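/- arXiv:2105.10632 — 3 statements merged into one kernel-verified Lean document; each statement's English description precedes it below -/
import Mathlib

section
/- Let k ≥ 1 be an integer and let G be an edge-colored graph on n vertices with n ≥ 4k − 4, whose average color degree satisfies d̂(G) ≥ 2k − 1, and which is not isomorphic (as an edge-colored graph) to K̃₄. Then G contains a rainbow matching of size k. -/
/-- The color degree of a vertex `v`: the number of distinct colors appearing
on edges of `G` incident to `v`. -/
noncomputable def colorDegree {V : Type*} (G : SimpleGraph V) (c : Sym2 V → ℕ) (v : V) : ℕ :=
  (c '' {e : Sym2 V | e ∈ G.edgeSet ∧ v ∈ e}).ncard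

/-- `M` is a rainbow matching in the edge-colored graph `(G, c)`:
a set of edges of `G`, pairwise vertex-disjoint, with pairwise distinct colors. -/
def IsRainbowMatching {V : Type*} (G : SimpleGraph V) (c : Sym2 V → ℕ)
    (M : Finset (Sym2 V)) : Prop :=
  ↑M ⊆ G.edgeSet ∧
  (∀ e ∈ M, ∀ f ∈ M, e ≠ f → ∀ v : V, v ∈ e → v ∉ f) ∧
  Set.InjOn c ↑M

/-- The canonical proper 3-edge-coloring of `K₄` in which every color class is a
perfect matching: the edge `{i, j}` gets color `i xor j`. -/
def k4Coloring : Sym2 (Fin 4) → ℕ :=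
  Sym2.lift ⟨fun i j => i.val ^^^ j.val, fun i j => Nat.xor_comm i.val j.val⟩

/-- `(G, c)` is isomorphic, as an edge-colored graph, to `K̃₄`: there is a bijection of the
vertex set with `Fin 4` under which `G` is complete and two edges of `G` have equal colors
iff the corresponding edges of `K̃₄` have equal colors. -/
def IsK4Tilde {V : Type*} (G : SimpleGraph V) (c : Sym2 V → ℕ) : Prop :=
  ∃ f : V ≃ Fin 4,
    (∀ u v : V, G.Adj u v ↔ u ≠ v) ∧
    (∀ u v w x : V, G.Adj u v → G.Adj w x →
      (c s(u, v) = c s(w, x) ↔ k4Coloring s(f u, f v) = k4Coloring s(f w, f x)))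



structure RCtx {V : Type*} (G : SimpleGraph V) (c : Sym2 V → ℕ) (K : ℕ)
    (f : Fin K → Bool → V) : Prop where
  adj : ∀ i t, G.Adj (f i t) (f i (!t))
  inj : ∀ i s j t, f i s = f j t → i = j ∧ s = t
  col : ∀ i j, c s(f i false, f i true) = c s(f j false, f j true) → i = j
  nomore : ¬ ∃ M : Finset (Sym2 V), IsRainbowMatching G c M ∧ M.card = K + 1

/-- color `q` is not used on the matching -/
def NewCol {V : Type*} (c : Sym2 V → ℕ) {K : ℕ} (f : Fin K → Bool → V) (q : ℕ) : Prop :=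
  ∀ i, c s(f i false, f i true) ≠ q

theorem list_rainbow {V : Type*} [DecidableEq V] (G : SimpleGraph V) (c : Sym2 V → ℕ)
    (l : List (V × V)) (hadj : ∀ p ∈ l, G.Adj p.1 p.2)
    (hv : (l.flatMap fun p => [p.1, p.2]).Nodup)
    (hc : (l.map fun p => c s(p.1, p.2)).Nodup) :
    IsRainbowMatching G c (l.map fun p => s(p.1, p.2)).toFinset ∧
      (l.map fun p => s(p.1, p.2)).toFinset.card = l.length := by
  induction l with
  | nil => simp [IsRainbowMatching]
  | cons p l ih =>
    simp only [List.flatMap_cons, List.nodup_append, List.map_cons, List.nodup_cons] at hv hc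
    obtain ⟨⟨h1, h2, h3⟩, h4⟩ := ih (fun q hq => hadj q (by simp [hq])) hv.2.1 hc.2
    have hp := hadj p (by simp)
    have hnot : ∀ q ∈ l, ∀ v, v ∈ s(p.1, p.2) → v ∉ s(q.1, q.2) := by
      intro q hq v hvp hvq
      refine hv.2.2 v ?_ v ?_ rfl
      · simpa using hvp
      · simp only [List.mem_flatMap]
        exact ⟨q, hq, by simpa using hvq⟩
    have hmem : s(p.1, p.2) ∉ (l.map fun p => s(p.1, p.2)).toFinset := by
      simp only [List.mem_toFinset, List.mem_map, not_exists, not_and]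
      intro q hq h
      exact hnot q hq p.1 (by simp) (by rw [h]; simp)
    refine ⟨⟨?_, ?_, ?_⟩, ?_⟩
    · intro e he
      simp only [List.map_cons, List.toFinset_cons, Finset.coe_insert, Set.mem_insert_iff] at he
      rcases he with rfl | he
      · exact hp
      · exact h1 he
    · intro e he e' he' hne v hv1 hv2
      simp only [List.map_cons, List.toFinset_cons, Finset.mem_insert] at he he'
      rcases he with rfl | he <;> rcases he' with rfl | he'
      · exact hne rfl
      · simp only [List.mem_toFinset, List.mem_map] at he'
        obtain ⟨q, hq, rfl⟩ := he'
        exact hnot q hq v hv1 hv2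
      · simp only [List.mem_toFinset, List.mem_map] at he
        obtain ⟨q, hq, rfl⟩ := he
        exact hnot q hq v hv2 hv1
      · exact h2 e he e' he' hne v hv1 hv2
    · simp only [List.map_cons, List.toFinset_cons, Finset.coe_insert]
      rw [Set.injOn_insert (by simpa using hmem)]
      refine ⟨h3, ?_⟩
      rintro ⟨e, he, hce⟩
      simp only [Finset.mem_coe, List.mem_toFinset, List.mem_map] at he
      obtain ⟨q, hq, rfl⟩ := he
      exact hc.1 (List.mem_map.2 ⟨q, hq, hce⟩)
    · simp only [List.map_cons, List.toFinset_cons, List.length_cons]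
      rw [Finset.card_insert_of_notMem hmem, h4]

theorem RCtx.aug {V : Type*} {G : SimpleGraph V} {c : Sym2 V → ℕ} {K : ℕ}
    {f : Fin K → Bool → V} (h : RCtx G c K f) (S : Finset (Fin K)) (l : List (V × V))
    (hadj : ∀ p ∈ l, G.Adj p.1 p.2)
    (hv : (l.flatMap fun p => [p.1, p.2]).Nodup)
    (hc : (l.map fun p => c s(p.1, p.2)).Nodup)
    (hlen : l.length = S.card + 1)
    (hS : ∀ p ∈ l, ∀ i t, (f i t = p.1 → i ∈ S) ∧ (f i t = p.2 → i ∈ S))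
    (hSc : ∀ p ∈ l, ∀ i, c s(f i false, f i true) = c s(p.1, p.2) → i ∈ S) : False := by
  classical
  obtain ⟨⟨h1, h2, h3⟩, h4⟩ := list_rainbow G c l hadj hv hc
  set N := (l.map fun p => s(p.1, p.2)).toFinset with hN
  have memN : ∀ e, e ∈ N ↔ ∃ p ∈ l, s(p.1, p.2) = e := by simp [hN]
  let E : Fin K → Sym2 V := fun i => s(f i false, f i true)
  have hEinj : Function.Injective E := fun i j hij => h.col i j (congrArg c hij)
  have memE : ∀ i v, v ∈ E i ↔ ∃ t, v = f i t := by
    intro i v; simp [E]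
  have hdis : ∀ i, i ∉ S → ∀ e ∈ N, ∀ v, v ∈ E i → v ∉ e := by
    intro i hi e he v hvi hve
    obtain ⟨p, hp, rfl⟩ := (memN e).1 he
    obtain ⟨t, rfl⟩ := (memE i v).1 hvi
    rcases Sym2.mem_iff.1 hve with hh | hh
    · exact hi ((hS p hp i t).1 hh)
    · exact hi ((hS p hp i t).2 hh)
  have hdisj : Disjoint (Sᶜ.image E) N := by
    rw [Finset.disjoint_left]
    intro e he heN
    obtain ⟨i, hi, rfl⟩ := Finset.mem_image.1 he
    have hv0 : f i false ∈ E i := by simp [E]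
    exact hdis i (Finset.mem_compl.1 hi) _ heN _ hv0 hv0
  apply h.nomore
  refine ⟨Sᶜ.image E ∪ N, ⟨?_, ?_, ?_⟩, ?_⟩
  · intro e he
    simp only [Finset.coe_union, Set.mem_union, Finset.mem_coe] at he
    rcases he with he | he
    · obtain ⟨i, hi, rfl⟩ := Finset.mem_image.1 he
      exact h.adj i false
    · exact h1 he
  · intro e he e' he' hne v hve hve'
    simp only [Finset.mem_union] at he he'
    rcases he with he | he <;> rcases he' with he' | he'
    · obtain ⟨i, hi, rfl⟩ := Finset.mem_image.1 he
      obtain ⟨j, hj, rfl⟩ := Finset.mem_image.1 he'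
      obtain ⟨t, rfl⟩ := (memE i v).1 hve
      obtain ⟨s, hs⟩ := (memE j _).1 hve'
      exact hne (congrArg E (h.inj _ _ _ _ hs).1)
    · obtain ⟨i, hi, rfl⟩ := Finset.mem_image.1 he
      exact hdis i (Finset.mem_compl.1 hi) _ he' _ hve hve'
    · obtain ⟨i, hi, rfl⟩ := Finset.mem_image.1 he'
      exact hdis i (Finset.mem_compl.1 hi) _ he _ hve' hve
    · exact h2 e he e' he' hne v hve hve'
  · rw [Finset.coe_union, Set.injOn_union (by exact_mod_cast hdisj)]
    refine ⟨?_, h3, ?_⟩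
    · intro e he e' he' hce
      obtain ⟨i, hi, rfl⟩ := Finset.mem_image.1 he
      obtain ⟨j, hj, rfl⟩ := Finset.mem_image.1 he'
      rw [h.col i j hce]
    · intro e he e' he' hce
      obtain ⟨i, hi, rfl⟩ := Finset.mem_image.1 he
      obtain ⟨p, hp, rfl⟩ := (memN e').1 he'
      exact Finset.mem_compl.1 hi (hSc p hp i hce)
  · rw [Finset.card_union_of_disjoint hdisj, Finset.card_image_of_injective _ hEinj, h4, hlen,
      Finset.card_compl, Fintype.card_fin]
    have := Finset.card_le_univ S
    rw [Fintype.card_fin] at this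
    omega

/-- abstract counting lemma -/
theorem pair_count {V : Type*} [DecidableEq V] (W : Finset V) (hW : 3 ≤ W.card)
    (P : Finset (V × ℕ)) (hh : Bool → V → ℕ) (val : Bool → V → Prop)
    (hP : ∀ p ∈ P, p.1 ∈ W ∧ ∃ t, val t p.1 ∧ hh t p.1 = p.2)
    (hcon : ∀ w ∈ W, ∀ w' ∈ W, val false w → val true w' → w = w' ∨ hh false w = hh true w') :
    P.card ≤ W.card + 1 := by
  classical
  let Dbl := W.filter fun w => val false w ∧ val true w ∧ hh false w ≠ hh true w
  by_cases hD : Dbl.card ≤ 1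
  · have hsub : P ⊆ (W.image fun w => (w, if val false w then hh false w else hh true w)) ∪
        Dbl.image fun w => (w, hh true w) := by
      intro p hp
      obtain ⟨hw, t, hv, hq⟩ := hP p hp
      obtain ⟨w, q⟩ := p
      simp only at hw hv hq
      simp only [Finset.mem_union, Finset.mem_image, Prod.mk.injEq, Dbl, Finset.mem_filter]
      cases t
      · left; exact ⟨w, hw, rfl, by simp [hv, hq]⟩
      · by_cases h1 : val false w
        · by_cases h2 : hh false w = hh true w
          · left; exact ⟨w, hw, rfl, by simp [h1, h2, hq]⟩
          · right; exact ⟨w, ⟨hw, h1, hv, h2⟩, rfl, hq⟩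
        · left; exact ⟨w, hw, rfl, by simp [h1, hq]⟩
    calc P.card ≤ _ := Finset.card_le_card hsub
      _ ≤ _ := Finset.card_union_le _ _
      _ ≤ W.card + Dbl.card := add_le_add Finset.card_image_le Finset.card_image_le
      _ ≤ _ := by omega
  · obtain ⟨w1, h1, w2, h2, h12⟩ := Finset.one_lt_card.1 (not_le.1 hD)
    simp only [Dbl, Finset.mem_filter] at h1 h2
    obtain ⟨m1, a1, b1, n1⟩ := h1
    obtain ⟨m2, a2, b2, n2⟩ := h2
    have e1 := (hcon w1 m1 w2 m2 a1 b2).resolve_left h12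
    have e2 := (hcon w2 m2 w1 m1 a2 b1).resolve_left (Ne.symm h12)
    have hsub : P ⊆ ({w1, w2} : Finset V) ×ˢ ({hh false w1, hh true w1} : Finset ℕ) := by
      intro p hp
      obtain ⟨hw, t, hv, hq⟩ := hP p hp
      obtain ⟨w, q⟩ := p
      simp only at hw hv hq
      simp only [Finset.mem_product, Finset.mem_insert, Finset.mem_singleton]
      by_cases hw1 : w = w1
      · subst hw1; cases t <;> simp [hq]
      by_cases hw2 : w = w2
      · subst hw2; cases t <;> grind
      exfalso
      cases t
      · have := hcon w hw w1 m1 hv b1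
        have := hcon w hw w2 m2 hv b2
        grind
      · have := hcon w1 m1 w hw a1 hv
        have := hcon w2 m2 w hw a2 hv
        grind
    have := Finset.card_le_card hsub
    rw [Finset.card_product] at this
    have c1 : ({w1, w2} : Finset V).card ≤ 2 := Finset.card_le_two
    have c2 : ({hh false w1, hh true w1} : Finset ℕ).card ≤ 2 := Finset.card_le_two
    nlinarith

structure DCtx {V : Type*} (G : SimpleGraph V) (c : Sym2 V → ℕ) (K : ℕ)
    (f : Fin K → Bool → V) (x : V) (D : Finset (Fin K)) : Prop extends RCtx G c K f where
  hx : ∀ i t, f i t ≠ x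
  dadj : ∀ i ∈ D, ∀ t, G.Adj x (f i t)
  dnew : ∀ i ∈ D, ∀ t, NewCol c f (c s(x, f i t))
  dinj : ∀ i ∈ D, ∀ j ∈ D, ∀ s t, c s(x, f i s) = c s(x, f j t) → i = j ∧ s = t

/-- vertex outside the matching and different from `x` -/
def InW {V : Type*} {K : ℕ} (f : Fin K → Bool → V) (x w : V) : Prop :=
  w ≠ x ∧ ∀ i t, f i t ≠ w

section claims
variable {V : Type*} {G : SimpleGraph V} {c : Sym2 V → ℕ} {K : ℕ}
    {f : Fin K → Bool → V} {x : V} {D : Finset (Fin K)}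

theorem RCtx.c1 (h : RCtx G c K f) {w v : V} (hw : ∀ i t, f i t ≠ w)
    (hwv : G.Adj w v) (hnew : NewCol c f (c s(w, v))) : ∃ i t, v = f i t := by
  by_contra hcon
  push Not at hcon
  have := hwv.ne
  refine h.aug ∅ [(w, v)] (by simpa using hwv) (by simpa using this) (by simp) (by simp) ?_ ?_
  · simp only [List.mem_singleton, forall_eq]; grind
  · simp only [List.mem_singleton, forall_eq]; grind [NewCol]

theorem RCtx.fne (h : RCtx G c K f) (i : Fin K) (t : Bool) : f i t ≠ f i (!t) := by
  intro hh
  have := (h.inj _ _ _ _ hh).2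
  cases t <;> simp at this

theorem RCtx.c3 (h : RCtx G c K f) {w w' : V} {i : Fin K} {t : Bool}
    (hw : ∀ i t, f i t ≠ w) (hw' : ∀ i t, f i t ≠ w') (hne : w ≠ w')
    (h1 : G.Adj (f i t) w) (n1 : NewCol c f (c s(f i t, w)))
    (h2 : G.Adj (f i (!t)) w') (n2 : NewCol c f (c s(f i (!t), w'))) :
    c s(f i t, w) = c s(f i (!t), w') := by
  by_contra hc
  have := h.fne i t
  have := h.inj
  refine h.aug {i} [(f i t, w), (f i (!t), w')] ?_ ?_ ?_ ?_ ?_ ?_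
  · simp [h1, h2]
  · simp; grind
  · simpa using hc
  · simp
  · simp only [List.mem_cons, List.not_mem_nil, or_false, forall_eq_or_imp, forall_eq,
      Finset.mem_singleton]
    grind
  · simp only [List.mem_cons, List.not_mem_nil, or_false, forall_eq_or_imp, forall_eq,
      Finset.mem_singleton]
    grind [NewCol]

theorem DCtx.c2 (h : DCtx G c K f x D) {w : V} {i : Fin K} (hi : i ∈ D) {t : Bool}
    (hw : InW f x w)
    (h1 : G.Adj (f i t) w) (n1 : NewCol c f (c s(f i t, w))) :
    c s(f i t, w) = c s(x, f i (!t)) := by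
  have h2 := (h.dadj i hi (!t)).symm
  have n2 := h.dnew i hi (!t)
  rw [Sym2.eq_swap] at n2
  rw [h.toRCtx.c3 hw.2 h.hx hw.1 h1 n1 h2 n2, Sym2.eq_swap]

theorem DCtx.lemX (h : DCtx G c K f x D) {w w0 v : V} {i : Fin K} (hi : i ∈ D) {t : Bool}
    (hw : InW f x w) (hw0 : InW f x w0) (hne : w0 ≠ w)
    (h0 : G.Adj (f i t) w0) (c0 : c s(f i t, w0) = c s(x, f i (!t)))
    (hv : G.Adj w v) (cv : c s(w, v) = c s(f i false, f i true)) :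
    ∃ j t', j ∉ D ∧ v = f j t' := by
  have hx := h.hx
  have hinj := h.inj
  have hfne := h.fne
  have hcol := h.col
  have hdadj := h.dadj
  have hdnew := h.dnew
  have hdinj := h.dinj
  obtain ⟨hwx, hwf⟩ := hw
  obtain ⟨hw0x, hw0f⟩ := hw0
  have hvw := hv.ne
  unfold NewCol at hdnew
  by_cases hcase : ∃ j t', v = f j t'
  · obtain ⟨j, t', rfl⟩ := hcase
    refine ⟨j, t', ?_, rfl⟩
    intro hj
    exfalso
    by_cases hij : j = i
    · subst hij
      refine h.aug {j} [(w, f j t'), (x, f j (!t'))] ?_ ?_ ?_ ?_ ?_ ?_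
      · simp [hv, hdadj j hj]
      · simp; grind
      · simp; grind
      · simp
      · simp only [List.mem_cons, List.not_mem_nil, or_false, forall_eq_or_imp, forall_eq,
          Finset.mem_singleton]
        grind
      · simp only [List.mem_cons, List.not_mem_nil, or_false, forall_eq_or_imp, forall_eq,
          Finset.mem_singleton]
        grind
    · refine h.aug {i, j} [(w, f j t'), (x, f j (!t')), (f i t, w0)] ?_ ?_ ?_ ?_ ?_ ?_
      · simp [hv, hdadj j hj, h0]
      · simp; grind
      · simp; grind
      · rw [Finset.card_pair (Ne.symm hij)]; rfl
      · simp only [List.mem_cons, List.not_mem_nil, or_false, forall_eq_or_imp, forall_eq,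
          Finset.mem_singleton, Finset.mem_insert]
        grind
      · simp only [List.mem_cons, List.not_mem_nil, or_false, forall_eq_or_imp, forall_eq,
          Finset.mem_singleton, Finset.mem_insert]
        grind
  · exfalso
    push Not at hcase
    by_cases hvx : v = x
    · subst hvx
      refine h.aug {i} [(f i t, w0), (w, v)] ?_ ?_ ?_ ?_ ?_ ?_
      · simp [hv, h0]
      · simp; grind
      · simp; grind
      · simp
      · simp only [List.mem_cons, List.not_mem_nil, or_false, forall_eq_or_imp, forall_eq,
          Finset.mem_singleton]
        grind
      · simp only [List.mem_cons, List.not_mem_nil, or_false, forall_eq_or_imp, forall_eq,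
          Finset.mem_singleton]
        grind
    · refine h.aug {i} [(x, f i t), (w, v)] ?_ ?_ ?_ ?_ ?_ ?_
      · simp [hv, hdadj i hi]
      · simp; grind
      · simp; grind
      · simp
      · simp only [List.mem_cons, List.not_mem_nil, or_false, forall_eq_or_imp, forall_eq,
          Finset.mem_singleton]
        grind
      · simp only [List.mem_cons, List.not_mem_nil, or_false, forall_eq_or_imp, forall_eq,
          Finset.mem_singleton]
        grind

/-- edges `i ∈ D` that can be freed while avoiding any two vertices outside -/
def Mono {V : Type*} (G : SimpleGraph V) (c : Sym2 V → ℕ) {K : ℕ}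
    (f : Fin K → Bool → V) (x : V) (D : Finset (Fin K)) (i : Fin K) : Prop :=
  i ∈ D ∧ ∀ w w', ∃ w'', w'' ≠ w ∧ w'' ≠ w' ∧ InW f x w'' ∧ ∃ t, G.Adj (f i t) w'' ∧
    c s(f i t, w'') = c s(x, f i (!t))

/-- new colors and colors of `Mono` edges -/
def FCol {V : Type*} (G : SimpleGraph V) (c : Sym2 V → ℕ) {K : ℕ}
    (f : Fin K → Bool → V) (x : V) (D : Finset (Fin K)) (q : ℕ) : Prop :=
  NewCol c f q ∨ ∃ i, Mono G c f x D i ∧ c s(f i false, f i true) = q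

theorem DCtx.c4half (h : DCtx G c K f x D) {w w' : V} {i j : Fin K} (hi : i ∈ D) (hj : j ∉ D)
    {t : Bool} (hw : InW f x w) (hw' : InW f x w') (hne : w ≠ w')
    (h1 : G.Adj (f j t) w) (n1 : c s(f i false, f i true) = c s(f j t, w))
    (h2 : G.Adj (f j (!t)) w') (n2 : NewCol c f (c s(f j (!t), w'))) : False := by
  have hx := h.hx
  have hinj := h.inj
  have hfne := h.fne
  have hcol := h.col
  have hdadj := h.dadj
  have hdnew := h.dnew
  have hdinj := h.dinj
  obtain ⟨hwx, hwf⟩ := hw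
  obtain ⟨hw'x, hw'f⟩ := hw'
  unfold NewCol at hdnew n2
  have hij : i ≠ j := by rintro rfl; exact hj hi
  obtain ⟨s, hs⟩ : ∃ s, c s(x, f i s) ≠ c s(f j (!t), w') := by
    by_contra hcon
    push Not at hcon
    have := (hdinj i hi i hi false true ((hcon false).trans (hcon true).symm)).2
    simp at this
  refine h.aug {i, j} [(f j t, w), (f j (!t), w'), (x, f i s)] ?_ ?_ ?_ ?_ ?_ ?_
  · simp [h1, h2, hdadj i hi]
  · simp; grind
  · simp; grind
  · rw [Finset.card_pair hij]; rfl
  · simp only [List.mem_cons, List.not_mem_nil, or_false, forall_eq_or_imp, forall_eq,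
      Finset.mem_singleton, Finset.mem_insert]
    grind
  · simp only [List.mem_cons, List.not_mem_nil, or_false, forall_eq_or_imp, forall_eq,
      Finset.mem_singleton, Finset.mem_insert]
    grind

theorem DCtx.c4 (h : DCtx G c K f x D) {w w' : V} {j : Fin K} (hj : j ∉ D)
    {t : Bool} (hw : InW f x w) (hw' : InW f x w') (hne : w ≠ w')
    (h1 : G.Adj (f j t) w) (n1 : FCol G c f x D (c s(f j t, w)))
    (h2 : G.Adj (f j (!t)) w') (n2 : FCol G c f x D (c s(f j (!t), w'))) :
    c s(f j t, w) = c s(f j (!t), w') := by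
  by_contra hcc
  rcases n1 with n1 | ⟨i1, m1, n1⟩ <;> rcases n2 with n2 | ⟨i2, m2, n2⟩
  · exact hcc (h.toRCtx.c3 hw.2 hw'.2 hne h1 n1 h2 n2)
  · exact h.c4half (t := !t) m2.1 hj hw' hw hne.symm h2 n2 (by simpa using h1) (by simpa using n1)
  · exact h.c4half m1.1 hj hw hw' hne h1 n1 h2 n2
  · have hx := h.hx
    have hinj := h.inj
    have hfne := h.fne
    have hcol := h.col
    have hdadj := h.dadj
    have hdnew := h.dnew
    have hdinj := h.dinj
    obtain ⟨hwx, hwf⟩ := hw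
    obtain ⟨hw'x, hw'f⟩ := hw'
    unfold NewCol at hdnew
    obtain ⟨d1, -⟩ := m1
    obtain ⟨d2, hm⟩ := m2
    obtain ⟨w'', e1, e2, ⟨hw''x, hw''f⟩, s, h3, n3⟩ := hm w w'
    have h1j : i1 ≠ j := by rintro rfl; exact hj d1
    have h2j : i2 ≠ j := by rintro rfl; exact hj d2
    have h12 : i1 ≠ i2 := by rintro rfl; exact hcc (n1.symm.trans n2)
    refine h.aug {i1, i2, j} [(f j t, w), (f j (!t), w'), (x, f i1 false), (f i2 s, w'')]
      ?_ ?_ ?_ ?_ ?_ ?_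
    · simp [h1, h2, hdadj i1 d1, h3]
    · simp; grind
    · simp; grind
    · rw [Finset.card_eq_three.2 ⟨i1, i2, j, h12, h1j, h2j, rfl⟩]; rfl
    · simp only [List.mem_cons, List.not_mem_nil, or_false, forall_eq_or_imp, forall_eq,
        Finset.mem_singleton, Finset.mem_insert]
      grind
    · simp only [List.mem_cons, List.not_mem_nil, or_false, forall_eq_or_imp, forall_eq,
        Finset.mem_singleton, Finset.mem_insert]
      grind

end claims

section counting
open Classical in
/-- finset of colors at `v` -/
noncomputable def colSet {V : Type*} [Fintype V] (G : SimpleGraph V) (c : Sym2 V → ℕ) (v : V) :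
    Finset ℕ := (Finset.univ.filter fun u => G.Adj v u).image fun u => c s(v, u)

theorem mem_colSet {V : Type*} [Fintype V] {G : SimpleGraph V} {c : Sym2 V → ℕ} {v : V} {q : ℕ} :
    q ∈ colSet G c v ↔ ∃ u, G.Adj v u ∧ c s(v, u) = q := by
  simp [colSet]

theorem colorDegree_eq {V : Type*} [Fintype V] (G : SimpleGraph V) (c : Sym2 V → ℕ) (v : V) :
    colorDegree G c v = (colSet G c v).card := by
  unfold colorDegree
  rw [← Set.ncard_coe_finset]
  congr 1
  ext q
  simp only [Set.mem_image, Set.mem_ofPred_eq, Finset.mem_coe, mem_colSet]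
  constructor
  · rintro ⟨e, ⟨he, hv⟩, rfl⟩
    obtain ⟨u, rfl⟩ := Sym2.mem_iff_exists.1 hv
    exact ⟨u, he, rfl⟩
  · rintro ⟨u, hu, rfl⟩
    exact ⟨s(v, u), ⟨hu, by simp⟩, rfl⟩

variable {V : Type*} [Fintype V] {G : SimpleGraph V} {c : Sym2 V → ℕ} {K : ℕ}
    {f : Fin K → Bool → V} {x : V} {D : Finset (Fin K)}

open Classical in
/-- pairs (vertex, color) -/
noncomputable def pairs (G : SimpleGraph V) (c : Sym2 V → ℕ) (W : Finset V) : Finset (V × ℕ) :=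
  W.biUnion fun w => (colSet G c w).image fun q => (w, q)

theorem mem_pairs {W : Finset V} {p : V × ℕ} :
    p ∈ pairs G c W ↔ p.1 ∈ W ∧ ∃ u, G.Adj p.1 u ∧ c s(p.1, u) = p.2 := by
  obtain ⟨w, q⟩ := p
  simp only [pairs, Finset.mem_biUnion, Finset.mem_image, Prod.mk.injEq, mem_colSet]
  constructor
  · rintro ⟨w, hw, q, hq, rfl, rfl⟩; exact ⟨hw, hq⟩
  · rintro ⟨hw, hq⟩; exact ⟨w, hw, q, hq, rfl, rfl⟩

theorem card_pairs (W : Finset V) :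
    (pairs G c W).card = ∑ w ∈ W, colorDegree G c w := by
  classical
  unfold pairs
  rw [Finset.card_biUnion]
  · refine Finset.sum_congr rfl fun w _ => ?_
    rw [Finset.card_image_of_injective _ (Prod.mk_right_injective w), colorDegree_eq]
  · intro w _ w' _ hne
    rw [Function.onFun, Finset.disjoint_left]
    intro p hp hp'
    simp only [Finset.mem_image] at hp hp'
    obtain ⟨q, -, rfl⟩ := hp
    obtain ⟨q', -, hq⟩ := hp'
    simp at hq
    exact hne hq.1.symm

open Classical in
/-- new-colored pairs through the matching edge `i` -/
noncomputable def nPairs (G : SimpleGraph V) (c : Sym2 V → ℕ) (f : Fin K → Bool → V)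
    (W : Finset V) (i : Fin K) : Finset (V × ℕ) :=
  (pairs G c W).filter fun p => NewCol c f p.2 ∧ ∃ t, G.Adj (f i t) p.1 ∧ c s(f i t, p.1) = p.2

open Classical in
/-- F-colored pairs through the matching edge `i` -/
noncomputable def fPairs (G : SimpleGraph V) (c : Sym2 V → ℕ) (f : Fin K → Bool → V) (x : V)
    (D : Finset (Fin K)) (W : Finset V) (i : Fin K) : Finset (V × ℕ) :=
  (pairs G c W).filter fun p => FCol G c f x D p.2 ∧
    ∃ t, G.Adj (f i t) p.1 ∧ c s(f i t, p.1) = p.2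

open Classical in
/-- pairs with the color of the matching edge `i` -/
noncomputable def oPairs (G : SimpleGraph V) (c : Sym2 V → ℕ) (f : Fin K → Bool → V)
    (W : Finset V) (i : Fin K) : Finset (V × ℕ) :=
  (pairs G c W).filter fun p => p.2 = c s(f i false, f i true)

theorem card_oPairs_le (W : Finset V) (i : Fin K) : (oPairs G c f W i).card ≤ W.card := by
  classical
  have : oPairs G c f W i ⊆ W.image fun w => (w, c s(f i false, f i true)) := by
    intro p hp
    simp only [oPairs, Finset.mem_filter, mem_pairs] at hp
    exact Finset.mem_image.2 ⟨p.1, hp.1.1, by rw [← hp.2]⟩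
  exact (Finset.card_le_card this).trans Finset.card_image_le

theorem DCtx.n3 (h : DCtx G c K f x D) {W : Finset V} (hW : ∀ w, w ∈ W ↔ InW f x w)
    {i : Fin K} (hi : i ∈ D) (hc : 3 ≤ (nPairs G c f W i).card) :
    ∃ t, ∀ p ∈ nPairs G c f W i, InW f x p.1 ∧ G.Adj (f i t) p.1 ∧
      c s(f i t, p.1) = c s(x, f i (!t)) ∧ p.2 = c s(x, f i (!t)) := by
  classical
  have key : ∀ p ∈ nPairs G c f W i, ∃ t, InW f x p.1 ∧ G.Adj (f i t) p.1 ∧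
      c s(f i t, p.1) = c s(x, f i (!t)) ∧ p.2 = c s(x, f i (!t)) := by
    intro p hp
    simp only [nPairs, Finset.mem_filter, mem_pairs, hW] at hp
    obtain ⟨⟨hw, -⟩, hn, t, ha, hq⟩ := hp
    have := h.c2 hi hw ha (by rw [hq]; exact hn)
    exact ⟨t, hw, ha, this, by rw [← this, hq]⟩
  by_contra hcon
  push Not at hcon
  choose T hT using key
  have hne : (nPairs G c f W i).Nonempty := Finset.card_pos.1 (by omega)
  obtain ⟨p0, hp0⟩ := hne
  -- an element with the opposite direction
  have hopp : ∀ p hp q hq, T p hp = !(T q hq) → p.1 = q.1 := by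
    intro p hp q hq hpq
    by_contra hne
    obtain ⟨a1, a2, a3, a4⟩ := hT p hp
    obtain ⟨b1, b2, b3, b4⟩ := hT q hq
    rw [hpq] at a2 a3
    have hh := h.toRCtx.c3 (t := T q hq) b1.2 a1.2 (Ne.symm hne) b2
      (by rw [b3]; exact h.dnew i hi _) a2 (by rw [a3]; exact h.dnew i hi _)
    rw [b3, a3] at hh
    have := (h.dinj i hi i hi _ _ hh).2
    revert this
    cases T q hq <;> simp
  obtain ⟨p1, hp1, hp1'⟩ := hcon (T p0 hp0)
  have hT1 : T p1 hp1 = !(T p0 hp0) := by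
    by_contra hcc
    have : T p1 hp1 = T p0 hp0 := by
      revert hcc; cases T p1 hp1 <;> cases T p0 hp0 <;> simp
    obtain ⟨a1, a2, a3, a4⟩ := hT p1 hp1
    rw [this] at a2 a3 a4
    exact hp1' a1 a2 a3 a4
  have hsub : nPairs G c f W i ⊆ {p0, p1} := by
    intro r hr
    simp only [Finset.mem_insert, Finset.mem_singleton]
    have e01 := hopp p1 hp1 p0 hp0 hT1
    by_cases hcc : T r hr = T p0 hp0
    · left
      have := hopp r hr p1 hp1 (by rw [hT1, hcc]; simp)
      refine Prod.ext (this.trans e01) ?_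
      rw [(hT r hr).2.2.2, (hT p0 hp0).2.2.2, hcc]
    · right
      have hcc' : T r hr = !(T p0 hp0) := by
        revert hcc; cases T r hr <;> cases T p0 hp0 <;> simp
      have := hopp r hr p0 hp0 hcc'
      refine Prod.ext (this.trans e01.symm) ?_
      rw [(hT r hr).2.2.2, (hT p1 hp1).2.2.2, hcc', hT1]
  have := (Finset.card_le_card hsub).trans Finset.card_le_two
  omega

theorem DCtx.n3card (h : DCtx G c K f x D) {W : Finset V} (hW : ∀ w, w ∈ W ↔ InW f x w)
    {i : Fin K} (hi : i ∈ D) (hc : 3 ≤ (nPairs G c f W i).card) :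
    (nPairs G c f W i).card ≤ W.card ∧ Mono G c f x D i := by
  classical
  obtain ⟨t, ht⟩ := h.n3 hW hi hc
  have hinj : Set.InjOn Prod.fst (nPairs G c f W i : Set (V × ℕ)) := by
    intro p hp q hq hpq
    refine Prod.ext hpq ?_
    rw [(ht p hp).2.2.2, (ht q hq).2.2.2]
  have hcard := Finset.card_image_of_injOn hinj
  constructor
  · rw [← hcard]
    apply Finset.card_le_card
    intro w hw
    obtain ⟨p, hp, rfl⟩ := Finset.mem_image.1 hw
    exact (hW _).2 (ht p hp).1
  · refine ⟨hi, fun w w' => ?_⟩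
    have : ∃ w'' ∈ (nPairs G c f W i).image Prod.fst, w'' ∉ ({w, w'} : Finset V) := by
      apply Finset.exists_mem_notMem_of_card_lt_card
      have : ({w, w'} : Finset V).card ≤ 2 := Finset.card_le_two
      omega
    obtain ⟨w'', hw'', hn⟩ := this
    obtain ⟨p, hp, rfl⟩ := Finset.mem_image.1 hw''
    simp only [Finset.mem_insert, Finset.mem_singleton, not_or] at hn
    obtain ⟨a1, a2, a3, a4⟩ := ht p hp
    exact ⟨p.1, hn.1, hn.2, a1, t, a2, a3⟩

theorem DCtx.count_full (h : DCtx G c K f x D) {W : Finset V} (hW : ∀ w, w ∈ W ↔ InW f x w)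
    (hD : ∀ i, i ∈ D) : ∑ w ∈ W, colorDegree G c w ≤ K * max W.card 3 := by
  classical
  rw [← card_pairs]
  have hcov : pairs G c W ⊆
      Finset.univ.biUnion fun i => nPairs G c f W i ∪ oPairs G c f W i := by
    intro p hp
    simp only [Finset.mem_biUnion, Finset.mem_univ, true_and, Finset.mem_union]
    have hp' := hp
    rw [mem_pairs, hW] at hp'
    obtain ⟨hw, v, hv, hq⟩ := hp'
    by_cases hn : NewCol c f p.2
    · obtain ⟨i, t, rfl⟩ := h.toRCtx.c1 hw.2 hv (by rw [hq]; exact hn)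
      refine ⟨i, Or.inl ?_⟩
      simp only [nPairs, Finset.mem_filter]
      exact ⟨hp, hn, t, hv.symm, by rw [Sym2.eq_swap, hq]⟩
    · unfold NewCol at hn
      push Not at hn
      obtain ⟨i, hi⟩ := hn
      refine ⟨i, Or.inr ?_⟩
      simp only [oPairs, Finset.mem_filter]
      exact ⟨hp, hi.symm⟩
  have hb : ∀ i, (nPairs G c f W i ∪ oPairs G c f W i).card ≤ max W.card 3 := by
    intro i
    have hno : ∀ p ∈ nPairs G c f W i, ∀ q ∈ oPairs G c f W i, p.1 = q.1 := by
      intro p hp q hq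
      by_contra hne
      simp only [nPairs, Finset.mem_filter, mem_pairs, hW] at hp
      simp only [oPairs, Finset.mem_filter, mem_pairs, hW] at hq
      obtain ⟨⟨hw, -⟩, hn, t, ha, hpq⟩ := hp
      obtain ⟨⟨hw', v, hv, hvq⟩, hqq⟩ := hq
      have h2 := h.c2 (hD i) hw ha (by rw [hpq]; exact hn)
      obtain ⟨j, t', hj, -⟩ := h.lemX (hD i) hw' hw hne ha h2 hv (by rw [hvq, hqq])
      exact hj (hD j)
    have hu := Finset.card_union_le (nPairs G c f W i) (oPairs G c f W i)
    have ho := card_oPairs_le (G := G) (c := c) (f := f) W i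
    have hoq : ∀ p ∈ oPairs G c f W i, p.2 = c s(f i false, f i true) := by
      intro p hp
      simp only [oPairs, Finset.mem_filter] at hp
      exact hp.2
    by_cases h0 : (nPairs G c f W i).card = 0
    · have := le_max_left W.card 3
      omega
    obtain ⟨p0, hp0⟩ := Finset.card_pos.1 (Nat.pos_of_ne_zero h0)
    have ho1 : (oPairs G c f W i).card ≤ 1 := by
      rw [Finset.card_le_one]
      intro a ha b hb
      exact Prod.ext ((hno p0 hp0 a ha).symm.trans (hno p0 hp0 b hb))
        ((hoq a ha).trans (hoq b hb).symm)
    by_cases h2 : (nPairs G c f W i).card ≤ 2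
    · have := le_max_right W.card 3
      omega
    have h3 : 3 ≤ (nPairs G c f W i).card := by omega
    have hle := (h.n3card hW (hD i) h3).1
    obtain ⟨t, ht⟩ := h.n3 hW (hD i) h3
    have ho0 : (oPairs G c f W i).card = 0 := by
      rw [Finset.card_eq_zero, Finset.eq_empty_iff_forall_notMem]
      intro q hq
      have : (nPairs G c f W i).card ≤ 1 := by
        rw [Finset.card_le_one]
        intro a ha b hb
        refine Prod.ext ((hno a ha q hq).trans (hno b hb q hq).symm) ?_
        rw [(ht a ha).2.2.2, (ht b hb).2.2.2]
      omega
    have := le_max_left W.card 3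
    omega
  calc (pairs G c W).card ≤ _ := Finset.card_le_card hcov
    _ ≤ ∑ i : Fin K, (nPairs G c f W i ∪ oPairs G c f W i).card := Finset.card_biUnion_le
    _ ≤ ∑ i : Fin K, max W.card 3 := Finset.sum_le_sum fun i _ => hb i
    _ = _ := by simp

theorem DCtx.count_gen (h : DCtx G c K f x D) {W : Finset V} (hW : ∀ w, w ∈ W ↔ InW f x w)
    (hW3 : 3 ≤ W.card) :
    ∑ w ∈ W, colorDegree G c w ≤ D.card * (W.card + 2) + (K - D.card) * (2 * W.card + 1) := by
  classical
  rw [← card_pairs]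
  let Q : Fin K → Finset (V × ℕ) := fun i =>
    if i ∈ D then (if Mono G c f x D i then nPairs G c f W i
      else nPairs G c f W i ∪ oPairs G c f W i)
    else fPairs G c f x D W i ∪ oPairs G c f W i
  have hcov : pairs G c W ⊆ Finset.univ.biUnion Q := by
    intro p hp
    simp only [Finset.mem_biUnion, Finset.mem_univ, true_and]
    have hp' := hp
    rw [mem_pairs, hW] at hp'
    obtain ⟨hw, v, hv, hq⟩ := hp'
    by_cases hn : NewCol c f p.2
    · obtain ⟨i, t, rfl⟩ := h.toRCtx.c1 hw.2 hv (by rw [hq]; exact hn)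
      have m1 : p ∈ nPairs G c f W i := by
        simp only [nPairs, Finset.mem_filter]
        exact ⟨hp, hn, t, hv.symm, by rw [Sym2.eq_swap, hq]⟩
      have m2 : p ∈ fPairs G c f x D W i := by
        simp only [fPairs, Finset.mem_filter]
        exact ⟨hp, Or.inl hn, t, hv.symm, by rw [Sym2.eq_swap, hq]⟩
      refine ⟨i, ?_⟩
      simp only [Q]
      split_ifs <;> simp [m1, m2]
    · unfold NewCol at hn
      push Not at hn
      obtain ⟨i, hi⟩ := hn
      by_cases hm : Mono G c f x D i
      · obtain ⟨w0, hw0, -, hw0W, t, ha, hc0⟩ := hm.2 p.1 p.1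
        obtain ⟨j, t', hj, rfl⟩ := h.lemX hm.1 hw hw0W hw0 ha hc0 hv (by rw [hq, hi])
        refine ⟨j, ?_⟩
        have m2 : p ∈ fPairs G c f x D W j := by
          simp only [fPairs, Finset.mem_filter]
          exact ⟨hp, Or.inr ⟨i, hm, hi⟩, t', hv.symm, by rw [Sym2.eq_swap, hq]⟩
        simp [Q, hj, m2]
      · refine ⟨i, ?_⟩
        have m3 : p ∈ oPairs G c f W i := by
          simp only [oPairs, Finset.mem_filter]
          exact ⟨hp, hi.symm⟩
        simp only [Q]
        split_ifs <;> simp [m3]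
  have hb : ∀ i, (Q i).card ≤ if i ∈ D then W.card + 2 else 2 * W.card + 1 := by
    intro i
    have ho := card_oPairs_le (G := G) (c := c) (f := f) W i
    simp only [Q]
    split_ifs with h1 h2
    · have : (nPairs G c f W i).card ≤ W.card + 1 := by
        by_cases h3 : 3 ≤ (nPairs G c f W i).card
        · have := (h.n3card hW h1 h3).1
          omega
        · omega
      omega
    · have h3 : ¬ 3 ≤ (nPairs G c f W i).card := fun h3 => h2 (h.n3card hW h1 h3).2
      have hu := Finset.card_union_le (nPairs G c f W i) (oPairs G c f W i)
      omega
    · have hu := Finset.card_union_le (fPairs G c f x D W i) (oPairs G c f W i)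
      have : (fPairs G c f x D W i).card ≤ W.card + 1 := by
        apply pair_count W hW3 _ (fun t w => c s(f i t, w))
          (fun t w => G.Adj (f i t) w ∧ FCol G c f x D (c s(f i t, w)))
        · intro p hp
          simp only [fPairs, Finset.mem_filter, mem_pairs] at hp
          obtain ⟨⟨hw, -⟩, hF, t, ha, hq⟩ := hp
          exact ⟨hw, t, ⟨ha, by rw [hq]; exact hF⟩, hq⟩
        · intro w hw w' hw' hv1 hv2
          by_cases hne : w = w'
          · exact Or.inl hne
          · exact Or.inr (h.c4 (t := false) h1 ((hW _).1 hw) ((hW _).1 hw') hne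
              hv1.1 hv1.2 hv2.1 hv2.2)
      omega
  calc (pairs G c W).card ≤ _ := Finset.card_le_card hcov
    _ ≤ ∑ i : Fin K, (Q i).card := Finset.card_biUnion_le
    _ ≤ ∑ i : Fin K, if i ∈ D then W.card + 2 else 2 * W.card + 1 :=
        Finset.sum_le_sum fun i _ => hb i
    _ = _ := by
      rw [Finset.sum_ite]
      have e1 : (Finset.univ.filter fun i => i ∈ D) = D := by ext; simp
      have e2 : (Finset.univ.filter fun i => i ∉ D) = Dᶜ := by ext; simp
      rw [e1, e2, Finset.sum_const, Finset.sum_const, Finset.card_compl, Fintype.card_fin]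
      simp

end counting

section final
variable {V : Type*} [Fintype V] {c : Sym2 V → ℕ} {K : ℕ}
  {f : Fin K → Bool → V} {x : V}

/-- choose representatives of the new colors at `x` -/
theorem RCtx.exists_D {G : SimpleGraph V} (h : RCtx G c K f) (hK : 0 < K)
    (hx : ∀ i t, f i t ≠ x) :
    ∃ D : Finset (Fin K), DCtx G c K f x D ∧ colorDegree G c x ≤ 2 * K + D.card := by
  classical
  have : Nonempty (Fin K × Bool) := ⟨(⟨0, hK⟩, false)⟩
  set C := (colSet G c x).filter (fun q => NewCol c f q) with hC
  have hg : ∀ q, q ∈ C → ∃ p : Fin K × Bool, G.Adj x (f p.1 p.2) ∧ c s(x, f p.1 p.2) = q := by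
    intro q hq
    rw [hC, Finset.mem_filter, mem_colSet] at hq
    obtain ⟨⟨u, hu, rfl⟩, hn⟩ := hq
    obtain ⟨i, t, rfl⟩ := h.c1 hx hu hn
    exact ⟨(i, t), hu, rfl⟩
  choose! g hg1 hg2 using hg
  set R := C.image g with hR
  have hRc : R.card = C.card := by
    apply Finset.card_image_of_injOn
    intro q hq q' hq' hh
    have h1 := hg2 q hq
    rw [hh, hg2 q' hq'] at h1
    exact h1.symm
  have hRp : ∀ i t, (i, t) ∈ R → c s(x, f i t) ∈ C ∧ g (c s(x, f i t)) = (i, t) ∧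
      G.Adj x (f i t) := by
    intro i t hit
    rw [hR, Finset.mem_image] at hit
    obtain ⟨q, hq, hgq⟩ := hit
    have h1 := hg1 q hq
    have h2 := hg2 q hq
    rw [hgq] at h1 h2
    simp only at h1 h2
    rw [h2]
    exact ⟨hq, hgq, h1⟩
  let A : Finset (Fin K) := Finset.univ.filter fun i => (i, false) ∈ R
  let B : Finset (Fin K) := Finset.univ.filter fun i => (i, true) ∈ R
  have hAB : ∀ i, i ∈ A ∩ B → ∀ t, (i, t) ∈ R := by
    intro i hi t
    simp only [A, B, Finset.mem_inter, Finset.mem_filter, Finset.mem_univ, true_and] at hi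
    cases t
    · exact hi.1
    · exact hi.2
  refine ⟨A ∩ B, { toRCtx := h, hx := hx, dadj := ?_, dnew := ?_, dinj := ?_ }, ?_⟩
  · intro i hi t
    exact (hRp i t (hAB i hi t)).2.2
  · intro i hi t
    exact (Finset.mem_filter.1 (hRp i t (hAB i hi t)).1).2
  · intro i hi j hj s t hh
    have h1 := (hRp i s (hAB i hi s)).2.1
    have h2 := (hRp j t (hAB j hj t)).2.1
    rw [hh, h2] at h1
    simp only [Prod.mk.injEq] at h1
    exact ⟨h1.1.symm, h1.2.symm⟩
  · have hsub : R ⊆ A.image (fun i => (i, false)) ∪ B.image (fun i => (i, true)) := by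
      rintro ⟨i, t⟩ hit
      cases t <;> simp [A, B, hit]
    have h1 : R.card ≤ A.card + B.card :=
      (Finset.card_le_card hsub).trans ((Finset.card_union_le _ _).trans
        (Nat.add_le_add Finset.card_image_le Finset.card_image_le))
    have h2 := Finset.card_union_add_card_inter A B
    have h3 : (A ∪ B).card ≤ K := by simpa using Finset.card_le_univ (A ∪ B)
    have h4 : colSet G c x ⊆ C ∪ Finset.univ.image (fun i => c s(f i false, f i true)) := by
      intro q hq
      by_cases hn : NewCol c f q
      · simp [hC, hq, hn]
      · unfold NewCol at hn
        push Not at hn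
        simp [hn]
    have h5 : (colSet G c x).card ≤ C.card + K :=
      (Finset.card_le_card h4).trans ((Finset.card_union_le _ _).trans
        (Nat.add_le_add le_rfl (Finset.card_image_le.trans (by simp))))
    rw [colorDegree_eq]
    omega

theorem index_matching {V : Type*} {c : Sym2 V → ℕ} {K : ℕ} {G : SimpleGraph V} {M : Finset (Sym2 V)} (hM : IsRainbowMatching G c M)
    (hc : M.card = K) :
    ∃ f : Fin K → Bool → V, (∀ i t, G.Adj (f i t) (f i (!t))) ∧
      (∀ i s j t, f i s = f j t → i = j ∧ s = t) ∧
      (∀ i j, c s(f i false, f i true) = c s(f j false, f j true) → i = j) := by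
  subst hc
  obtain ⟨h1, h2, h3⟩ := hM
  let e := M.equivFin.symm
  have hr : ∀ i, ∃ p : V × V, s(p.1, p.2) = (e i : Sym2 V) := by
    intro i
    induction h : (e i : Sym2 V) using Sym2.ind with
    | _ a b => exact ⟨(a, b), rfl⟩
  choose p hp using hr
  have hadj : ∀ i, G.Adj (p i).1 (p i).2 := by
    intro i
    rw [← SimpleGraph.mem_edgeSet, hp]
    exact h1 (e i).2
  let f : Fin M.card → Bool → V := fun i t => if t then (p i).2 else (p i).1
  have hf : ∀ i, s(f i false, f i true) = (e i : Sym2 V) := by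
    intro i; simp [f, hp]
  have hmem : ∀ i t, f i t ∈ (e i : Sym2 V) := by
    intro i t
    rw [← hf]
    cases t <;> simp
  have ha : ∀ i t, G.Adj (f i t) (f i (!t)) := by
    intro i t
    cases t
    · exact hadj i
    · exact (hadj i).symm
  refine ⟨f, ha, ?_, ?_⟩
  · intro i s j t hh
    have hij : i = j := by
      by_contra hne
      have : (e i : Sym2 V) ≠ e j := fun h => hne (e.injective (Subtype.ext h))
      exact h2 _ (e i).2 _ (e j).2 this _ (hmem i s) (hh ▸ hmem j t)
    subst hij
    refine ⟨rfl, ?_⟩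
    have := (ha i false).ne
    cases s <;> cases t <;> simp_all
  · intro i j hh
    rw [hf, hf] at hh
    exact e.injective (Subtype.ext (h3 (e i).2 (e j).2 hh))

/-- isolate the vertex `x` -/
def isol {V : Type*} (G : SimpleGraph V) (x : V) : SimpleGraph V where
  Adj u v := G.Adj u v ∧ u ≠ x ∧ v ≠ x
  symm := ⟨fun _ _ h => ⟨h.1.symm, h.2.2, h.2.1⟩⟩
  loopless := ⟨fun _ h => G.loopless.irrefl _ h.1⟩

theorem isol_sum (G : SimpleGraph V) (x : V) :
    ∑ v, colorDegree G c v + 1 ≤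
      colorDegree G c x + ∑ v, colorDegree (isol G x) c v + Fintype.card V := by
  classical
  have h1 : ∀ v, colorDegree G c v ≤ colorDegree (isol G x) c v + 1 +
      (if v = x then colorDegree G c x - 1 else 0) := by
    intro v
    split_ifs with hv
    · subst hv; omega
    · rw [colorDegree_eq, colorDegree_eq, add_zero]
      have : colSet G c v ⊆ insert (c s(v, x)) (colSet (isol G x) c v) := by
        intro q hq
        rw [mem_colSet] at hq
        obtain ⟨u, hu, rfl⟩ := hq
        by_cases hux : u = x
        · subst hux; simp
        · rw [Finset.mem_insert, mem_colSet]
          exact Or.inr ⟨u, ⟨hu, hv, hux⟩, rfl⟩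
      exact (Finset.card_le_card this).trans (Finset.card_insert_le _ _)
  have h2 := Finset.sum_le_sum fun v (_ : v ∈ Finset.univ) => h1 v
  rw [Finset.sum_add_distrib, Finset.sum_add_distrib, Finset.sum_ite_eq'] at h2
  simp only [Finset.mem_univ, if_true, Finset.sum_const, Finset.card_univ, smul_eq_mul,
    mul_one] at h2
  by_cases h0 : colorDegree G c x = 0
  · have h3 : ∀ v, colorDegree G c v ≤ colorDegree (isol G x) c v + (if v = x then 0 else 1) := by
      intro v
      split_ifs with hv
      · subst hv; omega
      · have := h1 v
        rw [if_neg hv] at this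
        exact this
    have h4 := Finset.sum_le_sum fun v (_ : v ∈ Finset.univ) => h3 v
    rw [Finset.sum_add_distrib] at h4
    have h5 : (∑ v, if v = x then 0 else 1) + 1 ≤ Fintype.card V := by
      have e : ∀ v, (if v = x then 0 else 1) + (if v = x then 1 else 0) = 1 := by
        intro v; split_ifs <;> rfl
      have : ∑ v : V, ((if v = x then 0 else 1) + (if v = x then 1 else 0)) = Fintype.card V := by
        simp [e]
      rw [Finset.sum_add_distrib, Finset.sum_ite_eq'] at this
      simp at this ⊢
      omega
    omega
  · omega

theorem colorDegree_lt (G : SimpleGraph V) (x : V) : colorDegree G c x + 1 ≤ Fintype.card V := by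
  classical
  rw [colorDegree_eq]
  have h1 : colSet G c x ⊆ (Finset.univ.erase x).image fun u => c s(x, u) := by
    intro q hq
    rw [mem_colSet] at hq
    obtain ⟨u, hu, rfl⟩ := hq
    rw [Finset.mem_image]
    exact ⟨u, by simp [hu.ne.symm], rfl⟩
  have h2 := (Finset.card_le_card h1).trans Finset.card_image_le
  rw [Finset.card_erase_of_mem (Finset.mem_univ x), Finset.card_univ] at h2
  have : 0 < Fintype.card V := Fintype.card_pos_iff.2 ⟨x⟩
  omega

theorem k4_arith : ∀ i j k l : Fin 4, i ≠ j → k ≠ l →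
    (k4Coloring s(i, j) = k4Coloring s(k, l) ↔
      ((i = k ∧ j = l) ∨ (i = l ∧ j = k) ∨ (i ≠ k ∧ i ≠ l ∧ j ≠ k ∧ j ≠ l))) := by
  decide

/-- the exceptional case -/
theorem k4_case (G : SimpleGraph V) (hV : Fintype.card V = 4)
    (hT : 12 ≤ ∑ v, colorDegree G c v)
    (hno : ¬ ∃ M : Finset (Sym2 V), IsRainbowMatching G c M ∧ M.card = 2) : IsK4Tilde G c := by
  classical
  have hle : ∀ v, colorDegree G c v ≤ 3 := fun v => by
    have := colorDegree_lt (c := c) G v; omega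
  have heq : ∀ v, colorDegree G c v = 3 := by
    have h1 : ∑ v, colorDegree G c v = ∑ v : V, 3 := by
      apply le_antisymm (Finset.sum_le_sum fun v _ => hle v)
      simp [hV]; omega
    have h2 := (Finset.sum_eq_sum_iff_of_le fun v _ => hle v).1 h1
    exact fun v => h2 v (Finset.mem_univ v)
  have hsurj : ∀ v, (G.neighborFinset v).card = 3 ∧
      Set.InjOn (fun u => c s(v, u)) (G.neighborFinset v) := by
    intro v
    have h1 : colSet G c v ⊆ (G.neighborFinset v).image fun u => c s(v, u) := by
      intro q hq
      rw [mem_colSet] at hq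
      obtain ⟨u, hu, rfl⟩ := hq
      rw [Finset.mem_image]
      exact ⟨u, by simpa using hu, rfl⟩
    have h2 := Finset.card_le_card h1
    rw [← colorDegree_eq, heq] at h2
    have h3 := Finset.card_image_le (s := G.neighborFinset v) (f := fun u => c s(v, u))
    have h4 : (G.neighborFinset v).card < 4 := by
      have := G.degree_lt_card_verts v
      rw [hV] at this
      exact this
    refine ⟨by omega, Finset.card_image_iff.1 (by omega)⟩
  have hcomp : ∀ u v, G.Adj u v ↔ u ≠ v := by
    intro u v
    refine ⟨fun h => h.ne, fun h => ?_⟩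
    have h1 : G.neighborFinset u = Finset.univ.erase u := by
      apply Finset.eq_of_subset_of_card_le
      · intro w hw
        have : G.Adj u w := by simpa using hw
        simp [this.ne.symm]
      · rw [Finset.card_erase_of_mem (Finset.mem_univ u), Finset.card_univ, hV, (hsurj u).1]
    have : v ∈ G.neighborFinset u := by rw [h1]; simp [h.symm]
    simpa using this
  have hprop : ∀ u v w, u ≠ v → u ≠ w → c s(u, v) = c s(u, w) → v = w := by
    intro u v w hv hw hh
    exact (hsurj u).2 (by simpa using (hcomp u v).2 hv) (by simpa using (hcomp u w).2 hw) hh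
  have hopp : ∀ u v w y, u ≠ v → w ≠ y → u ≠ w → u ≠ y → v ≠ w → v ≠ y →
      c s(u, v) = c s(w, y) := by
    intro u v w y h1 h2 h3 h4 h5 h6
    by_contra hne
    apply hno
    refine ⟨_, list_rainbow G c [(u, v), (w, y)] ?_ ?_ ?_⟩
    · simp [hcomp, h1, h2]
    · simp [*]
    · simpa using hne
  refine ⟨Fintype.equivFinOfCardEq hV, hcomp, ?_⟩
  intro u v w y huv hwy
  set F := Fintype.equivFinOfCardEq hV
  have huv' := huv.ne
  have hwy' := hwy.ne
  rw [k4_arith _ _ _ _ (F.injective.ne huv') (F.injective.ne hwy')]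
  simp only [ne_eq, EmbeddingLike.apply_eq_iff_eq]
  constructor
  · intro hh
    by_cases a1 : u = w
    · subst a1
      exact Or.inl ⟨rfl, hprop u v y huv' hwy' hh⟩
    by_cases a2 : u = y
    · subst a2
      rw [Sym2.eq_swap (a := w)] at hh
      exact Or.inr (Or.inl ⟨rfl, hprop u v w huv' (Ne.symm hwy') hh⟩)
    by_cases a3 : v = w
    · subst a3
      rw [Sym2.eq_swap (a := u)] at hh
      exact absurd (hprop v u y (Ne.symm huv') hwy' hh) a2
    by_cases a4 : v = y
    · subst a4
      rw [Sym2.eq_swap (a := u), Sym2.eq_swap (a := w)] at hh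
      exact absurd (hprop v u w (Ne.symm huv') (Ne.symm hwy') hh) a1
    exact Or.inr (Or.inr ⟨a1, a2, a3, a4⟩)
  · rintro (⟨rfl, rfl⟩ | ⟨rfl, rfl⟩ | ⟨a1, a2, a3, a4⟩)
    · rfl
    · rw [Sym2.eq_swap]
    · exact hopp u v w y huv' hwy' a1 a2 a3 a4

theorem main_nat (V : Type*) [Fintype V] (c : Sym2 V → ℕ) (hpos : 0 < Fintype.card V) (K : ℕ) :
    ∀ G : SimpleGraph V, 4 * K ≤ Fintype.card V →
      (2 * K + 1) * Fintype.card V ≤ ∑ v, colorDegree G c v → ¬ IsK4Tilde G c →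
      ∃ M : Finset (Sym2 V), IsRainbowMatching G c M ∧ M.card = K + 1 := by
  classical
  induction K with
  | zero =>
    intro G _ hT _
    have h1 : ∑ v, colorDegree G c v ≠ 0 := by omega
    obtain ⟨v, -, hv⟩ := Finset.exists_ne_zero_of_sum_ne_zero h1
    rw [colorDegree_eq, Finset.card_ne_zero] at hv
    obtain ⟨q, hq⟩ := hv
    rw [mem_colSet] at hq
    obtain ⟨u, hu, -⟩ := hq
    exact ⟨_, list_rainbow G c [(v, u)] (by simpa using hu) (by simpa using hu.ne) (by simp)⟩
  | succ K' ih =>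
    intro G hn hT hK4
    by_contra hno
    have : Nonempty V := Fintype.card_pos_iff.1 hpos
    obtain ⟨x, -, hmax⟩ := Finset.exists_max_image Finset.univ (fun v => colorDegree G c v)
      ⟨Classical.arbitrary V, Finset.mem_univ _⟩
    have hlt := colorDegree_lt (c := c) G x
    have hΔ : 2 * (K' + 1) + 1 ≤ colorDegree G c x := by
      have h1 : ∑ v, colorDegree G c v ≤ Fintype.card V * colorDegree G c x := by
        rw [← smul_eq_mul, ← Finset.card_univ]
        exact Finset.sum_le_card_nsmul _ _ _ fun v hv => hmax v hv
      by_contra hcon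
      nlinarith
    have hiso := isol_sum (c := c) G x
    obtain ⟨M, hM, hMc⟩ := ih (isol G x) (by omega) (by nlinarith) (by
      rintro ⟨F, h1, -⟩
      obtain ⟨y, hy⟩ : ∃ y, x ≠ y := by
        have : 1 < Fintype.card V := by omega
        obtain ⟨y, hy⟩ := Fintype.exists_ne_of_one_lt_card this x
        exact ⟨y, hy.symm⟩
      exact ((h1 x y).2 hy).2.1 rfl)
    obtain ⟨K, hKdef⟩ : ∃ K, K = K' + 1 := ⟨_, rfl⟩
    simp only [← hKdef] at hn hT hno hΔ hMc
    obtain ⟨f, f1, f2, f3⟩ := index_matching hM hMc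
    have hR : RCtx G c K f := ⟨fun i t => (f1 i t).1, f2, f3, hno⟩
    have hx : ∀ i t, f i t ≠ x := fun i t => (f1 i t).2.1
    obtain ⟨D, hD, hDc⟩ := hR.exists_D (by omega) hx
    have hDK : D.card ≤ K := by simpa using Finset.card_le_univ D
    let W : Finset V := Finset.univ.filter fun w => InW f x w
    have hW : ∀ w, w ∈ W ↔ InW f x w := by simp [W]
    let U : Finset V := insert x (Finset.univ.image fun p : Fin K × Bool => f p.1 p.2)
    have hU : U.card = 2 * K + 1 := by
      rw [Finset.card_insert_of_notMem, Finset.card_image_of_injective]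
      · simp; omega
      · rintro ⟨i, s⟩ ⟨j, t⟩ hh
        obtain ⟨rfl, rfl⟩ := f2 _ _ _ _ hh
        rfl
      · simp only [Finset.mem_image, Finset.mem_univ, true_and, not_exists]
        exact fun p => hx _ _
    have hUW : Uᶜ = W := by
      ext w
      rw [hW]
      simp only [U, InW, Finset.mem_compl, Finset.mem_insert, Finset.mem_image,
        Finset.mem_univ, true_and, not_or, not_exists, Prod.forall, ne_eq]
    have hWc : W.card + (2 * K + 1) = Fintype.card V := by
      rw [← hUW, ← hU, add_comm]; exact Finset.card_add_card_compl U
    have hsum : ∑ v, colorDegree G c v ≤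
        (2 * K + 1) * colorDegree G c x + ∑ w ∈ W, colorDegree G c w := by
      rw [← Finset.sum_add_sum_compl U, hUW, ← hU]
      gcongr
      rw [← smul_eq_mul]
      exact Finset.sum_le_card_nsmul _ _ _ fun v _ => hmax v (Finset.mem_univ v)
    generalize hDel : colorDegree G c x = Δ at *
    generalize hTT : ∑ v, colorDegree G c v = T at *
    generalize hWW : W.card = w at *
    generalize hN : Fintype.card V = n at *
    by_cases hfull : D.card = K
    · have hDu : ∀ i, i ∈ D := by
        have : D = Finset.univ := by
          rw [← Finset.card_eq_iff_eq_univ]; simpa using hfull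
        simp [this]
      have h1 := hD.count_full hW hDu
      rw [hWW] at h1
      by_cases h3 : 3 ≤ w
      · rw [max_eq_left h3] at h1
        nlinarith
      · rw [max_eq_right (by omega)] at h1
        have hK1 : K = 1 := by omega
        have hT' : (2 * 1 + 1) * n ≤ T := by rw [hK1] at hT; exact hT
        have hs' : T ≤ (2 * 1 + 1) * Δ + ∑ w ∈ W, colorDegree G c w := by
          have := hsum
          rw [show 2 * K + 1 = 2 * 1 + 1 by omega] at this
          exact this
        have hno' : ¬ ∃ M : Finset (Sym2 V), IsRainbowMatching G c M ∧ M.card = 2 := by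
          rw [show 2 = K + 1 by omega]; exact hno
        by_cases hn4 : n = 4
        · exact hK4 (k4_case G (hN.trans hn4) (by omega) hno')
        · omega
    · have hw3 : 3 ≤ w := by omega
      have h1 := hD.count_gen hW (by omega)
      rw [hWW] at h1
      generalize hs : D.card = s at *
      obtain ⟨r, hr⟩ : ∃ r, K = s + r := ⟨K - s, by omega⟩
      obtain ⟨a, ha⟩ : ∃ a, Δ = 2 * K + a := ⟨Δ - 2 * K, by omega⟩
      obtain ⟨b, hb⟩ : ∃ b, s = a + b := ⟨s - a, by omega⟩
      obtain ⟨h, hh⟩ : ∃ h, n = 4 * K + h := ⟨n - 4 * K, by omega⟩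
      have hKs : K - s = r := by omega
      rw [hKs] at h1
      have hr1 : 1 ≤ r := by omega
      have hwe : w + 1 = 2 * K + h := by omega
      subst hr ha hb hh
      obtain ⟨w', rfl⟩ : ∃ w', w = w' + 3 := ⟨w - 3, by omega⟩
      nlinarith [Nat.zero_le (b * w'), Nat.zero_le (h * a), Nat.zero_le (h*b)]

end final

/-- Theorem 3 (Zhou): every edge-colored graph `G` on `n ≥ 4k - 4` vertices with average
color degree at least `2k - 1`, other than `K̃₄`, contains a rainbow matching of size `k`. -/
theorem large_rainbow_matching_avg_color_degree
    {V : Type*} [Fintype V] (k : ℕ) (hk : 1 ≤ k)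
    (G : SimpleGraph V) (c : Sym2 V → ℕ)
    (hn : 4 * k - 4 ≤ Fintype.card V)
    (havg : (2 * (k : ℚ) - 1) ≤ (∑ v, (colorDegree G c v : ℚ)) / (Fintype.card V : ℚ))
    (hK4 : ¬ IsK4Tilde G c) :
    ∃ M : Finset (Sym2 V), IsRainbowMatching G c M ∧ M.card = k := by
  obtain ⟨K, rfl⟩ : ∃ K, k = K + 1 := ⟨k - 1, by omega⟩
  have hpos : 0 < Fintype.card V := by
    rcases Nat.eq_zero_or_pos (Fintype.card V) with h0 | h0
    · rw [h0] at havg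
      push_cast at havg
      rw [div_zero] at havg
      have : (0 : ℚ) ≤ K := by positivity
      linarith
    · exact h0
  refine main_nat V c hpos K G (by omega) ?_ hK4
  have hq : (0 : ℚ) < Fintype.card V := by exact_mod_cast hpos
  rw [le_div_iff₀ hq] at havg
  have : (((2 * K + 1) * Fintype.card V : ℕ) : ℚ) ≤ ((∑ v, colorDegree G c v : ℕ) : ℚ) := by
    push_cast
    push_cast at havg
    linarith
  exact_mod_cast this
end

section
/- Let G be a strongly edge-colored graph with minimum degree δ(G) and |V(G)| ≥ 2δ(G) + 1. Then G contains a rainbow matching of size at least δ(G). -/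
/-- `(G, c)` is strongly edge-colored: for each color, the edges of that color form an
induced matching, i.e. any two distinct edges of the same color neither share a vertex
nor are joined by an edge of `G`. -/
def StronglyEdgeColored {V : Type*} (G : SimpleGraph V) (c : Sym2 V → ℕ) : Prop :=
  ∀ e ∈ G.edgeSet, ∀ f ∈ G.edgeSet, e ≠ f → c e = c f →
    ∀ u v : V, u ∈ e → v ∈ f → u ≠ v ∧ ¬ G.Adj u v


namespace RainbowAux
open Finset
open scoped Classical

variable {V : Type*}

/-- Two edges of the same color with equal or adjacent endpoints coincide. -/
lemma strong_eq {G : SimpleGraph V} {c : Sym2 V → ℕ} (hs : StronglyEdgeColored G c)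
    {a b a' b' : V} (h : G.Adj a b) (h' : G.Adj a' b') (hc : c s(a, b) = c s(a', b'))
    (haa : a = a' ∨ G.Adj a a') : s(a, b) = s(a', b') := by
  by_contra hne
  have := hs s(a, b) h s(a', b') h' hne hc a a' (by simp) (by simp)
  tauto

/-- Extending a rainbow matching by a list of edges. -/
lemma extendL {G : SimpleGraph V} {c : Sym2 V → ℕ} (L : List (V × V)) (N : Finset (Sym2 V))
    (hN : IsRainbowMatching G c N) (hadj : ∀ p ∈ L, G.Adj p.1 p.2)
    (hnd : (L.flatMap (fun p => [p.1, p.2])).Nodup)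
    (hcd : (L.map (fun p => c s(p.1, p.2))).Nodup)
    (hv : ∀ v ∈ L.flatMap (fun p => [p.1, p.2]), ∀ e ∈ N, v ∉ e)
    (hcN : ∀ p ∈ L, ∀ e ∈ N, c s(p.1, p.2) ≠ c e) :
    ∃ N' : Finset (Sym2 V), IsRainbowMatching G c N' ∧ N'.card = N.card + L.length := by
  induction L generalizing N with
  | nil => exact ⟨N, hN, by simp⟩
  | cons p L ih =>
    obtain ⟨x, y⟩ := p
    simp only [List.flatMap_cons, List.cons_append, List.nil_append, List.nodup_cons,
      List.mem_cons, List.map_cons, not_or, forall_eq_or_imp] at *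
    obtain ⟨hxy, hadj⟩ := hadj
    obtain ⟨⟨hxy', hxL⟩, hyL, hnd⟩ := hnd
    obtain ⟨hc1, hcd⟩ := hcd
    obtain ⟨hvx, hvy, hv⟩ := hv
    obtain ⟨hc0, hcN⟩ := hcN
    have hnot : s(x, y) ∉ N := fun h => hvx _ h (by simp)
    have hN' : IsRainbowMatching G c (insert s(x, y) N) := by
      obtain ⟨h1, h2, h3⟩ := hN
      refine ⟨?_, ?_, ?_⟩
      · intro e he
        simp only [coe_insert, Set.mem_insert_iff, mem_coe] at he
        rcases he with rfl | he
        · exact hxy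
        · exact h1 he
      · intro e he f hf hef v hve hvf
        rw [mem_insert] at he hf
        rcases he with rfl | he <;> rcases hf with rfl | hf
        · exact hef rfl
        · rcases Sym2.mem_iff.1 hve with rfl | rfl
          · exact hvx _ hf hvf
          · exact hvy _ hf hvf
        · rcases Sym2.mem_iff.1 hvf with rfl | rfl
          · exact hvx _ he hve
          · exact hvy _ he hve
        · exact h2 e he f hf hef v hve hvf
      · intro e he f hf hef
        simp only [coe_insert, Set.mem_insert_iff, mem_coe] at he hf
        rcases he with rfl | he <;> rcases hf with rfl | hf
        · rfl
        · exact absurd hef (hc0 _ hf)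
        · exact absurd hef.symm (hc0 _ he)
        · exact h3 he hf hef
    obtain ⟨N', hr, hcard⟩ := ih (insert s(x, y) N) hN' hadj hnd hcd
      (by
        intro v hvL e he
        rw [mem_insert] at he
        rcases he with rfl | he
        · intro hm
          rcases Sym2.mem_iff.1 hm with rfl | rfl
          · exact hxL hvL
          · exact hyL hvL
        · exact hv v hvL e he)
      (by
        intro q hq e he
        rw [mem_insert] at he
        rcases he with rfl | he
        · intro hm
          exact hc1 (List.mem_map.2 ⟨q, hq, hm⟩)
        · exact hcN q hq e he)
    refine ⟨N', hr, ?_⟩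
    rw [hcard, card_insert_of_notMem hnot, List.length_cons]
    omega

lemma subset_rm {G : SimpleGraph V} {c : Sym2 V → ℕ} {N N' : Finset (Sym2 V)}
    (hN : IsRainbowMatching G c N) (h : N' ⊆ N) : IsRainbowMatching G c N' :=
  ⟨fun _ he => hN.1 (h he), fun e he f hf => hN.2.1 e (h he) f (h hf),
    hN.2.2.mono (by exact_mod_cast h)⟩

/-- The two ends of an edge. -/
noncomputable def fx (e : Sym2 V) : V := (Quot.out e).1
noncomputable def fy (e : Sym2 V) : V := (Quot.out e).2

lemma fxy (e : Sym2 V) : s(fx e, fy e) = e := Quot.out_eq e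

lemma mem_fxy {e : Sym2 V} {v : V} : v ∈ e ↔ v = fx e ∨ v = fy e := by
  conv_lhs => rw [← fxy e]
  exact Sym2.mem_iff

/-- edge `a w` is present with a color outside `B`. -/
def gd (G : SimpleGraph V) (c : Sym2 V → ℕ) (B : Finset ℕ) (a w : V) : Prop :=
  G.Adj a w ∧ c s(a, w) ∉ B

/-- the color of `e` is seen at `a`. -/
def sn (G : SimpleGraph V) (c : Sym2 V → ℕ) (a : V) (e : Sym2 V) : Prop :=
  ∃ w, G.Adj a w ∧ c s(a, w) = c e

lemma not_adj_of_sn {G : SimpleGraph V} {c : Sym2 V → ℕ} (hs : StronglyEdgeColored G c)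
    {a : V} {e : Sym2 V} (he : e ∈ G.edgeSet) (hae : a ∉ e) (h : sn G c a e) {x : V}
    (hx : x ∈ e) : ¬ G.Adj a x := by
  obtain ⟨w, haw, hc⟩ := h
  intro hax
  obtain ⟨y, rfl⟩ := Sym2.mem_iff_exists.1 hx
  have := strong_eq hs haw he hc (Or.inr hax)
  exact hae (this ▸ Sym2.mem_mk_left a w)

/-- neighbors of `a` not accounted for by `N`. -/
noncomputable def extr [Fintype V] (G : SimpleGraph V) (c : Sym2 V → ℕ) (B : Finset ℕ)
    (N : Finset (Sym2 V)) (a : V) : Finset V :=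
  univ.filter fun w => G.Adj a w ∧ (∀ e ∈ N, c s(a, w) ≠ c e) ∧
    (c s(a, w) ∈ B ∨ ∀ e ∈ N, w ∉ e)

lemma degree_le [Fintype V] {G : SimpleGraph V} [DecidableRel G.Adj] {c : Sym2 V → ℕ}
    (hs : StronglyEdgeColored G c) (B : Finset ℕ) (N : Finset (Sym2 V)) (a : V) :
    G.degree a ≤ (extr G c B N a).card + ∑ e ∈ N, ((if gd G c B a (fx e) then 1 else 0) +
      (if gd G c B a (fy e) then 1 else 0) + (if sn G c a e then 1 else 0)) := by
  let P : Sym2 V → Finset V := fun e =>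
    (if gd G c B a (fx e) then {fx e} else ∅) ∪ (if gd G c B a (fy e) then {fy e} else ∅) ∪
      univ.filter (fun w => G.Adj a w ∧ c s(a, w) = c e)
  have hsub : G.neighborFinset a ⊆ extr G c B N a ∪ N.biUnion P := by
    intro w hw
    rw [SimpleGraph.mem_neighborFinset] at hw
    rw [mem_union, mem_biUnion]
    by_cases h1 : ∃ e ∈ N, c s(a, w) = c e
    · obtain ⟨e, he, h⟩ := h1
      right
      exact ⟨e, he, by simp [P, hw, h]⟩
    · push Not at h1
      by_cases h2 : c s(a, w) ∈ B ∨ ∀ e ∈ N, w ∉ e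
      · left
        simp only [extr, mem_filter, mem_univ, true_and]
        exact ⟨hw, h1, h2⟩
      · push Not at h2
        obtain ⟨hB, e, he, hwe⟩ := h2
        right
        refine ⟨e, he, ?_⟩
        have hg : gd G c B a w := ⟨hw, hB⟩
        rcases mem_fxy.1 hwe with rfl | rfl
        · simp [P, hg]
        · simp [P, hg]
  have hP : ∀ e ∈ N, (P e).card ≤ ((if gd G c B a (fx e) then 1 else 0) +
      (if gd G c B a (fy e) then 1 else 0) + (if sn G c a e then 1 else 0)) := by
    intro e _
    refine (card_union_le _ _).trans (add_le_add ((card_union_le _ _).trans (add_le_add ?_ ?_)) ?_)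
    · split_ifs <;> simp
    · split_ifs <;> simp
    · split_ifs with h
      · rw [card_le_one]
        intro w hw w' hw'
        simp only [mem_filter, mem_univ, true_and] at hw hw'
        have := strong_eq hs hw.1 hw'.1 (hw.2.trans hw'.2.symm) (Or.inl rfl)
        exact Sym2.congr_right.1 this
      · rw [Nat.le_zero, card_eq_zero, filter_eq_empty_iff]
        intro w _ hw
        exact h ⟨w, hw⟩
  rw [← SimpleGraph.card_neighborFinset_eq_degree]
  exact (card_le_card hsub).trans ((card_union_le _ _).trans
    (add_le_add le_rfl (card_biUnion_le.trans (sum_le_sum hP))))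

/-- Pigeonhole: a vertex of large degree is doubly joined to an edge of `N`. -/
lemma exists_double [Fintype V] {G : SimpleGraph V} [DecidableRel G.Adj] {c : Sym2 V → ℕ}
    (hs : StronglyEdgeColored G c) (B : Finset ℕ) (N : Finset (Sym2 V)) (a : V)
    (hN : IsRainbowMatching G c N) (ha : ∀ e ∈ N, a ∉ e)
    (hd : (extr G c B N a).card + N.card < G.degree a) :
    ∃ e ∈ N, gd G c B a (fx e) ∧ gd G c B a (fy e) := by
  by_contra hcon
  push Not at hcon
  have h1 := degree_le hs B N a
  have h2 : ∑ e ∈ N, ((if gd G c B a (fx e) then 1 else 0) +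
      (if gd G c B a (fy e) then 1 else 0) + (if sn G c a e then 1 else 0)) ≤ ∑ e ∈ N, 1 := by
    refine sum_le_sum fun e he => ?_
    by_cases hsn : sn G c a e
    · have hx : ¬ gd G c B a (fx e) := fun h =>
        not_adj_of_sn hs (hN.1 he) (ha e he) hsn (mem_fxy.2 (Or.inl rfl)) h.1
      have hy : ¬ gd G c B a (fy e) := fun h =>
        not_adj_of_sn hs (hN.1 he) (ha e he) hsn (mem_fxy.2 (Or.inr rfl)) h.1
      simp [hx, hy, hsn]
    · have := hcon e he
      by_cases hx : gd G c B a (fx e)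
      · simp [hx, this hx, hsn]
      · simp only [hx, hsn, if_false]; split_ifs <;> simp
  simp at h2
  omega

end RainbowAux
namespace RainbowAux
open Finset
open scoped Classical

variable {V : Type*}

/-- color of the triangle edge opposite to `t i r`. -/
def oc (c : Sym2 V → ℕ) (t : Fin 3 → Fin 3 → V) (i r : Fin 3) : ℕ :=
  c s(t i (r + 1), t i (r + 2))

/-- Three vertex-disjoint triangles outside an (almost maximum) rainbow matching. -/
structure Cfg (G : SimpleGraph V) (c : Sym2 V → ℕ) (N : Finset (Sym2 V))
    (t : Fin 3 → Fin 3 → V) : Prop where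
  hs : StronglyEdgeColored G c
  hN : IsRainbowMatching G c N
  hmax : ∀ N', IsRainbowMatching G c N' → N'.card < N.card + 4
  tinj : ∀ i r j s, t i r = t j s → i = j ∧ r = s
  tN : ∀ i r, ∀ e ∈ N, t i r ∉ e
  tadj : ∀ i r s, r ≠ s → G.Adj (t i r) (t i s)
  oN : ∀ i r, ∀ e ∈ N, oc c t i r ≠ c e
  h4 : ∀ i r, i ≠ 0 → oc c t 0 0 ≠ oc c t i r

lemma f3a : ∀ r : Fin 3, r ≠ r + 1 ∧ r ≠ r + 2 ∧ r + 1 ≠ r + 2 := by decide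

lemma f3third : ∀ i j : Fin 3, i ≠ j → ∃ l, i ≠ l ∧ j ≠ l := by decide

lemma f3others : ∀ i : Fin 3, ∃ j l, i ≠ j ∧ i ≠ l ∧ j ≠ l := by decide

section
variable {G : SimpleGraph V} {c : Sym2 V → ℕ} {N : Finset (Sym2 V)} {t : Fin 3 → Fin 3 → V}

lemma Cfg.teq (h : Cfg G c N t) (i r j s : Fin 3) : t i r = t j s ↔ i = j ∧ r = s :=
  ⟨h.tinj i r j s, by rintro ⟨rfl, rfl⟩; rfl⟩

lemma Cfg.eqadj (h : Cfg G c N t) (i r s : Fin 3) : t i r = t i s ∨ G.Adj (t i r) (t i s) := by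
  by_cases hrs : r = s
  · left; rw [hrs]
  · right; exact h.tadj i r s hrs

lemma Cfg.oinj (h : Cfg G c N t) {i r s : Fin 3} (ho : oc c t i r = oc c t i s) : r = s := by
  have := strong_eq h.hs (h.tadj i (r + 1) (r + 2) (f3a r).2.2)
    (h.tadj i (s + 1) (s + 2) (f3a s).2.2) ho (h.eqadj i _ _)
  rw [Sym2.eq_iff] at this
  simp only [h.teq, true_and] at this
  clear ho
  revert r s
  decide

lemma Cfg.own (h : Cfg G c N t) {i r : Fin 3} {w : V} (haw : G.Adj (t i r) w)
    (hw : ∀ s, w ≠ t i s) (u : Fin 3) : c s(t i r, w) ≠ oc c t i u := by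
  intro ho
  have := strong_eq h.hs haw (h.tadj i (u + 1) (u + 2) (f3a u).2.2) ho (h.eqadj i _ _)
  rw [Sym2.eq_iff] at this
  rcases this with ⟨_, h2⟩ | ⟨_, h2⟩ <;> exact hw _ h2

lemma Cfg.pick (h : Cfg G c N t) (l : Fin 3) (p q : ℕ) :
    ∃ u, oc c t l u ≠ p ∧ oc c t l u ≠ q := by
  by_contra hcon
  push Not at hcon
  have h01 : oc c t l 0 ≠ oc c t l 1 := fun h' => absurd (h.oinj h') (by decide)
  have h02 : oc c t l 0 ≠ oc c t l 2 := fun h' => absurd (h.oinj h') (by decide)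
  have h12 : oc c t l 1 ≠ oc c t l 2 := fun h' => absurd (h.oinj h') (by decide)
  have a0 := hcon 0
  have a1 := hcon 1
  have a2 := hcon 2
  grind

lemma Cfg.augE (h : Cfg G c N t) {i j l r s u : Fin 3} (hij : i ≠ j) (hil : i ≠ l) (hjl : j ≠ l)
    {x y : V} (he : s(x, y) ∈ N) (hax : G.Adj (t i r) x) (hby : G.Adj (t j s) y)
    (hα : ∀ f ∈ N, c s(t i r, x) ≠ c f) (hβ : ∀ f ∈ N, c s(t j s, y) ≠ c f)
    (h1 : c s(t i r, x) ≠ oc c t j s) (h2 : c s(t j s, y) ≠ oc c t i r)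
    (h3 : oc c t i r ≠ oc c t j s) (h4 : oc c t l u ≠ c s(t i r, x))
    (h5 : oc c t l u ≠ c s(t j s, y)) (h6 : oc c t l u ≠ oc c t i r)
    (h7 : oc c t l u ≠ oc c t j s) : False := by
  have hxy : G.Adj x y := h.hN.1 he
  have tx : ∀ i r, t i r ≠ x := fun i r h' => h.tN i r _ he (by simp [h'])
  have ty : ∀ i r, t i r ≠ y := fun i r h' => h.tN i r _ he (by simp [h'])
  have hαβ : c s(t i r, x) ≠ c s(t j s, y) := by
    intro h'
    rw [Sym2.eq_swap, Sym2.eq_swap (a := t j s)] at h'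
    have := strong_eq h.hs hax.symm hby.symm h' (Or.inr hxy)
    rw [Sym2.eq_iff] at this
    rcases this with ⟨h5, _⟩ | ⟨h5, _⟩
    · exact hxy.ne h5
    · exact tx _ _ h5.symm
  have hα' := h.own hax (fun s => (tx _ _).symm) r
  have hβ' := h.own hby (fun s => (ty _ _).symm) s
  obtain ⟨N', hr, hc⟩ := extendL (G := G) (c := c)
    [(t i r, x), (t j s, y), (t i (r + 1), t i (r + 2)), (t j (s + 1), t j (s + 2)),
      (t l (u + 1), t l (u + 2))] (N.erase s(x, y)) (subset_rm h.hN (erase_subset _ _))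
    (by
      simp only [List.mem_cons, List.not_mem_nil, or_false, forall_eq_or_imp, forall_eq]
      exact ⟨hax, hby, h.tadj _ _ _ (f3a r).2.2, h.tadj _ _ _ (f3a s).2.2,
        h.tadj _ _ _ (f3a u).2.2⟩)
    (by
      simp [h.teq, tx, ty, fun i r => (tx i r).symm, fun i r => (ty i r).symm, hxy.ne, hij, hil,
        hjl, hij.symm, hil.symm, hjl.symm])
    (by
      simp only [List.map_cons, List.map_nil, List.nodup_cons, List.mem_cons, List.not_mem_nil,
        or_false, not_or, not_false_eq_true, List.nodup_nil, and_true]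
      exact ⟨⟨hαβ, hα', h1, h4.symm⟩, ⟨h2, hβ', h5.symm⟩, ⟨h3, h6.symm⟩, h7.symm⟩)
    (by
      intro v hv f hf hvf
      rw [mem_erase] at hf
      simp only [List.flatMap_cons, List.cons_append, List.nil_append, List.flatMap_nil,
        List.mem_cons, List.not_mem_nil, or_false] at hv
      have hx : x ∉ f := h.hN.2.1 _ he f hf.2 hf.1.symm x (by simp)
      have hy : y ∉ f := h.hN.2.1 _ he f hf.2 hf.1.symm y (by simp)
      rcases hv with rfl | rfl | rfl | rfl | rfl | rfl | rfl | rfl | rfl | rfl <;>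
        first
        | exact hx hvf
        | exact hy hvf
        | exact h.tN _ _ _ hf.2 hvf)
    (by
      intro p hp f hf
      rw [mem_erase] at hf
      simp only [List.mem_cons, List.not_mem_nil, or_false] at hp
      rcases hp with rfl | rfl | rfl | rfl | rfl
      · exact hα _ hf.2
      · exact hβ _ hf.2
      · exact h.oN _ _ _ hf.2
      · exact h.oN _ _ _ hf.2
      · exact h.oN _ _ _ hf.2)
  have := h.hmax N' hr
  have h8 := card_erase_add_one he
  simp only [List.length_cons, List.length_nil] at hc
  omega

lemma Cfg.augW (h : Cfg G c N t) {i j l r s u : Fin 3} (hij : i ≠ j) (hil : i ≠ l) (hjl : j ≠ l)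
    {w : V} (hwN : ∀ e ∈ N, w ∉ e) (tw : ∀ i r, w ≠ t i r) (haw : G.Adj (t i r) w)
    (hα : ∀ f ∈ N, c s(t i r, w) ≠ c f)
    (h1 : oc c t j s ≠ c s(t i r, w)) (h2 : oc c t l u ≠ c s(t i r, w))
    (h3 : oc c t j s ≠ oc c t i r) (h4 : oc c t l u ≠ oc c t i r)
    (h5 : oc c t l u ≠ oc c t j s) : False := by
  have hα' := h.own haw (fun s => tw _ _) r
  obtain ⟨N', hr, hc⟩ := extendL (G := G) (c := c)
    [(t i r, w), (t i (r + 1), t i (r + 2)), (t j (s + 1), t j (s + 2)),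
      (t l (u + 1), t l (u + 2))] N h.hN
    (by
      simp only [List.mem_cons, List.not_mem_nil, or_false, forall_eq_or_imp, forall_eq]
      exact ⟨haw, h.tadj _ _ _ (f3a r).2.2, h.tadj _ _ _ (f3a s).2.2,
        h.tadj _ _ _ (f3a u).2.2⟩)
    (by
      simp [h.teq, tw, fun i r => (tw i r).symm, hij, hil,
        hjl, hij.symm, hil.symm, hjl.symm])
    (by
      simp only [List.map_cons, List.map_nil, List.nodup_cons, List.mem_cons, List.not_mem_nil,
        or_false, not_or, not_false_eq_true, List.nodup_nil, and_true]
      exact ⟨⟨hα', h1.symm, h2.symm⟩, ⟨h3.symm, h4.symm⟩, h5.symm⟩)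
    (by
      intro v hv f hf hvf
      simp only [List.flatMap_cons, List.cons_append, List.nil_append, List.flatMap_nil,
        List.mem_cons, List.not_mem_nil, or_false] at hv
      rcases hv with rfl | rfl | rfl | rfl | rfl | rfl | rfl | rfl <;>
        first
        | exact hwN _ hf hvf
        | exact h.tN _ _ _ hf hvf)
    (by
      intro p hp f hf
      simp only [List.mem_cons, List.not_mem_nil, or_false] at hp
      rcases hp with rfl | rfl | rfl | rfl
      · exact hα _ hf
      · exact h.oN _ _ _ hf
      · exact h.oN _ _ _ hf
      · exact h.oN _ _ _ hf)
  have := h.hmax N' hr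
  simp only [List.length_cons, List.length_nil] at hc
  omega

lemma Cfg.augT (h : Cfg G c N t) {i j l r s u : Fin 3} (hij : i ≠ j) (hil : i ≠ l) (hjl : j ≠ l)
    (hab : G.Adj (t i r) (t j s)) (hα : ∀ f ∈ N, c s(t i r, t j s) ≠ c f)
    (h2 : oc c t l u ≠ c s(t i r, t j s))
    (h3 : oc c t i r ≠ oc c t j s) (h4 : oc c t l u ≠ oc c t i r)
    (h5 : oc c t l u ≠ oc c t j s) : False := by
  have hα' := h.own hab (fun s' h' => hij.symm (h.tinj _ _ _ _ h').1) r
  have hβ' := h.own hab.symm (fun s' h' => hij (h.tinj _ _ _ _ h').1) s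
  rw [Sym2.eq_swap] at hβ'
  obtain ⟨N', hr, hc⟩ := extendL (G := G) (c := c)
    [(t i r, t j s), (t i (r + 1), t i (r + 2)), (t j (s + 1), t j (s + 2)),
      (t l (u + 1), t l (u + 2))] N h.hN
    (by
      simp only [List.mem_cons, List.not_mem_nil, or_false, forall_eq_or_imp, forall_eq]
      exact ⟨hab, h.tadj _ _ _ (f3a r).2.2, h.tadj _ _ _ (f3a s).2.2,
        h.tadj _ _ _ (f3a u).2.2⟩)
    (by
      simp [h.teq, hij, hil, hjl, hij.symm, hil.symm, hjl.symm])
    (by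
      simp only [List.map_cons, List.map_nil, List.nodup_cons, List.mem_cons, List.not_mem_nil,
        or_false, not_or, not_false_eq_true, List.nodup_nil, and_true]
      exact ⟨⟨hα', hβ', h2.symm⟩, ⟨h3, h4.symm⟩, h5.symm⟩)
    (by
      intro v hv f hf hvf
      simp only [List.flatMap_cons, List.cons_append, List.nil_append, List.flatMap_nil,
        List.mem_cons, List.not_mem_nil, or_false] at hv
      rcases hv with rfl | rfl | rfl | rfl | rfl | rfl | rfl | rfl <;>
        exact h.tN _ _ _ hf hvf)
    (by
      intro p hp f hf
      simp only [List.mem_cons, List.not_mem_nil, or_false] at hp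
      rcases hp with rfl | rfl | rfl | rfl
      · exact hα _ hf
      · exact h.oN _ _ _ hf
      · exact h.oN _ _ _ hf
      · exact h.oN _ _ _ hf)
  have := h.hmax N' hr
  simp only [List.length_cons, List.length_nil] at hc
  omega

end
end RainbowAux
namespace RainbowAux
open Finset
open scoped Classical

variable {V : Type*}

/-- all colors of the matching and of the triangles. -/
noncomputable def BB (c : Sym2 V → ℕ) (N : Finset (Sym2 V)) (t : Fin 3 → Fin 3 → V) : Finset ℕ :=
  N.image c ∪ univ.image (fun p : Fin 3 × Fin 3 => oc c t p.1 p.2)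

section
variable {G : SimpleGraph V} {c : Sym2 V → ℕ} {N : Finset (Sym2 V)} {t : Fin 3 → Fin 3 → V}

lemma notMem_BB {a : ℕ} : a ∉ BB c N t ↔ (∀ e ∈ N, a ≠ c e) ∧ ∀ i r, a ≠ oc c t i r := by
  simp only [BB, mem_union, mem_image, mem_univ, true_and, Prod.exists, not_or, not_exists, not_and]
  exact and_congr (forall_congr' fun e => forall_congr' fun _ => ne_comm)
    (forall_congr' fun e => forall_congr' fun _ => ne_comm)

lemma Cfg.opp (h : Cfg G c N t) {i j r s : Fin 3} (hij : i ≠ j) {x y : V} (he : s(x, y) ∈ N)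
    (hx : gd G c (BB c N t) (t i r) x) (hy : gd G c (BB c N t) (t j s) y) :
    oc c t i r = oc c t j s := by
  by_contra hne
  obtain ⟨l, hil, hjl⟩ := f3third i j hij
  obtain ⟨u, hu1, hu2⟩ := h.pick l (oc c t i r) (oc c t j s)
  have h1 := notMem_BB.1 hx.2
  have h2 := notMem_BB.1 hy.2
  exact h.augE hij hil hjl he hx.1 hy.1 h1.1 h2.1 (h1.2 _ _) (h2.2 _ _) hne (h1.2 _ _).symm
    (h2.2 _ _).symm hu1 hu2

lemma Cfg.opp0 (h : Cfg G c N t) {j s : Fin 3} (hj : j ≠ 0) {x y : V} (he : s(x, y) ∈ N)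
    (hx : gd G c (N.image c) (t 0 0) x) (hy : gd G c (BB c N t) (t j s) y) :
    oc c t j s = c s(t 0 0, x) := by
  by_contra hne
  obtain ⟨l, hil, hjl⟩ := f3third 0 j hj.symm
  obtain ⟨u, hu1, hu2⟩ := h.pick l (c s(t 0 0, x)) (oc c t j s)
  have h1 : ∀ e ∈ N, c s(t 0 0, x) ≠ c e := fun e he h' => hx.2 (mem_image.2 ⟨e, he, h'.symm⟩)
  have h2 := notMem_BB.1 hy.2
  exact h.augE hj.symm hil hjl he hx.1 hy.1 h1 h2.1 (Ne.symm hne) (h2.2 _ _) (h.h4 _ _ hj) hu1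
    (h2.2 _ _).symm (h.h4 _ _ hil.symm).symm hu2

lemma Cfg.extras [Fintype V] (h : Cfg G c N t) (i : Fin 3) :
    ∑ r, (extr G c (BB c N t) N (t i r)).card ≤ 12 := by
  rw [← card_sigma]
  set P := univ.sigma (fun r => extr G c (BB c N t) N (t i r)) with hP
  rw [← card_filter_add_card_filter_not (s := P) (fun p => ∃ s, p.2 = t i s)]
  have h1 : (P.filter (fun p => ∃ s, p.2 = t i s)).card ≤
      (univ.filter (fun p : Fin 3 × Fin 3 => p.1 ≠ p.2)).card := by
    apply card_le_card_of_forall_subsingleton (fun p b => p.1 = b.1 ∧ p.2 = t i b.2)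
    · rintro ⟨r, w⟩ hp
      simp only [hP, mem_filter, mem_sigma, mem_univ, true_and, extr] at hp
      obtain ⟨⟨hadj, _⟩, s, rfl⟩ := hp
      refine ⟨(r, s), ?_, rfl, rfl⟩
      simp only [mem_filter, mem_univ, true_and]
      rintro rfl
      exact hadj.ne rfl
    · rintro ⟨r, s⟩ _ ⟨r1, w1⟩ ⟨_, h1, h2⟩ ⟨r2, w2⟩ ⟨_, h3, h4⟩
      simp only at h1 h2 h3 h4
      subst h1 h2 h3 h4
      rfl
  have h2 : (P.filter (fun p => ¬ ∃ s, p.2 = t i s)).card ≤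
      (univ.filter (fun p : Fin 3 × Fin 3 => p.1 ≠ i)).card := by
    apply card_le_card_of_forall_subsingleton (fun p b => c s(t i p.1, p.2) = oc c t b.1 b.2 ∨
      (p.2 = t b.1 b.2 ∧ oc c t i p.1 = oc c t b.1 b.2))
    · rintro ⟨r, w⟩ hp
      simp only [hP, mem_filter, mem_sigma, mem_univ, true_and, extr, not_exists] at hp
      obtain ⟨⟨hadj, hcN, hor⟩, hw⟩ := hp
      by_cases hq : ∃ j s, c s(t i r, w) = oc c t j s
      · obtain ⟨j, s, hq⟩ := hq
        refine ⟨(j, s), ?_, Or.inl hq⟩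
        simp only [mem_filter, mem_univ, true_and]
        rintro rfl
        exact h.own hadj hw _ hq
      · push Not at hq
        have hB : c s(t i r, w) ∉ BB c N t := notMem_BB.2 ⟨hcN, hq⟩
        have hwN := hor.resolve_left hB
        by_cases hT : ∃ j s, w = t j s
        · obtain ⟨j, s, rfl⟩ := hT
          have hji : j ≠ i := by rintro rfl; exact hw _ rfl
          refine ⟨(j, s), by simpa using hji, Or.inr ⟨rfl, ?_⟩⟩
          by_contra hne
          obtain ⟨l, hil, hjl⟩ := f3third i j hji.symm
          obtain ⟨u, hu1, hu2⟩ := h.pick l (oc c t i r) (oc c t j s)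
          exact h.augT hji.symm hil hjl hadj hcN (hq _ _).symm hne hu1 hu2
        · exfalso
          push Not at hT
          obtain ⟨j, l, hij, hil, hjl⟩ := f3others i
          obtain ⟨s, hs1, _⟩ := h.pick j (oc c t i r) (oc c t i r)
          obtain ⟨u, hu1, hu2⟩ := h.pick l (oc c t i r) (oc c t j s)
          exact h.augW hij hil hjl hwN hT hadj hcN (hq _ _).symm (hq _ _).symm hs1 hu1 hu2
    · rintro ⟨j, s⟩ _ ⟨r1, w1⟩ ⟨hp1, h1⟩ ⟨r2, w2⟩ ⟨hp2, h2⟩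
      simp only [hP, mem_filter, mem_sigma, mem_univ, true_and, extr, not_exists] at hp1 hp2 h1 h2
      obtain ⟨⟨ha1, _⟩, hw1⟩ := hp1
      obtain ⟨⟨ha2, _⟩, hw2⟩ := hp2
      rcases h1 with h1 | ⟨h1, h1'⟩ <;> rcases h2 with h2 | ⟨h2, h2'⟩
      · have := strong_eq h.hs ha1 ha2 (h1.trans h2.symm) (h.eqadj _ _ _)
        rw [Sym2.eq_iff] at this
        rcases this with ⟨h3, h4⟩ | ⟨h3, h4⟩
        · have := (h.tinj _ _ _ _ h3).2
          subst this h4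
          rfl
        · exact absurd h4 (hw1 _)
      · exact absurd (h1.trans h2'.symm) (h.own ha1 hw1 _)
      · exact absurd (h2.trans h1'.symm) (h.own ha2 hw2 _)
      · have := h.oinj (h1'.trans h2'.symm)
        subst this h1 h2
        rfl
  have c1 : (univ.filter (fun p : Fin 3 × Fin 3 => p.1 ≠ p.2)).card = 6 := by decide
  have c2 : ∀ i, (univ.filter (fun p : Fin 3 × Fin 3 => p.1 ≠ i)).card = 6 := by decide
  have := c2 i
  omega

/-- contribution of the matching edge `e`. -/
noncomputable def contr (G : SimpleGraph V) (c : Sym2 V → ℕ) (B : Finset ℕ)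
    (t : Fin 3 → Fin 3 → V) (e : Sym2 V) : ℕ :=
  ∑ i, ∑ r, ((if gd G c B (t i r) (fx e) then 1 else 0) +
      (if gd G c B (t i r) (fy e) then 1 else 0) + (if sn G c (t i r) e then 1 else 0))

lemma arith9 (x y s : Fin 3 → ℕ) (h1 : ∀ i, x i + s i ≤ 3) (h2 : ∀ i, y i + s i ≤ 3)
    (h3 : ∀ i, s i ≤ 1) (h4 : ∀ i j, i ≠ j → 0 < x i → 0 < y j → x i ≤ 1 ∧ y j ≤ 1) :
    ∑ i, (x i + y i + s i) ≤ 9 := by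
  rw [Fin.sum_univ_three]
  have a0 := h1 0
  have a1 := h1 1
  have a2 := h1 2
  have b0 := h2 0
  have b1 := h2 1
  have b2 := h2 2
  have c0 := h3 0
  have c1 := h3 1
  have c2 := h3 2
  have d01 := h4 0 1 (by decide)
  have d02 := h4 0 2 (by decide)
  have d10 := h4 1 0 (by decide)
  have d12 := h4 1 2 (by decide)
  have d20 := h4 2 0 (by decide)
  have d21 := h4 2 1 (by decide)
  omega

lemma arith8 (x y s : Fin 3 → ℕ) (h1 : ∀ i, x i + s i ≤ 3) (h2 : ∀ i, y i + s i ≤ 3)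
    (h3 : ∀ i, s i ≤ 1) (h5 : ∀ j, j ≠ 0 → x j ≤ 1 ∧ y j ≤ 1 ∧ (0 < x j → y 0 = 0) ∧
      (0 < y j → x 0 = 0)) :
    ∑ i, (x i + y i + s i) < 9 := by
  rw [Fin.sum_univ_three]
  have a0 := h1 0
  have a1 := h1 1
  have a2 := h1 2
  have b0 := h2 0
  have b1 := h2 1
  have b2 := h2 2
  have c0 := h3 0
  have c1 := h3 1
  have c2 := h3 2
  have d1 := h5 1 (by decide)
  have d2 := h5 2 (by decide)
  omega

lemma contr_eq (B : Finset ℕ) (e : Sym2 V) : contr G c B t e =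
    ∑ i, ((univ.filter fun r => gd G c B (t i r) (fx e)).card +
      (univ.filter fun r => gd G c B (t i r) (fy e)).card +
      (univ.filter fun r => sn G c (t i r) e).card) := by
  simp only [contr, sum_add_distrib, card_filter]

lemma Cfg.disj (h : Cfg G c N t) (B : Finset ℕ) {e : Sym2 V} (he : e ∈ N) {x : V} (hx : x ∈ e)
    (i : Fin 3) : (univ.filter fun r => gd G c B (t i r) x).card +
      (univ.filter fun r => sn G c (t i r) e).card ≤ 3 := by
  rw [← card_union_of_disjoint]
  · exact (card_le_univ _).trans (by simp)
  · rw [disjoint_filter]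
    intro r _ h1 h2
    exact not_adj_of_sn h.hs (h.hN.1 he) (h.tN i r e he) h2 hx h1.1

lemma Cfg.sone (h : Cfg G c N t) {e : Sym2 V} (he : e ∈ N) (i : Fin 3) :
    (univ.filter fun r => sn G c (t i r) e).card ≤ 1 := by
  rw [card_le_one]
  intro r hr r' hr'
  simp only [mem_filter, mem_univ, true_and] at hr hr'
  obtain ⟨w, hw, hc⟩ := hr
  obtain ⟨w', hw', hc'⟩ := hr'
  by_contra hne
  -- the common edge would be the triangle edge, whose color is not used in `N`
  have h1 := strong_eq h.hs hw hw' (hc.trans hc'.symm) (h.eqadj _ _ _)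
  rw [Sym2.eq_iff] at h1
  rcases h1 with ⟨h1, _⟩ | ⟨_, h2⟩
  · exact hne (h.tinj _ _ _ _ h1).2
  · subst h2
    have : ∀ r r' : Fin 3, r ≠ r' → ∃ u, (u + 1 = r ∧ u + 2 = r') ∨ (u + 1 = r' ∧ u + 2 = r) := by
      decide
    obtain ⟨u, ⟨rfl, rfl⟩ | ⟨rfl, rfl⟩⟩ := this r r' hne
    · exact h.oN i u e he hc
    · rw [Sym2.eq_swap] at hc
      exact h.oN i u e he hc

lemma Cfg.oneX (h : Cfg G c N t) {B : Finset ℕ} {i : Fin 3} {x : V} {k : ℕ}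
    (hk : ∀ r, gd G c B (t i r) x → oc c t i r = k) :
    (univ.filter fun r => gd G c B (t i r) x).card ≤ 1 := by
  rw [card_le_one]
  intro r hr r' hr'
  simp only [mem_filter, mem_univ, true_and] at hr hr'
  exact h.oinj ((hk r hr).trans (hk r' hr').symm)

lemma Cfg.contr9 (h : Cfg G c N t) {e : Sym2 V} (he : e ∈ N) : contr G c (BB c N t) t e ≤ 9 := by
  have he' : s(fx e, fy e) ∈ N := by rwa [fxy]
  rw [contr_eq]
  apply arith9
  · exact h.disj _ he (mem_fxy.2 (Or.inl rfl))
  · exact h.disj _ he (mem_fxy.2 (Or.inr rfl))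
  · exact h.sone he
  · intro i j hij hx hy
    rw [card_pos] at hx hy
    obtain ⟨r, hr⟩ := hx
    obtain ⟨s, hs⟩ := hy
    simp only [mem_filter, mem_univ, true_and] at hr hs
    exact ⟨h.oneX (fun r' hr' => h.opp hij he' hr' hs),
      h.oneX (fun s' hs' => (h.opp hij he' hr hs').symm)⟩

lemma Cfg.contr8 (h : Cfg G c N t) {e : Sym2 V} (he : e ∈ N)
    (hx : gd G c (N.image c) (t 0 0) (fx e)) (hy : gd G c (N.image c) (t 0 0) (fy e)) :
    contr G c (BB c N t) t e < 9 := by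
  have he' : s(fx e, fy e) ∈ N := by rwa [fxy]
  have he'' : s(fy e, fx e) ∈ N := by rwa [Sym2.eq_swap, fxy]
  have hnx : ∀ s, fx e ≠ t 0 s := fun s h' => h.tN 0 s e he (h' ▸ mem_fxy.2 (Or.inl rfl))
  have hny : ∀ s, fy e ≠ t 0 s := fun s h' => h.tN 0 s e he (h' ▸ mem_fxy.2 (Or.inr rfl))
  rw [contr_eq]
  apply arith8
  · exact h.disj _ he (mem_fxy.2 (Or.inl rfl))
  · exact h.disj _ he (mem_fxy.2 (Or.inr rfl))
  · exact h.sone he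
  · intro j hj
    refine ⟨h.oneX (fun r' hr' => h.opp0 hj he'' hy hr'),
      h.oneX (fun r' hr' => h.opp0 hj he' hx hr'), ?_, ?_⟩
    · intro hp
      rw [card_pos] at hp
      obtain ⟨s, hs⟩ := hp
      simp only [mem_filter, mem_univ, true_and] at hs
      rw [card_eq_zero, filter_eq_empty_iff]
      intro r _ hr
      exact h.own hy.1 hny r ((h.opp0 hj he'' hy hs).symm.trans (h.opp hj he' hs hr))
    · intro hp
      rw [card_pos] at hp
      obtain ⟨s, hs⟩ := hp
      simp only [mem_filter, mem_univ, true_and] at hs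
      rw [card_eq_zero, filter_eq_empty_iff]
      intro r _ hr
      exact h.own hx.1 hnx r ((h.opp0 hj he' hx hs).symm.trans (h.opp hj.symm he' hr hs).symm)

lemma Cfg.ext0 [Fintype V] (h : Cfg G c N t) :
    (extr G c (N.image c) N (t 0 0)).card ≤ 2 := by
  have : extr G c (N.image c) N (t 0 0) ⊆ {t 0 1, t 0 2} := by
    intro w hw
    simp only [extr, mem_filter, mem_univ, true_and] at hw
    obtain ⟨hadj, hcN, hor⟩ := hw
    have hB : c s(t 0 0, w) ∉ N.image c := by
      rw [mem_image]
      rintro ⟨e, he, h'⟩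
      exact hcN e he h'.symm
    have hwN := hor.resolve_left hB
    by_contra hcon
    have hw0 : ∀ s, w ≠ t 0 s := by
      intro s h'
      subst h'
      have : ∀ s : Fin 3, s = 0 ∨ s = 1 ∨ s = 2 := by decide
      rcases this s with rfl | rfl | rfl
      · exact hadj.ne rfl
      · simp at hcon
      · simp at hcon
    by_cases hT : ∃ j s, w = t j s
    · obtain ⟨j, s, rfl⟩ := hT
      have hji : j ≠ 0 := by rintro rfl; exact hw0 _ rfl
      obtain ⟨l, hil, hjl⟩ := f3third 0 j hji.symm
      obtain ⟨u, hu1, hu2⟩ := h.pick l (c s(t 0 0, t j s)) (oc c t j s)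
      exact h.augT hji.symm hil hjl hadj hcN hu1 (h.h4 _ _ hji) (h.h4 _ _ hil.symm).symm hu2
    · push Not at hT
      obtain ⟨s, hs1, _⟩ := h.pick 1 (c s(t 0 0, w)) 0
      obtain ⟨u, hu1, hu2⟩ := h.pick 2 (c s(t 0 0, w)) (oc c t 1 s)
      exact h.augW (by decide) (by decide) (by decide) hwN hT hadj hcN hs1 hu1
        (h.h4 _ _ (by decide)).symm (h.h4 _ _ (by decide)).symm hu2
  exact (card_le_card this).trans card_le_two

lemma Cfg.contra [Fintype V] [DecidableRel G.Adj] (h : Cfg G c N t)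
    (hd : ∀ v, N.card + 4 ≤ G.degree v) : False := by
  obtain ⟨e, he, hx, hy⟩ := exists_double h.hs (N.image c) N (t 0 0) h.hN (h.tN 0 0)
    (by have := h.ext0; have := hd (t 0 0); omega)
  have h1 : ∑ e ∈ N, contr G c (BB c N t) t e < ∑ e ∈ N, 9 :=
    sum_lt_sum (fun e he => h.contr9 he) ⟨e, he, h.contr8 he hx hy⟩
  have h2 : ∑ i : Fin 3, ∑ r : Fin 3, (N.card + 4) ≤
      ∑ i : Fin 3, ∑ r : Fin 3, ((extr G c (BB c N t) N (t i r)).card +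
        ∑ e ∈ N, ((if gd G c (BB c N t) (t i r) (fx e) then 1 else 0) +
      (if gd G c (BB c N t) (t i r) (fy e) then 1 else 0) +
      (if sn G c (t i r) e then 1 else 0))) :=
    sum_le_sum fun i _ => sum_le_sum fun r _ =>
      (hd _).trans (degree_le h.hs (BB c N t) N (t i r))
  have h3 : ∑ i : Fin 3, ∑ r : Fin 3, ∑ e ∈ N,
      ((if gd G c (BB c N t) (t i r) (fx e) then 1 else 0) +
      (if gd G c (BB c N t) (t i r) (fy e) then 1 else 0) +
      (if sn G c (t i r) e then 1 else 0)) = ∑ e ∈ N, contr G c (BB c N t) t e := by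
    unfold contr
    rw [sum_comm]
    rw [sum_congr rfl (fun i _ => sum_comm)]
    rw [sum_comm]
    refine sum_congr rfl fun e _ => ?_
    rw [sum_comm]
  have h4 : ∑ i : Fin 3, ∑ r : Fin 3, (extr G c (BB c N t) N (t i r)).card ≤
      ∑ i : Fin 3, 12 := sum_le_sum fun i _ => h.extras i
  have h5 : ∑ i : Fin 3, ∑ r : Fin 3, ((extr G c (BB c N t) N (t i r)).card +
        ∑ e ∈ N, ((if gd G c (BB c N t) (t i r) (fx e) then 1 else 0) +
      (if gd G c (BB c N t) (t i r) (fy e) then 1 else 0) +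
      (if sn G c (t i r) e then 1 else 0))) =
      ∑ i : Fin 3, ∑ r : Fin 3, (extr G c (BB c N t) N (t i r)).card +
      ∑ e ∈ N, contr G c (BB c N t) t e := by
    rw [← h3, ← sum_add_distrib]
    exact sum_congr rfl fun i _ => sum_add_distrib
  rw [h5] at h2
  simp only [sum_const, card_univ, Fintype.card_fin, smul_eq_mul] at h1 h2 h4
  omega

end
end RainbowAux
namespace RainbowAux
open Finset
open scoped Classical

variable {V : Type*}

lemma main [Fintype V] (G : SimpleGraph V) [DecidableRel G.Adj] (c : Sym2 V → ℕ)
    (hs : StronglyEdgeColored G c)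
    (hn : 2 * G.minDegree + 1 ≤ Fintype.card V) :
    ∃ M : Finset (Sym2 V), IsRainbowMatching G c M ∧ G.minDegree ≤ M.card := by
  by_contra hcon
  push Not at hcon
  obtain ⟨M, hMr, hMmax⟩ := exists_max_image
    (univ.filter fun M : Finset (Sym2 V) => IsRainbowMatching G c M) card
    ⟨∅, by
      rw [mem_filter]
      exact ⟨mem_univ _, by simp, by simp, by simp⟩⟩
  simp only [mem_filter, mem_univ, true_and] at hMr hMmax
  have hMk := hcon M hMr
  have hdeg : ∀ v, M.card < G.degree v := fun v => hMk.trans_le (G.minDegree_le_degree v)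
  -- three uncovered vertices
  obtain ⟨v, hvinj, hvM⟩ : ∃ v : Fin 3 → V, Function.Injective v ∧ ∀ i, ∀ e ∈ M, v i ∉ e := by
    let U : Finset V := (M.image fx ∪ M.image fy)ᶜ
    have hU : 3 ≤ U.card := by
      rw [card_compl]
      have h1 := card_union_le (M.image fx) (M.image fy)
      have h2 := card_image_le (s := M) (f := fx)
      have h3 := card_image_le (s := M) (f := fy)
      omega
    obtain ⟨f⟩ := Function.Embedding.nonempty_of_card_le (α := Fin 3) (β := U) (by simpa using hU)
    refine ⟨fun i => (f i : V), fun i j hij => f.injective (Subtype.ext hij), ?_⟩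
    intro i e he hm
    have := (f i).2
    simp only [U, mem_compl, mem_union, mem_image, not_or, not_exists, not_and] at this
    rcases mem_fxy.1 hm with h | h
    · exact this.1 e he h.symm
    · exact this.2 e he h.symm
  have hdouble : ∀ i, ∃ e ∈ M, gd G c (M.image c) (v i) (fx e) ∧
      gd G c (M.image c) (v i) (fy e) := by
    intro i
    apply exists_double hs _ _ _ hMr (hvM i)
    have : extr G c (M.image c) M (v i) = ∅ := by
      rw [eq_empty_iff_forall_notMem]
      intro w hw
      simp only [extr, mem_filter, mem_univ, true_and] at hw
      obtain ⟨hadj, hcN, hor⟩ := hw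
      have hB : c s(v i, w) ∉ M.image c := by
        rw [mem_image]
        rintro ⟨e, he, h'⟩
        exact hcN e he h'.symm
      have hwM := hor.resolve_left hB
      obtain ⟨N', hr, hc⟩ := extendL [(v i, w)] M hMr (by simpa using hadj)
        (by simpa using hadj.ne) (by simp) (by
          intro z hz e he
          simp at hz
          rcases hz with rfl | rfl
          · exact hvM i e he
          · exact hwM e he) (by simpa using hcN)
      have := hMmax N' hr
      simp at hc
      omega
    rw [this]
    simpa using hdeg (v i)
  choose e he hx hy using hdouble
  have mx : ∀ i, fx (e i) ∈ e i := fun i => mem_fxy.2 (Or.inl rfl)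
  have my : ∀ i, fy (e i) ∈ e i := fun i => mem_fxy.2 (Or.inr rfl)
  have hadj : ∀ i, G.Adj (fx (e i)) (fy (e i)) := by
    intro i
    have := hMr.1 (he i)
    rwa [← fxy (e i)] at this
  have hvx : ∀ i j, v i ≠ fx (e j) := fun i j h => hvM i _ (he j) (h ▸ mx j)
  have hvy : ∀ i j, v i ≠ fy (e j) := fun i j h => hvM i _ (he j) (h ▸ my j)
  have hcx : ∀ i, ∀ f ∈ M, c s(v i, fx (e i)) ≠ c f := fun i f hf h' =>
    (hx i).2 (mem_image.2 ⟨f, hf, h'.symm⟩)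
  have hcy : ∀ i, ∀ f ∈ M, c s(v i, fy (e i)) ≠ c f := fun i f hf h' =>
    (hy i).2 (mem_image.2 ⟨f, hf, h'.symm⟩)
  have einj : Function.Injective e := by
    intro i j hij
    by_contra hne
    have hvne : v i ≠ v j := fun h => hne (hvinj h)
    have hcol : c s(v i, fx (e i)) ≠ c s(v j, fy (e j)) := by
      intro h'
      rw [Sym2.eq_swap, Sym2.eq_swap (a := v j)] at h'
      have := strong_eq hs (hx i).1.symm (hy j).1.symm h' (Or.inr (hij ▸ hadj i))
      rw [Sym2.eq_iff] at this
      rcases this with ⟨_, h5⟩ | ⟨h5, _⟩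
      · exact hvne h5
      · exact hvx _ _ h5.symm
    have hxy : fx (e i) ≠ fy (e j) := hij ▸ (hadj i).ne
    obtain ⟨N', hr, hc⟩ := extendL [(v i, fx (e i)), (v j, fy (e j))] (M.erase (e i))
      (subset_rm hMr (erase_subset _ _)) (by simpa using ⟨(hx i).1, (hy j).1⟩)
      (by simp [hvne, hvx, hvy, hxy, fun i j => (hvx i j).symm])
      (by simpa using hcol)
      (by
        intro z hz f hf hzf
        rw [mem_erase] at hf
        simp only [List.flatMap_cons, List.cons_append, List.nil_append, List.flatMap_nil,
          List.mem_cons, List.not_mem_nil, or_false] at hz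
        rcases hz with rfl | rfl | rfl | rfl
        · exact hvM i f hf.2 hzf
        · exact hMr.2.1 _ (he i) f hf.2 hf.1.symm _ (mx i) hzf
        · exact hvM j f hf.2 hzf
        · exact hMr.2.1 _ (he j) f hf.2 (hij ▸ hf.1.symm) _ (my j) hzf)
      (by
        intro p hp f hf
        rw [mem_erase] at hf
        simp only [List.mem_cons, List.not_mem_nil, or_false] at hp
        rcases hp with rfl | rfl
        · exact hcx _ _ hf.2
        · exact hcy _ _ hf.2)
    have := hMmax N' hr
    have h8 := card_erase_add_one (he i)
    simp only [List.length_cons, List.length_nil] at hc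
    omega
  have hdis : ∀ i j z, z ∈ e i → z ∈ e j → i = j := by
    intro i j z hi hj
    by_contra hne
    exact hMr.2.1 _ (he i) _ (he j) (fun h => hne (einj h)) z hi hj
  have hxx : ∀ i j, fx (e i) = fx (e j) → i = j := fun i j h =>
    hdis i j (fx (e i)) (mx i) (h ▸ mx j)
  have hyy : ∀ i j, fy (e i) = fy (e j) → i = j := fun i j h =>
    hdis i j (fy (e i)) (my i) (h ▸ my j)
  have hxy : ∀ i j, fx (e i) ≠ fy (e j) := by
    intro i j h
    have := hdis i j (fx (e i)) (mx i) (h ▸ my j)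
    subst this
    exact (hadj i).ne h
  let N := M \ univ.image e
  have hNM : N ⊆ M := sdiff_subset
  have hNe : ∀ i, ∀ f ∈ N, e i ≠ f := by
    intro i f hf h
    simp only [N, mem_sdiff, mem_image, mem_univ, true_and, not_exists] at hf
    exact hf.2 i h
  have hNcard : N.card + 3 = M.card := by
    have h1 : univ.image e ⊆ M := by
      intro f hf
      simp only [mem_image, mem_univ, true_and] at hf
      obtain ⟨i, rfl⟩ := hf
      exact he i
    have h2 := card_sdiff_add_card_eq_card h1
    rw [card_image_of_injective _ einj] at h2
    simpa using h2
  let t : Fin 3 → Fin 3 → V := fun i => ![v i, fx (e i), fy (e i)]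
  have o0 : ∀ i, oc c t i 0 = c (e i) := fun i => congrArg c (fxy (e i))
  have o1 : ∀ i, oc c t i 1 = c s(v i, fy (e i)) := fun i => congrArg c Sym2.eq_swap
  have o2 : ∀ i, oc c t i 2 = c s(v i, fx (e i)) := fun i => rfl
  have h3 : ∀ s : Fin 3, s = 0 ∨ s = 1 ∨ s = 2 := by decide
  have hcfg : Cfg G c N t := by
    refine ⟨hs, subset_rm hMr hNM, ?_, ?_, ?_, ?_, ?_, ?_⟩
    · intro N' hr
      have := hMmax N' hr
      omega
    · intro i r j s
      have a1 := hvx i j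
      have a2 := hvx j i
      have a3 := hvy i j
      have a4 := hvy j i
      have a5 := hxy i j
      have a6 := hxy j i
      rcases h3 r with rfl | rfl | rfl <;> rcases h3 s with rfl | rfl | rfl <;>
        simp only [t, Matrix.cons_val] <;> intro h
      · exact ⟨hvinj h, trivial⟩
      · exact absurd h a1
      · exact absurd h a3
      · exact absurd h.symm a2
      · exact ⟨hxx _ _ h, trivial⟩
      · exact absurd h a5
      · exact absurd h.symm a4
      · exact absurd h.symm a6
      · exact ⟨hyy _ _ h, trivial⟩
    · intro i r f hf
      rcases h3 r with rfl | rfl | rfl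
      · exact hvM i f (hNM hf)
      · exact hMr.2.1 _ (he i) f (hNM hf) (hNe i f hf) _ (mx i)
      · exact hMr.2.1 _ (he i) f (hNM hf) (hNe i f hf) _ (my i)
    · intro i r s hrs
      rcases h3 r with rfl | rfl | rfl <;> rcases h3 s with rfl | rfl | rfl
      · exact absurd rfl hrs
      · exact (hx i).1
      · exact (hy i).1
      · exact (hx i).1.symm
      · exact absurd rfl hrs
      · exact hadj i
      · exact (hy i).1.symm
      · exact (hadj i).symm
      · exact absurd rfl hrs
    · intro i r f hf
      rcases h3 r with rfl | rfl | rfl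
      · rw [o0]
        exact fun h => hNe i f hf (hMr.2.2 (he i) (hNM hf) h)
      · rw [o1]; exact hcy i f (hNM hf)
      · rw [o2]; exact hcx i f (hNM hf)
    · intro i r hi
      rw [o0]
      rcases h3 r with rfl | rfl | rfl
      · rw [o0]
        exact fun h => hi (einj (hMr.2.2 (he 0) (he i) h)).symm
      · rw [o1]; exact (hcy i _ (he 0)).symm
      · rw [o2]; exact (hcx i _ (he 0)).symm
  exact hcfg.contra (fun v => by have := hdeg v; omega)

end RainbowAux
/-- Cheng–Tan–Wang: every strongly edge-colored graph `G` with `|V(G)| ≥ 2δ(G) + 1`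
contains a rainbow matching of size at least `δ(G)`. -/
theorem rainbow_matching_strongly_edge_colored_min_degree
    {V : Type*} [Fintype V]
    (G : SimpleGraph V) [DecidableRel G.Adj] (c : Sym2 V → ℕ)
    (hstrong : StronglyEdgeColored G c)
    (hn : 2 * G.minDegree + 1 ≤ Fintype.card V) :
    ∃ M : Finset (Sym2 V), IsRainbowMatching G c M ∧ G.minDegree ≤ M.card := by
  exact RainbowAux.main G c hstrong hn
end

section
/- Let k ≥ 1 and let G be an edge-colored graph on n vertices with average color degree d̂(G) ≥ 2k − 1, not isomorphic (as an edge-colored graph) to K̃₄, which contains no rainbow matching of size k. Then the number of edges of G satisfies |E(G)| ≥ n²/4 + 3n/4. -/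
universe u v

set_option linter.unusedSectionVars false




/-- A rainbow matching (indexed by `ι`) in an edge-colored graph on `U`, which cannot be
improved by a few local exchanges. -/
structure Conf (U : Type u) (ι : Type v) where
  H : SimpleGraph U
  col : U → U → ℕ
  csymm : ∀ x y, col x y = col y x
  z : ι → Bool → U
  k : ι → ℕ
  zinj : ∀ i s j t, z i s = z j t → i = j ∧ s = t
  zadj : ∀ i s, H.Adj (z i s) (z i !s)
  zcol : ∀ i s, col (z i s) (z i !s) = k i
  kinj : ∀ i j, k i = k j → i = j
  A0 : ∀ w w', (∀ i s, w ≠ z i s) → (∀ i s, w' ≠ z i s) → H.Adj w w' →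
    ∃ i, col w w' = k i
  A1 : ∀ i s w w', (∀ i s, w ≠ z i s) → (∀ i s, w' ≠ z i s) → w ≠ w' →
    H.Adj (z i s) w → H.Adj (z i !s) w' →
    (∀ j, col (z i s) w ≠ k j) → (∀ j, col (z i !s) w' ≠ k j) →
    col (z i s) w = col (z i !s) w'
  A2 : ∀ i j s t w w1, i ≠ j → (∀ i s, w ≠ z i s) → (∀ i s, w1 ≠ z i s) → w ≠ w1 →
    H.Adj (z j t) w → col (z j t) w = k i →
    H.Adj (z i !s) (z j !t) → (∀ l, col (z i !s) (z j !t) ≠ k l) →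
    H.Adj (z i s) w1 → (∀ l, col (z i s) w1 ≠ k l) →
    col (z i s) w1 = col (z i !s) (z j !t)
  A3 : ∀ i j s t w w1 w2, i ≠ j → (∀ i s, w ≠ z i s) → (∀ i s, w1 ≠ z i s) →
    (∀ i s, w2 ≠ z i s) → w ≠ w1 → w ≠ w2 → w1 ≠ w2 →
    H.Adj (z i !s) w → col (z i !s) w = k j →
    H.Adj (z i s) w1 → (∀ l, col (z i s) w1 ≠ k l) →
    H.Adj (z j t) w2 → (∀ l, col (z j t) w2 ≠ k l) →
    col (z i s) w1 = col (z j t) w2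
  A4 : ∀ i j l s t r w w1 w2, i ≠ j → l ≠ i → l ≠ j → (∀ i s, w ≠ z i s) →
    (∀ i s, w1 ≠ z i s) →
    (∀ i s, w2 ≠ z i s) → w ≠ w1 → w ≠ w2 → w1 ≠ w2 →
    H.Adj (z i !s) (z l !r) → col (z i !s) (z l !r) = k j →
    H.Adj (z l r) w → col (z l r) w = k i →
    H.Adj (z i s) w1 → (∀ l, col (z i s) w1 ≠ k l) →
    H.Adj (z j t) w2 → (∀ l, col (z j t) w2 ≠ k l) →
    col (z i s) w1 = col (z j t) w2

namespace Conf

open Finset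
open scoped Classical

variable {U : Type u} {ι : Type v} [Fintype U] [Fintype ι] (C : Conf U ι)

noncomputable def W : Finset U := univ.filter (fun w => ∀ i s, w ≠ C.z i s)

def fr (γ : ℕ) : Prop := ∀ j, γ ≠ C.k j

noncomputable def FN (x : U) : Finset U :=
  C.W.filter (fun w => C.H.Adj x w ∧ C.fr (C.col x w))

noncomputable def cd (x : U) : Finset ℕ := (univ.filter (fun y => C.H.Adj x y)).image (C.col x)

noncomputable def fcol (x : U) : Finset ℕ := (C.FN x).image (C.col x)

noncomputable def MW (i : ι) (s : Bool) : Finset ι :=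
  univ.filter (fun j => j ≠ i ∧ ∃ w ∈ C.W, C.H.Adj (C.z i s) w ∧ C.col (C.z i s) w = C.k j)

noncomputable def inc (x : U) : Finset (U × ℕ) := (C.FN x).image (fun w => (w, C.col x w))

noncomputable def Inc (i : ι) : Finset (U × ℕ) := C.inc (C.z i false) ∪ C.inc (C.z i true)

noncomputable def VR : Finset U := univ.image (fun p : ι × Bool => C.z p.1 p.2)

theorem mem_W {w : U} : w ∈ C.W ↔ ∀ i s, w ≠ C.z i s := by simp [W]

theorem mem_FN {x w : U} : w ∈ C.FN x ↔ w ∈ C.W ∧ C.H.Adj x w ∧ C.fr (C.col x w) := by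
  simp [FN]

theorem mem_VR {x : U} : x ∈ C.VR ↔ ∃ i s, C.z i s = x := by simp [VR]

theorem mem_W_or (x : U) : x ∈ C.W ∨ ∃ i s, x = C.z i s := by
  by_cases h : x ∈ C.W
  · exact Or.inl h
  · right; rw [mem_W] at h; push Not at h; exact h

theorem mem_cd {x : U} {γ : ℕ} : γ ∈ C.cd x ↔ ∃ y, C.H.Adj x y ∧ C.col x y = γ := by
  simp [cd]

theorem mem_fcol {x : U} {γ : ℕ} : γ ∈ C.fcol x ↔ ∃ w ∈ C.FN x, C.col x w = γ := by
  simp [fcol]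

theorem mem_MW {i j : ι} {s : Bool} : j ∈ C.MW i s ↔
    j ≠ i ∧ ∃ w ∈ C.W, C.H.Adj (C.z i s) w ∧ C.col (C.z i s) w = C.k j := by
  simp [MW]

theorem mem_inc {x : U} {p : U × ℕ} : p ∈ C.inc x ↔ p.1 ∈ C.FN x ∧ C.col x p.1 = p.2 := by
  unfold inc
  rw [mem_image]
  constructor
  · rintro ⟨w, hw, rfl⟩; exact ⟨hw, rfl⟩
  · rintro ⟨h1, h2⟩; exact ⟨p.1, h1, by rw [h2]⟩

theorem mem_Inc {i : ι} {p : U × ℕ} : p ∈ C.Inc i ↔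
    ∃ s, p.1 ∈ C.FN (C.z i s) ∧ C.col (C.z i s) p.1 = p.2 := by
  unfold Inc
  rw [mem_union, mem_inc, mem_inc]
  simp

theorem Inc_eq (i : ι) (s : Bool) : C.Inc i = C.inc (C.z i s) ∪ C.inc (C.z i !s) := by
  cases s
  · rfl
  · exact union_comm _ _

theorem card_inc (x : U) : #(C.inc x) = #(C.FN x) := by
  unfold inc
  exact card_image_of_injective _ (fun a b h => (Prod.mk.inj h).1)

theorem card_Inc_le (i : ι) (s : Bool) :
    #(C.Inc i) ≤ #(C.FN (C.z i s)) + #(C.FN (C.z i !s)) := by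
  rw [C.Inc_eq i s, ← C.card_inc, ← C.card_inc]
  exact card_union_le _ _

theorem fcol_le (x : U) : #(C.fcol x) ≤ #(C.FN x) := card_image_le

theorem z_inj : Function.Injective (fun p : ι × Bool => C.z p.1 p.2) := by
  rintro ⟨i, s⟩ ⟨j, t⟩ h
  obtain ⟨h1, h2⟩ := C.zinj i s j t h
  rw [h1, h2]

theorem card_VR : #C.VR = 2 * Fintype.card ι := by
  unfold VR
  rw [card_image_of_injective _ C.z_inj, card_univ, Fintype.card_prod, Fintype.card_bool, mul_comm]

theorem sum_split (f : U → ℕ) : ∑ x, f x = ∑ x ∈ C.W, f x +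
    ∑ i, (f (C.z i false) + f (C.z i true)) := by
  have h1 : C.VR = univ.filter (fun w => ¬ ∀ i s, w ≠ C.z i s) := by
    ext x
    rw [mem_VR, mem_filter]
    push Not
    simp [eq_comm]
  have h2 : ∑ x ∈ C.VR, f x = ∑ i, (f (C.z i false) + f (C.z i true)) := by
    unfold VR
    rw [sum_image (fun a _ b _ h => C.z_inj h), Fintype.sum_prod_type]
    refine sum_congr rfl fun i _ => ?_
    simp [add_comm]
  rw [← h2, h1, W, sum_filter_add_sum_filter_not]

theorem card_W : #C.W + 2 * Fintype.card ι = Fintype.card U := by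
  have := C.sum_split (fun _ => 1)
  simp at this
  omega

/-- Colors at vertices outside of the matching. -/
theorem sum_W : ∑ w ∈ C.W, #(C.cd w) ≤ Fintype.card ι * #C.W + #(univ.biUnion C.Inc) := by
  have h1 : ∀ w ∈ C.W, #(C.cd w) ≤
      Fintype.card ι + #((univ.biUnion C.Inc).filter (fun p => p.1 = w)) := by
    intro w hw
    have hsub : C.cd w ⊆ univ.image C.k ∪
        ((univ.biUnion C.Inc).filter (fun p => p.1 = w)).image Prod.snd := by
      intro γ hγ
      obtain ⟨y, hy, rfl⟩ := C.mem_cd.1 hγ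
      rw [mem_union]
      by_cases hf : C.fr (C.col w y)
      · right
        rcases C.mem_W_or y with hyW | ⟨i, s, rfl⟩
        · obtain ⟨i, hi⟩ := C.A0 w y (C.mem_W.1 hw) (C.mem_W.1 hyW) hy
          exact absurd hi (hf i)
        · rw [mem_image]
          refine ⟨(w, C.col w (C.z i s)), ?_, rfl⟩
          rw [mem_filter, mem_biUnion]
          refine ⟨⟨i, mem_univ _, C.mem_Inc.2 ⟨s, C.mem_FN.2 ⟨hw, hy.symm, ?_⟩, C.csymm _ _⟩⟩, rfl⟩
          rw [C.csymm]; exact hf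
      · left
        unfold fr at hf; push Not at hf
        obtain ⟨j, hj⟩ := hf
        rw [hj]; exact mem_image_of_mem _ (mem_univ _)
    refine (card_le_card hsub).trans ((card_union_le _ _).trans ?_)
    gcongr
    · exact card_image_le
    · exact card_image_le
  refine (sum_le_sum h1).trans ?_
  rw [sum_add_distrib, sum_const, smul_eq_mul, mul_comm]
  gcongr
  refine le_of_eq (card_eq_sum_card_fiberwise (f := Prod.fst) ?_).symm
  intro p hp
  simp only [coe_biUnion, Set.mem_iUnion, mem_coe] at hp
  obtain ⟨i, _, hi⟩ := hp
  obtain ⟨s, hs, _⟩ := C.mem_Inc.1 hi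
  exact (C.mem_FN.1 hs).1

theorem cd_sub (i : ι) (s : Bool) : C.cd (C.z i s) ⊆
    (C.VR.erase (C.z i s)).image (C.col (C.z i s)) ∪ ((C.MW i s).image C.k ∪ C.fcol (C.z i s)) := by
  intro γ hγ
  obtain ⟨y, hy, rfl⟩ := C.mem_cd.1 hγ
  rw [mem_union, mem_union]
  rcases C.mem_W_or y with hyW | ⟨j, t, rfl⟩
  · by_cases hf : C.fr (C.col (C.z i s) y)
    · right; right; exact C.mem_fcol.2 ⟨y, C.mem_FN.2 ⟨hyW, hy, hf⟩, rfl⟩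
    · unfold fr at hf; push Not at hf
      obtain ⟨j, hj⟩ := hf
      by_cases hji : j = i
      · left
        rw [hj, hji, ← C.zcol i s]
        refine mem_image_of_mem _ (mem_erase.2 ⟨(C.zadj i s).ne', C.mem_VR.2 ⟨_, _, rfl⟩⟩)
      · right; left
        rw [hj]
        exact mem_image_of_mem _ (C.mem_MW.2 ⟨hji, y, hyW, hy, hj⟩)
  · left
    exact mem_image_of_mem _ (mem_erase.2 ⟨hy.ne', C.mem_VR.2 ⟨_, _, rfl⟩⟩)

theorem card_VR_erase (i : ι) (s : Bool) :
    #(C.VR.erase (C.z i s)) + 1 = 2 * Fintype.card ι := by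
  rw [card_erase_add_one (C.mem_VR.2 ⟨_, _, rfl⟩), card_VR]

theorem cd_le (i : ι) (s : Bool) :
    #(C.cd (C.z i s)) + 1 ≤ 2 * Fintype.card ι + #(C.MW i s) + #(C.fcol (C.z i s)) := by
  have h1 := card_le_card (C.cd_sub i s)
  have h2 := card_union_le ((C.VR.erase (C.z i s)).image (C.col (C.z i s)))
    ((C.MW i s).image C.k ∪ C.fcol (C.z i s))
  have h3 := card_union_le ((C.MW i s).image C.k) (C.fcol (C.z i s))
  have h4 : #((C.VR.erase (C.z i s)).image (C.col (C.z i s))) ≤ _ := card_image_le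
  have h5 : #((C.MW i s).image C.k) ≤ _ := card_image_le
  have h6 := C.card_VR_erase i s
  omega

theorem MW_le (i : ι) (s : Bool) : #(C.MW i s) + 1 ≤ Fintype.card ι := by
  have : C.MW i s ⊆ univ.erase i := by
    intro j hj
    exact mem_erase.2 ⟨(C.mem_MW.1 hj).1, mem_univ _⟩
  have h := card_le_card this
  rw [card_erase_of_mem (mem_univ _), card_univ] at h
  have : 0 < Fintype.card ι := Fintype.card_pos_iff.2 ⟨i⟩
  omega

theorem MW_FN_le (i : ι) (s : Bool) : #(C.MW i s) + #(C.FN (C.z i s)) ≤ #C.W := by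
  have h1 : #(C.MW i s) ≤ #(C.W \ C.FN (C.z i s)) := by
    have : (C.MW i s).image C.k ⊆ (C.W \ C.FN (C.z i s)).image (C.col (C.z i s)) := by
      intro γ hγ
      obtain ⟨j, hj, rfl⟩ := mem_image.1 hγ
      obtain ⟨_, w, hw, ha, hc⟩ := C.mem_MW.1 hj
      rw [← hc]
      refine mem_image_of_mem _ (mem_sdiff.2 ⟨hw, fun h => ?_⟩)
      exact (C.mem_FN.1 h).2.2 j hc
    have h := (card_le_card this).trans card_image_le
    rwa [card_image_of_injective _ (fun a b h => C.kinj a b h)] at h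
  have h2 : C.FN (C.z i s) ⊆ C.W := filter_subset _ _
  rw [card_sdiff_of_subset h2] at h1
  have := card_le_card h2
  omega

end Conf




namespace Conf

open Finset
open scoped Classical

variable {U : Type u} {ι : Type v} [Fintype U] [Fintype ι] (C : Conf U ι)

/-- Avoiding few elements. -/
theorem exists_avoid {α : Type*} (S T : Finset α) (h : #T < #S) : ∃ x ∈ S, x ∉ T :=
  exists_mem_notMem_of_card_lt_card h

theorem A1' {i : ι} {s : Bool} {w w' : U} (hw : w ∈ C.FN (C.z i s)) (hw' : w' ∈ C.FN (C.z i !s))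
    (h : w ≠ w') : C.col (C.z i s) w = C.col (C.z i !s) w' := by
  obtain ⟨h1, h2, h3⟩ := C.mem_FN.1 hw
  obtain ⟨h4, h5, h6⟩ := C.mem_FN.1 hw'
  exact C.A1 i s w w' (C.mem_W.1 h1) (C.mem_W.1 h4) h h2 h5 h3 h6

theorem fcol_one {i : ι} {s : Bool} (h : 3 ≤ #(C.FN (C.z i s))) : #(C.fcol (C.z i !s)) ≤ 1 := by
  rw [card_le_one]
  intro a ha b hb
  obtain ⟨w1, hw1, rfl⟩ := C.mem_fcol.1 ha
  obtain ⟨w2, hw2, rfl⟩ := C.mem_fcol.1 hb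
  obtain ⟨w, hw, hn⟩ := exists_avoid (C.FN (C.z i s)) {w1, w2}
    (lt_of_le_of_lt card_le_two (by omega))
  simp only [mem_insert, mem_singleton, not_or] at hn
  rw [← C.A1' hw hw1 hn.1, ← C.A1' hw hw2 hn.2]

theorem fcol_subset {i : ι} {s : Bool} (h : 2 ≤ #(C.FN (C.z i !s))) :
    C.fcol (C.z i s) ⊆ C.fcol (C.z i !s) := by
  intro a ha
  obtain ⟨w, hw, rfl⟩ := C.mem_fcol.1 ha
  obtain ⟨w', hw', hn⟩ := exists_avoid (C.FN (C.z i !s)) {w} (by rw [card_singleton]; omega)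
  rw [mem_singleton] at hn
  exact C.mem_fcol.2 ⟨w', hw', (C.A1' hw hw' (Ne.symm hn)).symm⟩

theorem fcol_two {i : ι} {s : Bool} (h : 1 ≤ #(C.FN (C.z i !s))) : #(C.fcol (C.z i s)) ≤ 2 := by
  obtain ⟨w', hw'⟩ := card_pos.1 h
  have : C.fcol (C.z i s) ⊆ {C.col (C.z i !s) w', C.col (C.z i s) w'} := by
    intro a ha
    obtain ⟨w, hw, rfl⟩ := C.mem_fcol.1 ha
    by_cases hww : w = w'
    · simp [hww]
    · simp [C.A1' hw hw' hww]
  exact (card_le_card this).trans card_le_two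

theorem small_aux (i : ι) (s : Bool) (h : ∀ s, #(C.FN (C.z i s)) ≤ 3)
    (hs : #(C.FN (C.z i !s)) ≤ #(C.FN (C.z i s))) :
    #(C.Inc i) + #(C.fcol (C.z i s)) + #(C.fcol (C.z i !s)) ≤ 8 ∧
    (#(C.FN (C.z i !s)) ≤ 1 →
      #(C.Inc i) + #(C.fcol (C.z i s)) + #(C.fcol (C.z i !s)) ≤ 7) := by
  have h1 := C.card_Inc_le i s
  have h2 := C.fcol_le (C.z i s)
  have h3 := C.fcol_le (C.z i !s)
  have h4 := h s
  have h5 := h (!s)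
  by_cases h6 : #(C.FN (C.z i s)) + #(C.FN (C.z i !s)) ≤ 4
  · refine ⟨by omega, fun h7 => ?_⟩
    by_cases h8 : 1 ≤ #(C.FN (C.z i !s))
    · have := C.fcol_two h8
      omega
    · omega
  · have h7 : #(C.fcol (C.z i !s)) ≤ 1 := C.fcol_one (by omega)
    have h8 := card_le_card (C.fcol_subset (i := i) (s := s) (by omega))
    refine ⟨by omega, by omega⟩

theorem small (i : ι) (h : ∀ s, #(C.FN (C.z i s)) ≤ 3) :
    #(C.Inc i) + #(C.fcol (C.z i false)) + #(C.fcol (C.z i true)) ≤ 8 ∧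
    ((∃ s, #(C.FN (C.z i s)) ≤ 1) →
      #(C.Inc i) + #(C.fcol (C.z i false)) + #(C.fcol (C.z i true)) ≤ 7) := by
  rcases le_total (#(C.FN (C.z i true))) (#(C.FN (C.z i false))) with h0 | h0
  · have := C.small_aux i false h h0
    refine ⟨this.1, fun ⟨s, hs⟩ => this.2 ?_⟩
    cases s
    · exact h0.trans hs
    · exact hs
  · have := C.small_aux i true h h0
    simp only [Bool.not_true] at this
    refine ⟨by omega, fun ⟨s, hs⟩ => ?_⟩
    have h3 : #(C.FN (C.z i false)) ≤ 1 := by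
      cases s
      · exact hs
      · exact h0.trans hs
    have := this.2 h3
    omega

/-- The free edges at `x` to the outside have color `γ`, with one possible exception. -/
def NM (x : U) (γ : ℕ) : Prop := #((C.FN x).filter (fun w => C.col x w ≠ γ)) ≤ 1

theorem NM_of {x : U} {γ : ℕ} (w : U) (h : ∀ v ∈ C.FN x, v ≠ w → C.col x v = γ) : C.NM x γ := by
  have : (C.FN x).filter (fun w => C.col x w ≠ γ) ⊆ {w} := by
    intro v hv
    rw [mem_filter] at hv
    rw [mem_singleton]
    by_contra h1
    exact hv.2 (h v hv.1 h1)
  exact (card_le_card this).trans (by simp)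

theorem NM_unique {x : U} {γ γ' : ℕ} (h : 4 ≤ #(C.FN x)) (h1 : C.NM x γ) (h2 : C.NM x γ') :
    γ = γ' := by
  by_contra hne
  have : C.FN x ⊆ (C.FN x).filter (fun w => C.col x w ≠ γ) ∪
      (C.FN x).filter (fun w => C.col x w ≠ γ') := by
    intro w hw
    rw [mem_union, mem_filter, mem_filter]
    by_cases h3 : C.col x w = γ
    · right; exact ⟨hw, by rw [h3]; exact hne⟩
    · left; exact ⟨hw, h3⟩
  have h3 := (card_le_card this).trans (card_union_le _ _)
  unfold NM at h1 h2
  omega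

theorem NM_fcol {x : U} {γ : ℕ} (h1 : C.NM x γ) : #(C.fcol x) ≤ 2 := by
  have : C.fcol x ⊆ insert γ (((C.FN x).filter (fun w => C.col x w ≠ γ)).image (C.col x)) := by
    intro a ha
    obtain ⟨w, hw, rfl⟩ := C.mem_fcol.1 ha
    rw [mem_insert]
    by_cases h : C.col x w = γ
    · exact Or.inl h
    · exact Or.inr (mem_image_of_mem _ (mem_filter.2 ⟨hw, h⟩))
  have h2 := (card_le_card this).trans (card_insert_le _ _)
  have h3 : #(((C.FN x).filter (fun w => C.col x w ≠ γ)).image (C.col x)) ≤ _ := card_image_le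
  unfold NM at h1
  omega

theorem NM_of_mem {i : ι} {s : Bool} {w : U} (hw : w ∈ C.FN (C.z i !s)) :
    C.NM (C.z i s) (C.col (C.z i !s) w) :=
  C.NM_of w (fun _ hv hne => C.A1' hv hw hne)

theorem compat {x x' : U} (w : U) (hx : 4 ≤ #(C.FN x)) (hx' : 4 ≤ #(C.FN x'))
    (h : ∀ w1 ∈ C.FN x, ∀ w2 ∈ C.FN x', w ≠ w1 → w ≠ w2 → w1 ≠ w2 →
      C.col x w1 = C.col x' w2) : ∃ γ, C.NM x γ ∧ C.NM x' γ := by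
  obtain ⟨w0, hw0, hn0⟩ := exists_avoid (C.FN x') {w} (by rw [card_singleton]; omega)
  rw [mem_singleton] at hn0
  have key : ∀ v ∈ C.FN x', v ≠ w → C.col x' v = C.col x' w0 := by
    intro v hv hvw
    obtain ⟨w1, hw1, hn1⟩ := exists_avoid (C.FN x) {w, v, w0} (lt_of_le_of_lt card_le_three hx)
    simp only [mem_insert, mem_singleton, not_or] at hn1
    rw [← h w1 hw1 v hv (Ne.symm hn1.1) (Ne.symm hvw) hn1.2.1,
      ← h w1 hw1 w0 hw0 (Ne.symm hn1.1) (Ne.symm hn0) hn1.2.2]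
  refine ⟨C.col x' w0, C.NM_of w ?_, C.NM_of w key⟩
  intro v hv hvw
  obtain ⟨w1, hw1, hn1⟩ := exists_avoid (C.FN x') {w, v}
    (lt_of_le_of_lt card_le_two (by omega))
  simp only [mem_insert, mem_singleton, not_or] at hn1
  rw [← key w1 hw1 hn1.1]
  exact h v hv w1 hw1 (Ne.symm hvw) (Ne.symm hn1.1) (Ne.symm hn1.2)

/-- Matching edges with an endpoint seeing many free edges. -/
noncomputable def F : Finset ι := univ.filter (fun i => ∃ s, 4 ≤ #(C.FN (C.z i s)))

noncomputable def o (i : ι) : Bool := if 4 ≤ #(C.FN (C.z i true)) then true else false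

noncomputable def xx (i : ι) : U := C.z i (C.o i)

noncomputable def yy (i : ι) : U := C.z i (!C.o i)

theorem xx_big {i : ι} (hi : i ∈ C.F) : 4 ≤ #(C.FN (C.xx i)) := by
  obtain ⟨s, hs⟩ := (mem_filter.1 hi).2
  unfold xx o
  by_cases h : 4 ≤ #(C.FN (C.z i true))
  · rw [if_pos h]; exact h
  · rw [if_neg h]
    cases s
    · exact hs
    · exact absurd hs h

theorem not_F {i : ι} (hi : i ∉ C.F) (s : Bool) : #(C.FN (C.z i s)) ≤ 3 := by
  by_contra h
  exact hi (mem_filter.2 ⟨mem_univ _, s, by omega⟩)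

noncomputable def gam (i : ι) : Finset ℕ := (C.fcol (C.xx i)).filter (fun γ => C.NM (C.xx i) γ)

noncomputable def mates (i : ι) : Finset ι :=
  C.F.filter (fun j => j ≠ i ∧ ∃ γ, C.NM (C.xx i) γ ∧ C.NM (C.xx j) γ)

noncomputable def lost (i : ι) : Finset (ι × Bool) :=
  univ.filter (fun p => p.1 ∉ C.F ∧ i ∈ C.MW p.1 (!p.2))

theorem gam_le {i : ι} (hi : i ∈ C.F) : #(C.gam i) ≤ 1 := by
  rw [card_le_one]
  intro a ha b hb
  exact C.NM_unique (C.xx_big hi) (mem_filter.1 ha).2 (mem_filter.1 hb).2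

theorem mem_gam {i : ι} {γ : ℕ} (hi : i ∈ C.F) (h : C.NM (C.xx i) γ) : γ ∈ C.gam i := by
  refine mem_filter.2 ⟨?_, h⟩
  have h1 := C.xx_big hi
  have h2 := card_filter_add_card_filter_not (s := C.FN (C.xx i)) (fun w => C.col (C.xx i) w = γ)
  have h3 : #((C.FN (C.xx i)).filter (fun w => ¬ C.col (C.xx i) w = γ)) ≤ 1 := h
  obtain ⟨w, hw⟩ := card_pos.1 (show 0 < #((C.FN (C.xx i)).filter
    (fun w => C.col (C.xx i) w = γ)) by omega)
  rw [mem_filter] at hw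
  exact C.mem_fcol.2 ⟨w, hw.1, hw.2⟩

theorem mem_mates {i j : ι} (hi : i ∈ C.F) (hj : j ∈ C.F) (hij : j ≠ i) (w : U)
    (h : ∀ w1 ∈ C.FN (C.xx i), ∀ w2 ∈ C.FN (C.xx j), w ≠ w1 → w ≠ w2 → w1 ≠ w2 →
      C.col (C.xx i) w1 = C.col (C.xx j) w2) : j ∈ C.mates i :=
  mem_filter.2 ⟨hj, hij, C.compat w (C.xx_big hi) (C.xx_big hj) h⟩

theorem yy_sub {i : ι} (hi : i ∈ C.F) : C.cd (C.yy i) ⊆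
    (univ \ C.F).image C.k ∪ ({C.k i} ∪ (C.gam i ∪ ((C.mates i).image C.k ∪
    ((univ.filter (fun p : ι × Bool => p.1 ≠ i)) \ C.lost i).image
      (fun p => C.col (C.yy i) (C.z p.1 p.2))))) := by
  intro γ hγ
  obtain ⟨v, hv, rfl⟩ := C.mem_cd.1 hγ
  simp only [mem_union]
  have hB : ∀ j, j ∉ C.F → C.k j ∈ (univ \ C.F).image C.k := fun j hj =>
    mem_image_of_mem _ (mem_sdiff.2 ⟨mem_univ _, hj⟩)
  rcases C.mem_W_or v with hvW | ⟨j, t, rfl⟩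
  · by_cases hf : C.fr (C.col (C.yy i) v)
    · right; right; left
      exact C.mem_gam hi (C.NM_of_mem (C.mem_FN.2 ⟨hvW, hv, hf⟩))
    · unfold fr at hf; push Not at hf
      obtain ⟨j, hj⟩ := hf
      rw [hj]
      by_cases hji : j = i
      · right; left; rw [hji]; exact mem_singleton_self _
      by_cases hjF : j ∈ C.F
      · right; right; right; left
        refine mem_image_of_mem _ (C.mem_mates hi hjF hji v ?_)
        intro w1 hw1 w2 hw2 h1 h2 h3
        obtain ⟨a1, a2, a3⟩ := C.mem_FN.1 hw1
        obtain ⟨b1, b2, b3⟩ := C.mem_FN.1 hw2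
        exact C.A3 i j (C.o i) (C.o j) v w1 w2 (Ne.symm hji) (C.mem_W.1 hvW) (C.mem_W.1 a1)
          (C.mem_W.1 b1) h1 h2 h3 hv hj a2 a3 b2 b3
      · left; exact hB j hjF
  · by_cases hji : j = i
    · right; left
      subst hji
      have ht : t = !(!C.o j) := by
        by_contra h
        have : t = !C.o j := by
          revert h; cases t <;> cases C.o j <;> simp
        rw [this] at hv
        exact hv.ne rfl
      rw [ht, mem_singleton]
      exact C.zcol j (!C.o j)
    by_cases hl : (j, t) ∈ C.lost i
    · obtain ⟨_, hjF, hM⟩ := mem_filter.1 hl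
      obtain ⟨_, w, hw, ha, hc⟩ := C.mem_MW.1 hM
      simp only at hjF ha hc
      have htt : (!(!t)) = t := by simp
      by_cases hf : C.fr (C.col (C.yy i) (C.z j t))
      · right; right; left
        refine C.mem_gam hi (C.NM_of w fun w1 hw1 hne => ?_)
        obtain ⟨a1, a2, a3⟩ := C.mem_FN.1 hw1
        have := C.A2 i j (C.o i) (!t) w w1 (Ne.symm hji) (C.mem_W.1 hw) (C.mem_W.1 a1)
          (Ne.symm hne) ha hc (by rw [htt]; exact hv) (by rw [htt]; exact hf) a2 a3
        rw [htt] at this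
        exact this
      · unfold fr at hf; push Not at hf
        obtain ⟨l, hj⟩ := hf
        rw [hj]
        by_cases hli : l = i
        · right; left; rw [hli]; exact mem_singleton_self _
        by_cases hlF : l ∈ C.F
        · right; right; right; left
          refine mem_image_of_mem _ (C.mem_mates hi hlF hli w ?_)
          intro w1 hw1 w2 hw2 h1 h2 h3
          obtain ⟨a1, a2, a3⟩ := C.mem_FN.1 hw1
          obtain ⟨b1, b2, b3⟩ := C.mem_FN.1 hw2
          exact C.A4 i l j (C.o i) (C.o l) (!t) w w1 w2 (Ne.symm hli) hji
            (fun h => hjF (h ▸ hlF)) (C.mem_W.1 hw) (C.mem_W.1 a1)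
            (C.mem_W.1 b1) h1 h2 h3 (by rw [htt]; exact hv) (by rw [htt]; exact hj) ha hc
            a2 a3 b2 b3
        · left; exact hB l hlF
    · right; right; right; right
      exact mem_image_of_mem (fun p : ι × Bool => C.col (C.yy i) (C.z p.1 p.2))
        (mem_sdiff.2 ⟨mem_filter.2 ⟨mem_univ (j, t), hji⟩, hl⟩)

noncomputable def be : ℕ := #(univ \ C.F)

theorem be_add : C.be + #C.F = Fintype.card ι := by
  unfold be
  rw [card_sdiff_add_card_eq_card (subset_univ _), card_univ]

theorem card_ne (i : ι) :
    #(univ.filter (fun p : ι × Bool => p.1 ≠ i)) + 2 = 2 * Fintype.card ι := by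
  have h : univ.filter (fun p : ι × Bool => p.1 ≠ i) = (univ.erase i) ×ˢ univ := by
    ext ⟨j, t⟩
    simp
  rw [h, card_product, card_erase_of_mem (mem_univ _), card_univ, card_univ, Fintype.card_bool]
  have : 0 < Fintype.card ι := Fintype.card_pos_iff.2 ⟨i⟩
  omega

theorem yy_le {i : ι} (hi : i ∈ C.F) : #(C.cd (C.yy i)) + 1 + #(C.lost i) ≤
    3 * C.be + 2 * #C.F + #(C.mates i) + #(C.gam i) := by
  have h1 := card_le_card (C.yy_sub hi)
  have h2 : C.lost i ⊆ univ.filter (fun p : ι × Bool => p.1 ≠ i) := by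
    intro p hp
    obtain ⟨_, h, _⟩ := mem_filter.1 hp
    exact mem_filter.2 ⟨mem_univ _, fun h' => h (h' ▸ hi)⟩
  have h3 := card_ne (ι := ι) i
  have h4 := card_sdiff_add_card_eq_card h2
  have h5 := C.be_add
  have e1 := card_union_le ((univ \ C.F).image C.k) ({C.k i} ∪ (C.gam i ∪
    ((C.mates i).image C.k ∪ ((univ.filter (fun p : ι × Bool => p.1 ≠ i)) \ C.lost i).image
      (fun p => C.col (C.yy i) (C.z p.1 p.2)))))
  have e2 := card_union_le {C.k i} (C.gam i ∪
    ((C.mates i).image C.k ∪ ((univ.filter (fun p : ι × Bool => p.1 ≠ i)) \ C.lost i).image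
      (fun p => C.col (C.yy i) (C.z p.1 p.2))))
  have e3 := card_union_le (C.gam i)
    ((C.mates i).image C.k ∪ ((univ.filter (fun p : ι × Bool => p.1 ≠ i)) \ C.lost i).image
      (fun p => C.col (C.yy i) (C.z p.1 p.2)))
  have e4 := card_union_le ((C.mates i).image C.k)
    (((univ.filter (fun p : ι × Bool => p.1 ≠ i)) \ C.lost i).image
      (fun p => C.col (C.yy i) (C.z p.1 p.2)))
  have f1 : #((univ \ C.F).image C.k) ≤ C.be := card_image_le
  have f2 : #((C.mates i).image C.k) ≤ _ := card_image_le
  have f3 : #(((univ.filter (fun p : ι × Bool => p.1 ≠ i)) \ C.lost i).image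
      (fun p => C.col (C.yy i) (C.z p.1 p.2))) ≤ _ := card_image_le
  have f4 : #({C.k i} : Finset ℕ) = 1 := card_singleton _
  omega

end Conf




namespace Conf

open Finset
open scoped Classical

variable {U : Type u} {ι : Type v} [Fintype U] [Fintype ι] (C : Conf U ι)

theorem sum_lost : ∑ i ∈ C.F, #(C.lost i) = ∑ j ∈ univ \ C.F,
    (#(C.F.filter (fun i => i ∈ C.MW j false)) + #(C.F.filter (fun i => i ∈ C.MW j true))) := by
  have h := sum_card_bipartiteAbove_eq_sum_card_bipartiteBelow
    (s := C.F) (t := (univ \ C.F) ×ˢ (univ : Finset Bool))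
    (fun (i : ι) (p : ι × Bool) => i ∈ C.MW p.1 (!p.2))
  have h1 : ∀ i, bipartiteAbove (fun (i : ι) (p : ι × Bool) => i ∈ C.MW p.1 (!p.2))
      ((univ \ C.F) ×ˢ (univ : Finset Bool)) i = C.lost i := by
    intro i
    ext p
    simp [bipartiteAbove, lost]
  simp only [h1] at h
  rw [h, sum_product]
  refine sum_congr rfl fun j _ => ?_
  simp [bipartiteBelow]

theorem MW_split (j : ι) (hj : j ∉ C.F) (s : Bool) :
    #(C.MW j s) + 1 ≤ #(C.F.filter (fun i => i ∈ C.MW j s)) + C.be := by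
  have h : C.MW j s ⊆ C.F.filter (fun i => i ∈ C.MW j s) ∪ (univ \ C.F).erase j := by
    intro i hi
    rw [mem_union, mem_filter, mem_erase, mem_sdiff]
    by_cases hF : i ∈ C.F
    · exact Or.inl ⟨hF, hi⟩
    · exact Or.inr ⟨(C.mem_MW.1 hi).1, mem_univ _, hF⟩
  have h1 := (card_le_card h).trans (card_union_le _ _)
  have h2 : j ∈ univ \ C.F := mem_sdiff.2 ⟨mem_univ _, hj⟩
  have h3 := card_erase_add_one h2
  unfold be
  omega

theorem small_edge (j : ι) (hj : j ∉ C.F) :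
    #(C.cd (C.z j false)) + #(C.cd (C.z j true)) + #(C.Inc j) ≤
    4 * Fintype.card ι + 2 * C.be + 4 +
    (#(C.F.filter (fun i => i ∈ C.MW j false)) + #(C.F.filter (fun i => i ∈ C.MW j true))) := by
  have h1 := C.cd_le j false
  have h2 := C.cd_le j true
  have h3 := (C.small j (C.not_F hj)).1
  have h4 := C.MW_split j hj false
  have h5 := C.MW_split j hj true
  omega

theorem big_edge (i : ι) (hi : i ∈ C.F) :
    #(C.cd (C.z i false)) + #(C.cd (C.z i true)) + 2 + #(C.lost i) ≤
    4 * Fintype.card ι + C.be +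
    (#(C.MW i (C.o i)) + #(C.fcol (C.xx i)) + #(C.mates i) + #(C.gam i)) := by
  have h1 : #(C.cd (C.xx i)) + 1 ≤ _ := C.cd_le i (C.o i)
  have h2 := C.yy_le hi
  have h3 := C.be_add
  have h4 : #(C.cd (C.z i false)) + #(C.cd (C.z i true)) =
      #(C.cd (C.xx i)) + #(C.cd (C.yy i)) := by
    unfold xx yy
    cases C.o i
    · rfl
    · exact add_comm _ _
  change _ ≤ _ + #(C.fcol (C.xx i)) at h1
  omega

/-- Color classes of near-monochromatic big edges. -/
noncomputable def K (γ : ℕ) : Finset ι := C.F.filter (fun i => C.NM (C.xx i) γ)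

theorem mem_K {γ : ℕ} {i : ι} : i ∈ C.K γ ↔ i ∈ C.F ∧ C.NM (C.xx i) γ := by simp [K]

theorem yy_col {γ : ℕ} {i : ι} (hi : i ∈ C.K γ) {w : U} (hw : w ∈ C.FN (C.yy i)) :
    C.col (C.yy i) w = γ := by
  obtain ⟨h1, h2⟩ := C.mem_K.1 hi
  exact C.NM_unique (C.xx_big h1) (C.NM_of_mem hw) h2

theorem Inc_eq' (i : ι) : C.Inc i = C.inc (C.xx i) ∪ C.inc (C.yy i) := C.Inc_eq i (C.o i)

theorem K_Inc (γ : ℕ) : #((C.K γ).biUnion C.Inc) ≤ #C.W + #(C.K γ) := by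
  have hsub : (C.K γ).biUnion C.Inc ⊆ C.W.image (fun w => (w, γ)) ∪
      (C.K γ).biUnion (fun i => ((C.FN (C.xx i)).filter (fun w => C.col (C.xx i) w ≠ γ)).image
        (fun w => (w, C.col (C.xx i) w))) := by
    rintro ⟨w, δ⟩ hp
    obtain ⟨i, hi, hp⟩ := mem_biUnion.1 hp
    rw [Inc_eq', mem_union, mem_inc, mem_inc] at hp
    rw [mem_union]
    rcases hp with ⟨h1, h2⟩ | ⟨h1, h2⟩
    · simp only at h1 h2
      by_cases hd : δ = γ
      · left
        rw [hd]
        exact mem_image_of_mem (fun w => (w, γ)) (C.mem_FN.1 h1).1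
      · right
        rw [mem_biUnion]
        refine ⟨i, hi, ?_⟩
        rw [← h2]
        exact mem_image_of_mem (fun w => (w, C.col (C.xx i) w))
          (mem_filter.2 ⟨h1, by rw [h2]; exact hd⟩)
    · left
      simp only at h1 h2
      rw [← h2, C.yy_col hi h1]
      exact mem_image_of_mem (fun w => (w, γ)) (C.mem_FN.1 h1).1
  refine (card_le_card hsub).trans ((card_union_le _ _).trans ?_)
  gcongr
  · exact card_image_le
  · refine (card_biUnion_le_card_mul _ _ 1 fun i hi => ?_).trans (by simp)
    exact card_image_le.trans (C.mem_K.1 hi).2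

theorem mates_le {γ : ℕ} {i : ι} (hi : i ∈ C.K γ) : #(C.mates i) + 1 ≤ #(C.K γ) := by
  obtain ⟨h1, h2⟩ := C.mem_K.1 hi
  rw [← card_erase_add_one hi]
  refine Nat.succ_le_succ (card_le_card fun j hj => ?_)
  obtain ⟨hj1, hj2, δ, hj3, hj4⟩ := mem_filter.1 hj
  rw [C.NM_unique (C.xx_big h1) hj3 h2] at hj4
  exact mem_erase.2 ⟨hj2, C.mem_K.2 ⟨hj1, hj4⟩⟩

theorem yy_three {γ : ℕ} {i : ι} (hi : i ∈ C.K γ) (h : 3 ≤ #(C.FN (C.yy i))) :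
    #(C.MW i (C.o i)) + 1 ≤ C.be + #(C.K γ) := by
  have hsub : C.MW i (C.o i) ⊆ (univ \ C.F) ∪ (C.K γ).erase i := by
    intro j hj
    obtain ⟨hji, w, hw, ha, hc⟩ := C.mem_MW.1 hj
    rw [mem_union, mem_erase, mem_sdiff]
    by_cases hjF : j ∈ C.F
    · refine Or.inr ⟨hji, C.mem_K.2 ⟨hjF, C.NM_of w fun w2 hw2 hne => ?_⟩⟩
      obtain ⟨w1, hw1, hn⟩ := exists_avoid (C.FN (C.yy i)) {w, w2}
        (lt_of_le_of_lt card_le_two (by omega))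
      simp only [mem_insert, mem_singleton, not_or] at hn
      obtain ⟨a1, a2, a3⟩ := C.mem_FN.1 hw1
      obtain ⟨b1, b2, b3⟩ := C.mem_FN.1 hw2
      have hoo : (!(!C.o i)) = C.o i := by simp
      rw [← C.yy_col hi hw1]
      exact (C.A3 i j (!C.o i) (C.o j) w w1 w2 (Ne.symm hji) (C.mem_W.1 hw) (C.mem_W.1 a1)
        (C.mem_W.1 b1) (Ne.symm hn.1) (Ne.symm hne) hn.2 (by rw [hoo]; exact ha)
        (by rw [hoo]; exact hc) a2 a3 b2 b3).symm
    · exact Or.inl ⟨mem_univ _, hjF⟩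
  have h1 := (card_le_card hsub).trans (card_union_le _ _)
  have h2 := card_erase_add_one hi
  unfold be
  omega

theorem K_sum (γ : ℕ) (hN : 2 * Fintype.card ι ≤ #C.W) (hne : (C.K γ).Nonempty) :
    #((C.K γ).biUnion C.Inc) +
    ∑ i ∈ C.K γ, (#(C.MW i (C.o i)) + #(C.fcol (C.xx i)) + #(C.mates i) + #(C.gam i)) ≤
    #(C.K γ) * (#C.W + 5 + C.be) := by
  have hpos := hne.card_pos
  have hI := C.K_Inc γ
  by_cases h1 : #(C.K γ) = 1
  · obtain ⟨i, hi⟩ := card_eq_one.1 h1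
    have hiK : i ∈ C.K γ := by rw [hi]; exact mem_singleton_self _
    have hm := C.mates_le hiK
    have hf := C.NM_fcol (C.mem_K.1 hiK).2
    have hg := C.gam_le (C.mem_K.1 hiK).1
    have hy : 3 ≤ #(C.FN (C.yy i)) → _ := C.yy_three hiK
    rw [h1] at hm hI hy ⊢
    rw [hi, singleton_biUnion] at hI ⊢
    rw [sum_singleton]
    by_cases h3 : 3 ≤ #(C.FN (C.yy i))
    · have := hy h3
      omega
    · have h4 : #(C.Inc i) ≤ #(C.FN (C.xx i)) + #(C.FN (C.yy i)) := C.card_Inc_le i (C.o i)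
      have h5 : #(C.MW i (C.o i)) + #(C.FN (C.xx i)) ≤ #C.W := C.MW_FN_le i (C.o i)
      omega
  · have hs : ∑ i ∈ C.K γ, (#(C.MW i (C.o i)) + #(C.fcol (C.xx i)) + #(C.mates i) + #(C.gam i)) ≤
        #(C.K γ) * (Fintype.card ι + #(C.K γ) + 1) := by
      rw [← smul_eq_mul]
      refine sum_le_card_nsmul _ _ _ fun i hi => ?_
      have hm := C.mates_le hi
      have hf := C.NM_fcol (C.mem_K.1 hi).2
      have hg := C.gam_le (C.mem_K.1 hi).1
      have hw := C.MW_le i (C.o i)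
      omega
    have hgb : #(C.K γ) ≤ Fintype.card ι := card_le_univ _
    generalize #(C.K γ) = g at *
    generalize Fintype.card ι = b at *
    generalize #C.W = N at *
    generalize C.be = β at *
    obtain ⟨g', rfl⟩ : ∃ g', g = g' + 2 := ⟨g - 2, by omega⟩
    obtain ⟨b', rfl⟩ : ∃ b', b = g' + 2 + b' := ⟨b - (g' + 2), by omega⟩
    obtain ⟨N', rfl⟩ : ∃ N', N = 2 * (g' + 2 + b') + N' := ⟨N - 2 * (g' + 2 + b'), by omega⟩
    refine (Nat.add_le_add hI hs).trans ?_
    nlinarith [Nat.zero_le (g' * b'), Nat.zero_le (g' * N'), Nat.zero_le (g' * β),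
      Nat.zero_le (g' * g')]

theorem F_sum (a : ℕ) (hN : 2 * Fintype.card ι ≤ #C.W)
    (ha : ∀ i s, #(C.fcol (C.z i s)) ≤ 2 * a + 5) :
    #(C.F.biUnion C.Inc) +
    ∑ i ∈ C.F, (#(C.MW i (C.o i)) + #(C.fcol (C.xx i)) + #(C.mates i) + #(C.gam i)) ≤
    #C.F * (#C.W + 2 * a + 5 + C.be) := by
  set f : ι → ℕ := fun i => #(C.MW i (C.o i)) + #(C.fcol (C.xx i)) + #(C.mates i) + #(C.gam i)
    with hf
  set L := #C.W + 2 * a + 5 + C.be with hL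
  set Q := C.F.filter (fun i => ∀ γ, ¬ C.NM (C.xx i) γ) with hQ
  set Γ := C.F.biUnion C.gam with hΓ
  have hdisj : (Γ : Set ℕ).PairwiseDisjoint C.K := by
    intro γ _ δ _ hne
    rw [Function.onFun, disjoint_left]
    intro i hi hi'
    exact hne (C.NM_unique (C.xx_big (C.mem_K.1 hi).1) (C.mem_K.1 hi).2 (C.mem_K.1 hi').2)
  have hFdec : C.F = Q ∪ Γ.biUnion C.K := by
    ext i
    rw [mem_union, hQ, mem_filter, mem_biUnion]
    constructor
    · intro hi
      by_cases h : ∃ γ, C.NM (C.xx i) γ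
      · obtain ⟨γ, hγ⟩ := h
        exact Or.inr ⟨γ, mem_biUnion.2 ⟨i, hi, C.mem_gam hi hγ⟩, C.mem_K.2 ⟨hi, hγ⟩⟩
      · push Not at h
        exact Or.inl ⟨hi, h⟩
    · rintro (h | ⟨γ, _, h⟩)
      · exact h.1
      · exact (C.mem_K.1 h).1
  have hQd : Disjoint Q (Γ.biUnion C.K) := by
    rw [disjoint_left]
    intro i hi hi'
    obtain ⟨γ, _, h⟩ := mem_biUnion.1 hi'
    exact (mem_filter.1 hi).2 γ (C.mem_K.1 h).2
  have hQsum : #(Q.biUnion C.Inc) + ∑ i ∈ Q, f i ≤ #Q * L := by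
    refine (Nat.add_le_add_right card_biUnion_le _).trans ?_
    rw [← sum_add_distrib, ← smul_eq_mul]
    refine sum_le_card_nsmul _ _ _ fun i hi => ?_
    obtain ⟨hiF, hn⟩ := mem_filter.1 hi
    have h1 : #(C.Inc i) ≤ #(C.FN (C.xx i)) + #(C.FN (C.yy i)) := C.card_Inc_le i (C.o i)
    have h2 : #(C.MW i (C.o i)) + #(C.FN (C.xx i)) ≤ #C.W := C.MW_FN_le i (C.o i)
    have h3 : C.FN (C.yy i) = ∅ := by
      rw [eq_empty_iff_forall_notMem]
      intro w hw
      exact hn _ (C.NM_of_mem hw)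
    have h4 : C.mates i = ∅ := by
      rw [eq_empty_iff_forall_notMem]
      intro w hw
      obtain ⟨_, _, γ, hγ, _⟩ := mem_filter.1 hw
      exact hn γ hγ
    have h5 : C.gam i = ∅ := by
      rw [eq_empty_iff_forall_notMem]
      intro w hw
      exact hn _ (mem_filter.1 hw).2
    have h6 : #(C.fcol (C.xx i)) ≤ 2 * a + 5 := ha i (C.o i)
    rw [h3, card_empty] at h1
    simp only [hf, h4, h5, card_empty]
    omega
  have hKsum : #((Γ.biUnion C.K).biUnion C.Inc) + ∑ i ∈ Γ.biUnion C.K, f i ≤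
      #(Γ.biUnion C.K) * L := by
    rw [sum_biUnion hdisj, card_biUnion (fun x hx y hy h => hdisj hx hy h), biUnion_biUnion,
      sum_mul]
    refine (Nat.add_le_add_right card_biUnion_le _).trans ?_
    rw [← sum_add_distrib]
    refine sum_le_sum fun γ hγ => ?_
    have hne : (C.K γ).Nonempty := by
      obtain ⟨i, hi, hg⟩ := mem_biUnion.1 hγ
      exact ⟨i, C.mem_K.2 ⟨hi, (mem_filter.1 hg).2⟩⟩
    refine (C.K_sum γ hN hne).trans ?_
    exact Nat.mul_le_mul_left _ (by omega)
  have e1 : #(C.F.biUnion C.Inc) ≤ #(Q.biUnion C.Inc) + #((Γ.biUnion C.K).biUnion C.Inc) := by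
    rw [hFdec, union_biUnion]
    exact card_union_le _ _
  have e2 : ∑ i ∈ C.F, f i = ∑ i ∈ Q, f i + ∑ i ∈ Γ.biUnion C.K, f i := by
    conv_lhs => rw [hFdec]
    rw [sum_union hQd]
  have e3 : #C.F = #Q + #(Γ.biUnion C.K) := by
    conv_lhs => rw [hFdec]
    rw [card_union_of_disjoint hQd]
  rw [e2, e3, add_mul]
  omega

theorem count (a : ℕ) (hN : 2 * Fintype.card ι ≤ #C.W)
    (ha : ∀ i s, #(C.fcol (C.z i s)) ≤ 2 * a + 5) :
    ∑ u, #(C.cd u) + 2 * #C.F ≤ Fintype.card ι * #C.W +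
      C.be * (4 * Fintype.card ι + 2 * C.be + 4) + #C.F * (4 * Fintype.card ι + C.be) +
      #C.F * (#C.W + 2 * a + 5 + C.be) := by
  have h1 := C.sum_W
  have h2 := C.F_sum a hN ha
  have h3 : ∑ j ∈ univ \ C.F, (#(C.cd (C.z j false)) + #(C.cd (C.z j true)) + #(C.Inc j)) ≤
      C.be * (4 * Fintype.card ι + 2 * C.be + 4) + ∑ i ∈ C.F, #(C.lost i) := by
    refine (sum_le_sum fun j hj => C.small_edge j (mem_sdiff.1 hj).2).trans ?_
    rw [sum_add_distrib, sum_const, smul_eq_mul, ← sum_lost, be]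
  have h4 := sum_le_sum fun i hi => C.big_edge i hi
  rw [sum_add_distrib, sum_add_distrib, sum_add_distrib, sum_add_distrib, sum_const, sum_const, smul_eq_mul,
    smul_eq_mul] at h4
  rw [sum_add_distrib] at h3
  have h5 : #(univ.biUnion C.Inc) ≤ #(C.F.biUnion C.Inc) + ∑ j ∈ univ \ C.F, #(C.Inc j) := by
    have : univ = C.F ∪ (univ \ C.F) := by simp
    rw [this, union_biUnion]
    refine (card_union_le _ _).trans ?_
    gcongr
    rw [← this]
    exact card_biUnion_le
  rw [C.sum_split]
  have h6 := sum_sdiff (subset_univ C.F)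
    (f := fun i => #(C.cd (C.z i false)) + #(C.cd (C.z i true)))
  rw [← h6]
  simp only [sum_add_distrib] at *
  omega

/-- A vertex of the matching with the largest possible number of colors. -/
theorem tight {i : ι} {s : Bool}
    (h : 2 * Fintype.card ι + #(C.MW i s) + #(C.fcol (C.z i s)) ≤ #(C.cd (C.z i s)) + 1)
    (hM : Fintype.card ι ≤ #(C.MW i s) + 1) {j : ι} (hj : j ≠ i) (t : Bool) :
    C.H.Adj (C.z i s) (C.z j t) ∧ C.fr (C.col (C.z i s) (C.z j t)) ∧
    C.col (C.z i s) (C.z j t) ∉ C.fcol (C.z i s) := by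
  have hMW : ∀ l, l ≠ i → l ∈ C.MW i s := by
    have hsub : C.MW i s ⊆ univ.erase i := fun l hl =>
      mem_erase.2 ⟨(C.mem_MW.1 hl).1, mem_univ _⟩
    have : C.MW i s = univ.erase i := by
      refine eq_of_subset_of_card_le hsub ?_
      rw [card_erase_of_mem (mem_univ _), card_univ]
      omega
    intro l hl
    rw [this]
    exact mem_erase.2 ⟨hl, mem_univ _⟩
  have hvV : C.z j t ∈ C.VR.erase (C.z i s) :=
    mem_erase.2 ⟨fun h => hj (C.zinj _ _ _ _ h).1, C.mem_VR.2 ⟨_, _, rfl⟩⟩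
  set S := ((C.VR.erase (C.z i s)).erase (C.z j t)).image (C.col (C.z i s)) ∪
    ((C.MW i s).image C.k ∪ C.fcol (C.z i s)) with hS
  have hxS : C.k i ∈ S := by
    rw [hS, mem_union]
    left
    rw [← C.zcol i s]
    refine mem_image_of_mem _ (mem_erase.2 ⟨fun h => hj (C.zinj _ _ _ _ h).1.symm,
      mem_erase.2 ⟨(C.zadj i s).ne', C.mem_VR.2 ⟨_, _, rfl⟩⟩⟩)
  have hkS : ∀ l, C.k l ∈ S := by
    intro l
    by_cases hl : l = i
    · rw [hl]; exact hxS
    · rw [hS, mem_union, mem_union]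
      exact Or.inr (Or.inl (mem_image_of_mem _ (hMW l hl)))
  have hcard : #S < #(C.cd (C.z i s)) := by
    have h2 := card_union_le (((C.VR.erase (C.z i s)).erase (C.z j t)).image (C.col (C.z i s)))
      ((C.MW i s).image C.k ∪ C.fcol (C.z i s))
    have h3 := card_union_le ((C.MW i s).image C.k) (C.fcol (C.z i s))
    have h4 : #(((C.VR.erase (C.z i s)).erase (C.z j t)).image (C.col (C.z i s))) ≤ _ :=
      card_image_le
    have h5 : #((C.MW i s).image C.k) ≤ _ := card_image_le
    have h6 := C.card_VR_erase i s
    have h7 := card_erase_add_one hvV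
    rw [hS]
    omega
  obtain ⟨γ, hγ, hn⟩ := exists_avoid _ _ hcard
  obtain ⟨v, hv, rfl⟩ := C.mem_cd.1 hγ
  have hfr : C.fr (C.col (C.z i s) v) := fun l hl => hn (hl ▸ hkS l)
  have hnf : C.col (C.z i s) v ∉ C.fcol (C.z i s) := fun hl => hn (by
    rw [hS, mem_union, mem_union]; exact Or.inr (Or.inr hl))
  have hveq : v = C.z j t := by
    rcases C.mem_W_or v with hvW | ⟨l, r, rfl⟩
    · exact absurd (C.mem_fcol.2 ⟨v, C.mem_FN.2 ⟨hvW, hv, hfr⟩, rfl⟩) hnf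
    · by_contra hne
      refine hn ?_
      rw [hS, mem_union]
      left
      exact mem_image_of_mem _ (mem_erase.2 ⟨hne, mem_erase.2 ⟨hv.ne', C.mem_VR.2 ⟨_, _, rfl⟩⟩⟩)
  subst hveq
  exact ⟨hv, hfr, hnf⟩

theorem strict (hF : C.F = ∅) (hb : 2 ≤ Fintype.card ι) :
    ∑ u, #(C.cd u) < Fintype.card ι * #C.W + Fintype.card ι * (6 * Fintype.card ι + 4) := by
  by_contra hcon
  push Not at hcon
  have h1 := C.sum_W
  have h5 : #(univ.biUnion C.Inc) ≤ ∑ j, #(C.Inc j) := card_biUnion_le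
  rw [C.sum_split] at hcon
  have hq : ∀ j s, #(C.FN (C.z j s)) ≤ 3 := fun j s => C.not_F (by rw [hF]; simp) s
  have hle : ∀ j ∈ univ, #(C.cd (C.z j false)) + #(C.cd (C.z j true)) + #(C.Inc j) ≤
      6 * Fintype.card ι + 4 := by
    intro j _
    have h1 := C.cd_le j false
    have h2 := C.cd_le j true
    have h3 := (C.small j (hq j)).1
    have h4 := C.MW_le j false
    have h5 := C.MW_le j true
    omega
  have hsum : ∑ j, (#(C.cd (C.z j false)) + #(C.cd (C.z j true)) + #(C.Inc j)) =
      ∑ _j : ι, (6 * Fintype.card ι + 4) := by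
    refine le_antisymm (sum_le_sum hle) ?_
    rw [sum_const, smul_eq_mul, card_univ, sum_add_distrib]
    omega
  have heq := (sum_eq_sum_iff_of_le hle).1 hsum
  have hall : ∀ j s, Fintype.card ι ≤ #(C.MW j s) + 1 ∧
      2 * Fintype.card ι + #(C.MW j s) + #(C.fcol (C.z j s)) ≤ #(C.cd (C.z j s)) + 1 ∧
      2 ≤ #(C.FN (C.z j s)) := by
    intro j s
    have h0 := heq j (mem_univ _)
    have h1 := C.cd_le j false
    have h2 := C.cd_le j true
    have h3 := C.small j (hq j)
    have h4 := C.MW_le j false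
    have h5 := C.MW_le j true
    refine ⟨?_, ?_, ?_⟩
    · cases s <;> omega
    · cases s <;> omega
    · by_contra hlt
      have := h3.2 ⟨s, by omega⟩
      omega
  obtain ⟨i, j, hij⟩ := Fintype.one_lt_card_iff.1 (show 1 < Fintype.card ι by omega)
  obtain ⟨_, b2, _⟩ := hall j false
  obtain ⟨a1, a2, a3⟩ := hall i true
  obtain ⟨_, _, c3⟩ := hall i false
  obtain ⟨t1, t2, t3⟩ := C.tight a2 a1 (Ne.symm hij) true
  have hMW : i ∈ C.MW j false := by
    have hsub : C.MW j false ⊆ univ.erase j := fun l hl =>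
      mem_erase.2 ⟨(C.mem_MW.1 hl).1, mem_univ _⟩
    have : C.MW j false = univ.erase j := by
      refine eq_of_subset_of_card_le hsub ?_
      rw [card_erase_of_mem (mem_univ _), card_univ]
      have := (hall j false).1
      omega
    rw [this]
    exact mem_erase.2 ⟨hij, mem_univ _⟩
  obtain ⟨_, w, hw, ha, hc⟩ := C.mem_MW.1 hMW
  obtain ⟨w1, hw1, hn1⟩ := exists_avoid (C.FN (C.z i false)) {w} (by rw [card_singleton]; omega)
  obtain ⟨v, hv, hnv⟩ := exists_avoid (C.FN (C.z i true)) {w1} (by rw [card_singleton]; omega)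
  rw [mem_singleton] at hn1 hnv
  obtain ⟨d1, d2, d3⟩ := C.mem_FN.1 hw1
  have e1 := C.A2 i j false false w w1 hij (C.mem_W.1 hw) (C.mem_W.1 d1) (Ne.symm hn1) ha hc
    t1 t2 d2 d3
  have e2 := C.A1' (i := i) (s := false) hw1 hv (Ne.symm hnv)
  simp only [Bool.not_false] at e1 e2
  exact t3 (C.mem_fcol.2 ⟨v, hv, by rw [← e2, e1]⟩)

end Conf




namespace Conf

open Finset
open scoped Classical

/-- The exchange property. -/
def Exch {U : Type u} {ι : Type v} (H : SimpleGraph U) (col : U → U → ℕ) (z : ι → Bool → U)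
    (k : ι → ℕ) : Prop :=
  ∀ (L : List (U × U)) (D : Finset ι) (S : Finset U) (T : Finset ℕ), #S ≤ 3 → #T ≤ 2 →
    (∀ w ∈ S, ∀ i s, w ≠ z i s) → (∀ γ ∈ T, ∀ j, γ ≠ k j) →
    (∀ p ∈ L, H.Adj p.1 p.2) → (L.flatMap (fun p => [p.1, p.2])).Nodup →
    (L.map (fun p => col p.1 p.2)).Nodup →
    (∀ p ∈ L, (p.1 ∈ S ∨ ∃ i ∈ D, ∃ s, p.1 = z i s) ∧ (p.2 ∈ S ∨ ∃ i ∈ D, ∃ s, p.2 = z i s) ∧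
      (col p.1 p.2 ∈ T ∨ ∃ i ∈ D, col p.1 p.2 = k i)) →
    L.length ≤ #D

theorem exA0 {U : Type u} {ι : Type v} {H : SimpleGraph U} {col : U → U → ℕ} {z : ι → Bool → U}
    {k : ι → ℕ} (hE : Exch H col z k)
    :
    ∀ w w', (∀ i s, w ≠ z i s) → (∀ i s, w' ≠ z i s) → H.Adj w w' →
    ∃ i, col w w' = k i := by
  intro w w' hw hw' ha
  by_contra hcon
  push Not at hcon
  have := hE [(w, w')] ∅ {w, w'} {col w w'} (card_le_two.trans (by norm_num)) (by simp)
    (by simp [hw, hw']) (by simpa using hcon) (by simpa using ha) (by simpa using ha.ne)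
    (by simp) (by simp)
  simp at this

theorem exA1 {U : Type u} {ι : Type v} {H : SimpleGraph U} {col : U → U → ℕ} {z : ι → Bool → U}
    {k : ι → ℕ} (hE : Exch H col z k)
    (zinj : ∀ i s j t, z i s = z j t → i = j ∧ s = t) :
    ∀ i s w w', (∀ i s, w ≠ z i s) → (∀ i s, w' ≠ z i s) → w ≠ w' →
    H.Adj (z i s) w → H.Adj (z i !s) w' →
    (∀ j, col (z i s) w ≠ k j) → (∀ j, col (z i !s) w' ≠ k j) →
    col (z i s) w = col (z i !s) w' := by
  intro i s w w' hw hw' hne a1 a2 f1 f2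
  by_contra hcon
  have hb : ∀ i s, z i s = z i false ∨ z i s = z i true := fun i s => by cases s <;> simp
  have hz : z i s ≠ z i !s := fun h => by simpa using (zinj _ _ _ _ h).2
  have := hE [(z i s, w), (z i !s, w')] {i} {w, w'} {col (z i s) w, col (z i !s) w'}
    (card_le_two.trans (by norm_num)) card_le_two
    (by simp [hw, hw']) (by simpa using ⟨f1, f2⟩) (by simpa using ⟨a1, a2⟩)
    (by have := hw i s; have := hw i !s; have := hw' i s; have := hw' i !s
        simp; grind)
    (by simp [hcon]) (by simp [hb])
  simp at this

theorem exA2 {U : Type u} {ι : Type v} {H : SimpleGraph U} {col : U → U → ℕ} {z : ι → Bool → U}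
    {k : ι → ℕ} (hE : Exch H col z k)
    (zinj : ∀ i s j t, z i s = z j t → i = j ∧ s = t) :
    ∀ i j s t w w1, i ≠ j → (∀ i s, w ≠ z i s) → (∀ i s, w1 ≠ z i s) → w ≠ w1 →
    H.Adj (z j t) w → col (z j t) w = k i →
    H.Adj (z i !s) (z j !t) → (∀ l, col (z i !s) (z j !t) ≠ k l) →
    H.Adj (z i s) w1 → (∀ l, col (z i s) w1 ≠ k l) →
    col (z i s) w1 = col (z i !s) (z j !t) := by
  intro i j s t w w1 hij hw hw1 hne a1 c1 a2 f2 a3 f3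
  by_contra hcon
  have hb : ∀ i s, z i s = z i false ∨ z i s = z i true := fun i s => by cases s <;> simp
  have hz : ∀ i s, z i s ≠ z i !s := fun i s h => by simpa using (zinj _ _ _ _ h).2
  have hz' : ∀ s t, z i s ≠ z j t := fun s t h => hij (zinj _ _ _ _ h).1
  have := hE [(z j t, w), (z i !s, z j !t), (z i s, w1)] {i, j} {w, w1}
    {col (z i !s) (z j !t), col (z i s) w1}
    (card_le_two.trans (by norm_num)) card_le_two
    (by simp [hw, hw1]) (by simpa using ⟨f2, f3⟩) (by simpa using ⟨a1, a2, a3⟩)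
    (by simp; grind)
    (by simp [c1]; grind) (by simp [c1, hb])
  rw [card_pair hij] at this
  simp at this

theorem exA3 {U : Type u} {ι : Type v} {H : SimpleGraph U} {col : U → U → ℕ} {z : ι → Bool → U}
    {k : ι → ℕ} (hE : Exch H col z k)
    (zinj : ∀ i s j t, z i s = z j t → i = j ∧ s = t) :
    ∀ i j s t w w1 w2, i ≠ j → (∀ i s, w ≠ z i s) → (∀ i s, w1 ≠ z i s) →
    (∀ i s, w2 ≠ z i s) → w ≠ w1 → w ≠ w2 → w1 ≠ w2 →
    H.Adj (z i !s) w → col (z i !s) w = k j →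
    H.Adj (z i s) w1 → (∀ l, col (z i s) w1 ≠ k l) →
    H.Adj (z j t) w2 → (∀ l, col (z j t) w2 ≠ k l) →
    col (z i s) w1 = col (z j t) w2 := by
  intro i j s t w w1 w2 hij hw hw1 hw2 n1 n2 n3 a1 c1 a2 f2 a3 f3
  by_contra hcon
  have hb : ∀ i s, z i s = z i false ∨ z i s = z i true := fun i s => by cases s <;> simp
  have hz : ∀ i s, z i s ≠ z i !s := fun i s h => by simpa using (zinj _ _ _ _ h).2
  have hz' : ∀ s t, z i s ≠ z j t := fun s t h => hij (zinj _ _ _ _ h).1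
  have := hE [(z i !s, w), (z i s, w1), (z j t, w2)] {i, j} {w, w1, w2}
    {col (z i s) w1, col (z j t) w2}
    card_le_three card_le_two
    (by simp [hw, hw1, hw2]) (by simpa using ⟨f2, f3⟩) (by simpa using ⟨a1, a2, a3⟩)
    (by simp; grind)
    (by simp [c1]; grind) (by simp [c1, hb])
  rw [card_pair hij] at this
  simp at this

theorem exA4 {U : Type u} {ι : Type v} {H : SimpleGraph U} {col : U → U → ℕ} {z : ι → Bool → U}
    {k : ι → ℕ} (hE : Exch H col z k)
    (zinj : ∀ i s j t, z i s = z j t → i = j ∧ s = t)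
    (kinj : ∀ i j, k i = k j → i = j) :
    ∀ i j l s t r w w1 w2, i ≠ j → l ≠ i → l ≠ j → (∀ i s, w ≠ z i s) →
    (∀ i s, w1 ≠ z i s) →
    (∀ i s, w2 ≠ z i s) → w ≠ w1 → w ≠ w2 → w1 ≠ w2 →
    H.Adj (z i !s) (z l !r) → col (z i !s) (z l !r) = k j →
    H.Adj (z l r) w → col (z l r) w = k i →
    H.Adj (z i s) w1 → (∀ l, col (z i s) w1 ≠ k l) →
    H.Adj (z j t) w2 → (∀ l, col (z j t) w2 ≠ k l) →
    col (z i s) w1 = col (z j t) w2 := by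
  intro i j l s t r w w1 w2 hij hli hlj hw hw1 hw2 n1 n2 n3 a0 c0 a1 c1 a2 f2 a3 f3
  by_contra hcon
  have hb : ∀ i s, z i s = z i false ∨ z i s = z i true := fun i s => by cases s <;> simp
  have hz : ∀ i s, z i s ≠ z i !s := fun i s h => by simpa using (zinj _ _ _ _ h).2
  have hz1 : ∀ s t, z i s ≠ z j t := fun s t h => hij (zinj _ _ _ _ h).1
  have hz2 : ∀ s t, z l s ≠ z j t := fun s t h => hlj (zinj _ _ _ _ h).1
  have hz3 : ∀ s t, z l s ≠ z i t := fun s t h => hli (zinj _ _ _ _ h).1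
  have := hE [(z i !s, z l !r), (z l r, w), (z i s, w1), (z j t, w2)] {i, j, l} {w, w1, w2}
    {col (z i s) w1, col (z j t) w2}
    card_le_three card_le_two
    (by simp [hw, hw1, hw2]) (by simpa using ⟨f2, f3⟩) (by simpa using ⟨a0, a1, a2, a3⟩)
    (by simp; grind)
    (by have hk : k j ≠ k i := fun h => hij (kinj _ _ h).symm
        simp [c1, c0]; grind) (by simp [c1, c0, hb])
  have h3 : #({i, j, l} : Finset ι) ≤ 3 := card_le_three
  simp at this
  omega

end Conf




namespace RMaux

open Finset
open scoped Classical

variable {V : Type u} [Fintype V]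

/-- Vertices covered by a set of edges. -/
noncomputable def vs (M : Finset (Sym2 V)) : Finset V := univ.filter (fun v => ∃ e ∈ M, v ∈ e)

theorem mem_vs {M : Finset (Sym2 V)} {v : V} : v ∈ vs M ↔ ∃ e ∈ M, v ∈ e := by simp [vs]

theorem vs_union (M N : Finset (Sym2 V)) : vs (M ∪ N) = vs M ∪ vs N := by
  ext v
  simp only [mem_vs, mem_union]
  grind

theorem vs_single (a b : V) : vs {s(a, b)} = {a, b} := by
  ext v
  simp [mem_vs]

theorem vs_mono {M N : Finset (Sym2 V)} (h : M ⊆ N) : vs M ⊆ vs N := by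
  intro v hv
  obtain ⟨e, he, hve⟩ := mem_vs.1 hv
  exact mem_vs.2 ⟨e, h he, hve⟩

variable {G : SimpleGraph V} {c : Sym2 V → ℕ}

theorem rm_sub {M N : Finset (Sym2 V)} (hM : IsRainbowMatching G c M) (h : N ⊆ M) :
    IsRainbowMatching G c N :=
  ⟨fun _ he => hM.1 (h he), fun e he f hf => hM.2.1 e (h he) f (h hf),
    fun _ he _ hf => hM.2.2 (h he) (h hf)⟩

theorem rm_empty : IsRainbowMatching G c ∅ := ⟨by simp, by simp, by simp⟩

theorem rm_single {a b : V} (h : G.Adj a b) : IsRainbowMatching G c {s(a, b)} := by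
  refine ⟨by simpa using h, ?_, by simp⟩
  intro e he f hf hne
  rw [mem_singleton] at he hf
  exact absurd (he.trans hf.symm) hne

theorem rm_union {M N : Finset (Sym2 V)} (hM : IsRainbowMatching G c M)
    (hN : IsRainbowMatching G c N) (hv : Disjoint (vs M) (vs N))
    (hc : ∀ e ∈ M, ∀ f ∈ N, c e ≠ c f) :
    IsRainbowMatching G c (M ∪ N) ∧ #(M ∪ N) = #M + #N := by
  rw [disjoint_left] at hv
  refine ⟨⟨?_, ?_, ?_⟩, ?_⟩
  · intro e he
    rcases mem_union.1 he with h | h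
    · exact hM.1 h
    · exact hN.1 h
  · intro e he f hf hne v hve hvf
    rcases mem_union.1 he with h | h <;> rcases mem_union.1 hf with h' | h'
    · exact hM.2.1 e h f h' hne v hve hvf
    · exact hv (mem_vs.2 ⟨e, h, hve⟩) (mem_vs.2 ⟨f, h', hvf⟩)
    · exact hv (mem_vs.2 ⟨f, h', hvf⟩) (mem_vs.2 ⟨e, h, hve⟩)
    · exact hN.2.1 e h f h' hne v hve hvf
  · intro e he f hf hef
    rcases mem_union.1 he with h | h <;> rcases mem_union.1 hf with h' | h'
    · exact hM.2.2 h h' hef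
    · exact absurd hef (hc e h f h')
    · exact absurd hef.symm (hc f h' e h)
    · exact hN.2.2 h h' hef
  · refine card_union_of_disjoint (disjoint_left.2 fun e he he' => hc e he e he' rfl)

theorem list_rm (L : List (V × V)) (ha : ∀ p ∈ L, G.Adj p.1 p.2)
    (hv : (L.flatMap (fun p => [p.1, p.2])).Nodup)
    (hc : (L.map (fun p => c s(p.1, p.2))).Nodup) :
    ∃ M, IsRainbowMatching G c M ∧ #M = L.length ∧
      (∀ v ∈ vs M, v ∈ L.flatMap (fun p => [p.1, p.2])) ∧
      (∀ e ∈ M, c e ∈ L.map (fun p => c s(p.1, p.2))) := by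
  induction L with
  | nil => exact ⟨∅, rm_empty, by simp, by simp [vs], by simp⟩
  | cons p L ih =>
    simp only [List.flatMap_cons, List.map_cons, List.nodup_cons, List.cons_append,
      List.nil_append, List.mem_cons, not_or] at hv hc
    obtain ⟨M, h1, h2, h3, h4⟩ := ih (fun q hq => ha q (List.mem_cons_of_mem _ hq)) hv.2.2 hc.2
    have hu := rm_union (rm_single (c := c) (ha p List.mem_cons_self)) h1 (by
      rw [vs_single, disjoint_left]
      intro v hv1 hv2
      have := h3 v hv2
      rw [mem_insert, mem_singleton] at hv1
      rcases hv1 with rfl | rfl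
      · exact hv.1.2 this
      · exact hv.2.1 this) (by
      intro e he f hf hef
      rw [mem_singleton] at he
      rw [he] at hef
      apply hc.1
      rw [hef]
      exact h4 f hf)
    refine ⟨{s(p.1, p.2)} ∪ M, hu.1, ?_, ?_, ?_⟩
    · rw [hu.2, h2, card_singleton, List.length_cons, add_comm]
    · intro v hv1
      rw [vs_union, vs_single, mem_union, mem_insert, mem_singleton] at hv1
      simp only [List.flatMap_cons, List.cons_append, List.nil_append, List.mem_cons]
      rcases hv1 with (h | h) | h
      · exact Or.inl h
      · exact Or.inr (Or.inl h)
      · exact Or.inr (Or.inr (h3 v h))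
    · intro e he
      rw [mem_union, mem_singleton] at he
      rw [List.map_cons, List.mem_cons]
      rcases he with rfl | h
      · exact Or.inl rfl
      · exact Or.inr (h4 e h)

variable (G c)

/-- `X` can be robustly saturated by a rainbow matching compatible with `R`. -/
structure State (m : ℕ) (X : Finset V) (R : Finset (Sym2 V)) : Prop where
  rm : IsRainbowMatching G c R
  disj : Disjoint (vs R) X
  card : #X + #R = m
  rob : ∀ (S : Finset V) (T : Finset ℕ), #S ≤ 3 → Disjoint S X → #T ≤ 2 →
    ∃ N, IsRainbowMatching G c N ∧ #N = #X ∧ #(vs N \ X) ≤ #X ∧ Disjoint (vs N) (vs R) ∧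
      Disjoint (vs N) S ∧ ∀ e ∈ N, c e ∉ T ∧ ∀ f ∈ R, c e ≠ c f

variable {G c}

theorem state_init {M : Finset (Sym2 V)} (hM : IsRainbowMatching G c M) :
    State G c (#M) ∅ M :=
  ⟨hM, by simp, by simp, fun S T _ _ _ => ⟨∅, rm_empty, by simp, by simp [vs], by simp [vs],
    by simp [vs], by simp⟩⟩

theorem state_ext {m : ℕ} {X : Finset V} {R : Finset (Sym2 V)} (h : State G c m X R)
    {e : Sym2 V} (he : e ∈ R) {z : V} (hz : z ∈ e) (P : Finset ℕ) (hP : 2 * #X + 6 ≤ #P)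
    (hPw : ∀ γ ∈ P, ∃ w, w ∉ X ∧ w ∉ vs R ∧ G.Adj z w ∧ c s(z, w) = γ ∧ ∀ f ∈ R, γ ≠ c f) :
    State G c m (insert z X) (R.erase e) := by
  have hzR : z ∈ vs R := mem_vs.2 ⟨e, he, hz⟩
  have hzX : z ∉ X := fun hx => disjoint_left.1 h.disj hzR hx
  have hzR' : z ∉ vs (R.erase e) := by
    intro hz'
    obtain ⟨f, hf, hzf⟩ := mem_vs.1 hz'
    exact h.rm.2.1 f (mem_of_mem_erase hf) e he (ne_of_mem_erase hf) z hzf hz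
  refine ⟨rm_sub h.rm (erase_subset _ _), ?_, ?_, ?_⟩
  · rw [disjoint_left]
    intro v hv hv'
    rcases mem_insert.1 hv' with rfl | hv'
    · exact hzR' hv
    · exact disjoint_left.1 h.disj (vs_mono (erase_subset _ _) hv) hv'
  · rw [card_insert_of_notMem hzX, ← h.card, ← card_erase_add_one he]
    omega
  · intro S T hS hSX hT
    have hSX' : Disjoint S X := hSX.mono_right (subset_insert _ _)
    have hzS : z ∉ S := fun hz' => disjoint_left.1 hSX hz' (mem_insert_self _ _)
    obtain ⟨N, n1, n2, n3, n4, n5, n6⟩ := h.rob S T hS hSX' hT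
    have : Nonempty V := ⟨z⟩
    choose! w hw using hPw
    have hbad : ∃ γ ∈ P, γ ∉ (N.image c ∪ T) ∪ ((vs N \ X) ∪ S).image (fun v => c s(z, v)) := by
      apply exists_mem_notMem_of_card_lt_card
      have e1 := card_union_le (N.image c ∪ T) (((vs N \ X) ∪ S).image (fun v => c s(z, v)))
      have e2 := card_union_le (N.image c) T
      have e3 : #(((vs N \ X) ∪ S).image (fun v => c s(z, v))) ≤ _ := card_image_le
      have e4 := card_union_le (vs N \ X) S
      have e5 : #(N.image c) ≤ #N := card_image_le
      omega
    obtain ⟨γ, hγ, hn⟩ := hbad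
    obtain ⟨w1, w2, w3, w4, w5⟩ := hw γ hγ
    simp only [mem_union, not_or] at hn
    obtain ⟨⟨hn1, hn2⟩, hn3⟩ := hn
    have hwN : w γ ∉ vs N := fun hh => hn3 (by
      rw [← w4]
      exact mem_image_of_mem (fun v => c s(z, v)) (mem_union_left _ (mem_sdiff.2 ⟨hh, w1⟩)))
    have hwS : w γ ∉ S := fun hh => hn3 (by
      rw [← w4]
      exact mem_image_of_mem (fun v => c s(z, v)) (mem_union_right _ hh))
    have hzN : z ∉ vs N := fun hh => disjoint_left.1 n4 hh hzR
    obtain ⟨u1, u2⟩ := rm_union (rm_single (c := c) w3) n1 (by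
      rw [vs_single, disjoint_left]
      intro v hv1 hv2
      rw [mem_insert, mem_singleton] at hv1
      rcases hv1 with rfl | rfl
      · exact hzN hv2
      · exact hwN hv2) (by
      intro f hf g hg hfg
      rw [mem_singleton] at hf
      rw [hf, w4] at hfg
      exact hn1 (hfg ▸ mem_image_of_mem c hg))
    refine ⟨_, u1, ?_, ?_, ?_, ?_, ?_⟩
    · rw [u2, card_singleton, n2, card_insert_of_notMem hzX, add_comm]
    · have : vs ({s(z, w γ)} ∪ N) \ insert z X ⊆ insert (w γ) (vs N \ X) := by
        intro v hv
        rw [vs_union, vs_single] at hv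
        simp only [mem_sdiff, mem_union, mem_insert, mem_singleton, not_or] at hv ⊢
        tauto
      refine (card_le_card this).trans ((card_insert_le _ _).trans ?_)
      rw [card_insert_of_notMem hzX]
      omega
    · rw [vs_union, vs_single, disjoint_left]
      intro v hv hv'
      have hv'' := vs_mono (erase_subset _ _) hv'
      simp only [mem_union, mem_insert, mem_singleton] at hv
      rcases hv with (rfl | rfl) | hv
      · exact hzR' hv'
      · exact w2 hv''
      · exact disjoint_left.1 n4 hv hv''
    · rw [vs_union, vs_single, disjoint_left]
      intro v hv hv'
      simp only [mem_union, mem_insert, mem_singleton] at hv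
      rcases hv with (rfl | rfl) | hv
      · exact hzS hv'
      · exact hwS hv'
      · exact disjoint_left.1 n5 hv hv'
    · intro f hf
      rw [mem_union, mem_singleton] at hf
      rcases hf with rfl | hf
      · rw [w4]
        exact ⟨hn2, fun g hg => w5 g (mem_of_mem_erase hg)⟩
      · exact ⟨(n6 f hf).1, fun g hg => (n6 f hf).2 g (mem_of_mem_erase hg)⟩

theorem exchange {m : ℕ} {X : Finset V} {R : Finset (Sym2 V)} (h : State G c m X R)
    (hmax : ∀ M, IsRainbowMatching G c M → #M ≤ m)
    {D N : Finset (Sym2 V)} (hD : D ⊆ R) (hN : IsRainbowMatching G c N)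
    {S : Finset V} {T : Finset ℕ} (hS : #S ≤ 3) (hT : #T ≤ 2) (hSX : Disjoint S X)
    (hSR : Disjoint S (vs R)) (hTR : ∀ γ ∈ T, ∀ f ∈ R, γ ≠ c f)
    (hNv : ∀ v ∈ vs N, v ∈ S ∨ v ∈ vs D) (hNc : ∀ e ∈ N, c e ∈ T ∨ ∃ f ∈ D, c e = c f) :
    #N ≤ #D := by
  obtain ⟨Q, n1, n2, n3, n4, n5, n6⟩ := h.rob S T hS hSX hT
  have hDR : Disjoint (vs (R \ D)) (vs D) := by
    rw [disjoint_left]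
    intro v hv hv'
    obtain ⟨e, he, hve⟩ := mem_vs.1 hv
    obtain ⟨f, hf, hvf⟩ := mem_vs.1 hv'
    rw [mem_sdiff] at he
    exact h.rm.2.1 e he.1 f (hD hf) (fun hh => he.2 (hh ▸ hf)) v hve hvf
  obtain ⟨u1, u2⟩ := rm_union (rm_sub h.rm (sdiff_subset (s := R) (t := D))) hN (by
    rw [disjoint_left]
    intro v hv hv'
    rcases hNv v hv' with h1 | h1
    · exact disjoint_left.1 hSR h1 (vs_mono sdiff_subset hv)
    · exact disjoint_left.1 hDR hv h1) (by
    intro e he f hf hef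
    rw [mem_sdiff] at he
    rcases hNc f hf with h1 | ⟨g, hg, h1⟩
    · exact hTR _ h1 e he.1 hef.symm
    · have := h.rm.2.2 he.1 (hD hg) (hef.trans h1)
      exact he.2 (this ▸ hg))
  obtain ⟨v1, v2⟩ := rm_union u1 n1 (by
    rw [vs_union, disjoint_left]
    intro v hv hv'
    rcases mem_union.1 hv with hv | hv
    · exact disjoint_left.1 n4 hv' (vs_mono sdiff_subset hv)
    · rcases hNv v hv with h1 | h1
      · exact disjoint_left.1 n5 hv' h1
      · exact disjoint_left.1 n4 hv' (vs_mono hD h1)) (by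
    intro e he f hf hef
    rcases mem_union.1 he with he | he
    · exact (n6 f hf).2 e (sdiff_subset he) hef.symm
    · rcases hNc e he with h1 | ⟨g, hg, h1⟩
      · exact (n6 f hf).1 (hef ▸ h1)
      · exact (n6 f hf).2 g (hD hg) (hef.symm.trans h1))
  have h1 := hmax _ v1
  have h2 := card_sdiff_add_card_eq_card hD
  have h3 := h.card
  omega

theorem exists_max_state {m : ℕ} {M : Finset (Sym2 V)} (hM : IsRainbowMatching G c M)
    (hm : #M = m) : ∃ X R, State G c m X R ∧ ∀ X' R', State G c m X' R' → #X' ≤ #X := by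
  obtain ⟨p, hp, hmax⟩ := exists_max_image
    (univ.filter (fun p : Finset V × Finset (Sym2 V) => State G c m p.1 p.2)) (fun p => #p.1)
    ⟨(∅, M), mem_filter.2 ⟨mem_univ _, hm ▸ state_init hM⟩⟩
  refine ⟨p.1, p.2, (mem_filter.1 hp).2, fun X' R' h => ?_⟩
  exact hmax (X', R') (mem_filter.2 ⟨mem_univ _, h⟩)

theorem colorDegree_eq (v : V) :
    colorDegree G c v = #((univ.filter (fun w => G.Adj v w)).image (fun w => c s(v, w))) := by
  unfold colorDegree
  rw [← Set.ncard_coe_finset]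
  congr 1
  ext γ
  simp only [Set.mem_image, Set.mem_ofPred_eq, coe_image, coe_filter, mem_univ, true_and]
  constructor
  · rintro ⟨e, ⟨he, hv⟩, rfl⟩
    obtain ⟨w, rfl⟩ := hv
    exact ⟨w, he, rfl⟩
  · rintro ⟨w, hw, rfl⟩
    exact ⟨s(v, w), ⟨hw, by simp⟩, rfl⟩

theorem colorDegree_le_degree (v : V) : colorDegree G c v ≤ G.degree v := by
  rw [colorDegree_eq]
  refine card_image_le.trans (le_of_eq ?_)
  rw [← SimpleGraph.card_neighborFinset_eq_degree]
  congr 1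
  ext w
  simp

end RMaux




namespace RMaux

open Finset
open scoped Classical

variable {V : Type u} [Fintype V]
variable {G : SimpleGraph V} {c : Sym2 V → ℕ}

theorem exists_z {X : Finset V} {R : Finset (Sym2 V)} (hd : Disjoint (vs R) X)
    (i : {e // e ∈ R}) : ∃ f : Bool → {v // v ∉ X}, s((f false).1, (f true).1) = i.1 := by
  obtain ⟨e, he⟩ := i
  induction e with
  | h a b =>
    have ha : a ∉ X := fun h => disjoint_left.1 hd (mem_vs.2 ⟨_, he, by simp⟩) h
    have hb : b ∉ X := fun h => disjoint_left.1 hd (mem_vs.2 ⟨_, he, by simp⟩) h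
    exact ⟨fun s => if s then ⟨b, hb⟩ else ⟨a, ha⟩, by simp⟩

theorem build {m : ℕ} {X : Finset V} {R : Finset (Sym2 V)} (h : State G c m X R)
    (hmax : ∀ M, IsRainbowMatching G c M → #M ≤ m)
    (hX : ∀ X' R', State G c m X' R' → #X' ≤ #X) :
    ∃ C : Conf {v // v ∉ X} {e // e ∈ R}, C.H = G.comap Subtype.val ∧
      (∀ x y, C.col x y = c s(x.1, y.1)) ∧ ∀ i s, #(C.fcol (C.z i s)) ≤ 2 * #X + 5 := by
  choose z hz using exists_z (X := X) (R := R) h.disj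
  have hz' : ∀ i s, s((z i s).1, (z i !s).1) = i.1 := by
    intro i s
    cases s
    · exact hz i
    · rw [Sym2.eq_swap]; exact hz i
  have hmem : ∀ i s, (z i s).1 ∈ i.1 := fun i s => by
    rw [← hz' i s]; simp
  have hmem' : ∀ (i : {e // e ∈ R}) (v : V), v ∈ i.1 → ∃ s, v = (z i s).1 := by
    intro i v hv
    rw [← hz i, Sym2.mem_iff] at hv
    rcases hv with hv | hv
    · exact ⟨_, hv⟩
    · exact ⟨_, hv⟩
  have zadj : ∀ i s, G.Adj (z i s).1 (z i !s).1 := by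
    intro i s
    rw [← SimpleGraph.mem_edgeSet, hz' i s]
    exact h.rm.1 i.2
  have zinj : ∀ i s j t, z i s = z j t → i = j ∧ s = t := by
    intro i s j t hh
    have hij : i = j := by
      by_contra hne
      exact h.rm.2.1 i.1 i.2 j.1 j.2 (fun h' => hne (Subtype.ext h')) (z i s).1 (hmem i s)
        (by rw [hh]; exact hmem j t)
    subst hij
    refine ⟨rfl, ?_⟩
    by_contra hne
    have ht : t = !s := by cases s <;> cases t <;> simp_all
    subst ht
    exact (zadj i s).ne (congrArg Subtype.val hh)
  have kinj : ∀ i j : {e // e ∈ R}, c i.1 = c j.1 → i = j := fun i j hh =>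
    Subtype.ext (h.rm.2.2 i.2 j.2 hh)
  have hE : Conf.Exch (G.comap (Subtype.val : {v // v ∉ X} → V))
      (fun x y => c s(x.1, y.1)) z (fun i => c i.1) := by
    intro L D S T hS hT hSz hTk hadj hnd hcd hp
    obtain ⟨N, n1, n2, n3, n4⟩ := list_rm (G := G) (c := c) (L.map (fun p => (p.1.1, p.2.1)))
      (by
        intro p hp
        obtain ⟨q, hq, rfl⟩ := List.mem_map.1 hp
        exact hadj q hq)
      (by
        have := hnd.map (Subtype.val_injective (p := fun v => v ∉ X))
        rw [List.map_flatMap] at this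
        rw [List.flatMap_map]
        exact this)
      (by
        rw [List.map_map]
        exact hcd)
    rw [List.length_map] at n2
    rw [← n2]
    have hDc : #(D.image Subtype.val) = #D := card_image_of_injective _ Subtype.val_injective
    rw [← hDc]
    have hzD : ∀ i ∈ D, ∀ s, (z i s).1 ∈ vs (D.image Subtype.val) := fun i hi s =>
      mem_vs.2 ⟨i.1, mem_image_of_mem _ hi, hmem i s⟩
    refine exchange h hmax (D := D.image Subtype.val) (S := S.image Subtype.val) (T := T)
      ?_ n1 (card_image_le.trans hS) hT ?_ ?_ ?_ ?_ ?_
    · intro e he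
      obtain ⟨i, _, rfl⟩ := mem_image.1 he
      exact i.2
    · rw [disjoint_left]
      intro v hv
      obtain ⟨w, _, rfl⟩ := mem_image.1 hv
      exact w.2
    · rw [disjoint_left]
      intro v hv hv'
      obtain ⟨w, hw, rfl⟩ := mem_image.1 hv
      obtain ⟨e, he, hwe⟩ := mem_vs.1 hv'
      obtain ⟨s, hs⟩ := hmem' ⟨e, he⟩ _ hwe
      exact hSz w hw ⟨e, he⟩ s (Subtype.ext hs)
    · intro γ hγ f hf
      exact hTk γ hγ ⟨f, hf⟩
    · intro v hv
      have := n3 v hv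
      simp only [List.mem_flatMap, List.mem_map, List.mem_cons, List.not_mem_nil, or_false] at this
      obtain ⟨_, ⟨q, hq, rfl⟩, hv'⟩ := this
      obtain ⟨h1, h2, -⟩ := hp q hq
      rcases hv' with rfl | rfl
      · rcases h1 with h1 | ⟨i, hi, s, h1⟩
        · exact Or.inl (mem_image_of_mem _ h1)
        · right; rw [h1]; exact hzD i hi s
      · rcases h2 with h1 | ⟨i, hi, s, h1⟩
        · exact Or.inl (mem_image_of_mem _ h1)
        · right; rw [h1]; exact hzD i hi s
    · intro e he
      have := n4 e he
      rw [List.map_map] at this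
      obtain ⟨q, hq, hqe⟩ := List.mem_map.1 this
      rw [← hqe]
      rcases (hp q hq).2.2 with h1 | ⟨i, hi, h1⟩
      · exact Or.inl h1
      · exact Or.inr ⟨i.1, mem_image_of_mem _ hi, h1⟩
  let C : Conf {v // v ∉ X} {e // e ∈ R} :=
    { H := G.comap Subtype.val
      col := fun x y => c s(x.1, y.1)
      csymm := fun x y => by rw [Sym2.eq_swap]
      z := z
      k := fun i => c i.1
      zinj := zinj
      zadj := zadj
      zcol := fun i s => congrArg c (hz' i s)
      kinj := kinj
      A0 := Conf.exA0 hE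
      A1 := Conf.exA1 hE zinj
      A2 := Conf.exA2 hE zinj
      A3 := Conf.exA3 hE zinj
      A4 := Conf.exA4 hE zinj kinj }
  refine ⟨C, rfl, fun _ _ => rfl, ?_⟩
  intro i s
  by_contra hcon
  push Not at hcon
  have hst := state_ext h i.2 (hmem i s) (C.fcol (C.z i s)) (by omega) (by
    intro γ hγ
    obtain ⟨w, hw, hwγ⟩ := C.mem_fcol.1 hγ
    obtain ⟨w1, w2, w3⟩ := C.mem_FN.1 hw
    rw [C.mem_W] at w1
    refine ⟨w.1, w.2, ?_, w2, hwγ, ?_⟩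
    · intro hw'
      obtain ⟨e, he, hwe⟩ := mem_vs.1 hw'
      obtain ⟨t, ht⟩ := hmem' ⟨e, he⟩ _ hwe
      exact w1 ⟨e, he⟩ t (Subtype.ext ht)
    · intro f hf
      rw [← hwγ]
      exact w3 ⟨f, hf⟩)
  have := hX _ _ hst
  rw [card_insert_of_notMem (z i s).2] at this
  omega

theorem cdeg_le {X : Finset V} {R : Finset (Sym2 V)} (C : Conf {v // v ∉ X} {e // e ∈ R})
    (hH : C.H = G.comap Subtype.val) (hc : ∀ x y, C.col x y = c s(x.1, y.1))
    (x : {v // v ∉ X}) : colorDegree G c x.1 ≤ #(C.cd x) + #X := by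
  rw [colorDegree_eq]
  have : (univ.filter (fun w => G.Adj x.1 w)).image (fun w => c s(x.1, w)) ⊆
      C.cd x ∪ X.image (fun w => c s(x.1, w)) := by
    intro γ hγ
    obtain ⟨w, hw, rfl⟩ := mem_image.1 hγ
    rw [mem_filter] at hw
    by_cases hwX : w ∈ X
    · exact mem_union_right _ (mem_image_of_mem _ hwX)
    · refine mem_union_left _ (C.mem_cd.2 ⟨⟨w, hwX⟩, ?_, hc _ _⟩)
      rw [hH]
      exact hw.2
  exact (card_le_card this).trans ((card_union_le _ _).trans
    (Nat.add_le_add_left card_image_le _))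

theorem sum_le {X : Finset V} {R : Finset (Sym2 V)} (C : Conf {v // v ∉ X} {e // e ∈ R})
    (hH : C.H = G.comap Subtype.val) (hc : ∀ x y, C.col x y = c s(x.1, y.1)) :
    ∑ v, colorDegree G c v + #X ≤ #X * Fintype.card V +
      Fintype.card {v // v ∉ X} * #X + ∑ u, #(C.cd u) := by
  have h1 : ∑ v, colorDegree G c v = ∑ v ∈ X, colorDegree G c v +
      ∑ u : {v // v ∉ X}, colorDegree G c u.1 := by
    rw [← sum_add_sum_compl X]
    congr 1
    exact sum_subtype _ (by simp) _
  have h2 : ∑ v ∈ X, (colorDegree G c v + 1) ≤ ∑ v ∈ X, Fintype.card V :=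
    sum_le_sum fun v _ => lt_of_le_of_lt (colorDegree_le_degree v) (G.degree_lt_card_verts v)
  have h3 : ∑ u : {v // v ∉ X}, colorDegree G c u.1 ≤ ∑ u, (#(C.cd u) + #X) :=
    sum_le_sum fun u _ => cdeg_le C hH hc u
  rw [sum_add_distrib] at h2 h3
  simp only [sum_const, smul_eq_mul, card_univ, mul_one] at h2 h3
  omega

theorem core {m : ℕ} (hmax : ∀ M, IsRainbowMatching G c M → #M ≤ m)
    {M : Finset (Sym2 V)} (hM : IsRainbowMatching G c M) (hm : #M = m)
    (hn : 4 * m ≤ Fintype.card V) (hpos : 1 ≤ Fintype.card V)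
    (hD : (2 * m + 1) * Fintype.card V ≤ ∑ v, colorDegree G c v) :
    m = 1 ∧ Fintype.card V = 4 := by
  obtain ⟨X, R, hS, hX⟩ := exists_max_state hM hm
  obtain ⟨C, hH, hc, hf⟩ := build hS hmax hX
  have e1 := sum_le C hH hc
  have e2 := C.card_W
  have e3 : Fintype.card {v // v ∉ X} + #X = Fintype.card V := by
    have := Fintype.card_subtype_compl (fun v => v ∈ X)
    have h2 := card_le_univ X
    simp only [Fintype.card_coe] at this
    omega
  have e4 := hS.card
  have e5 : Fintype.card {e // e ∈ R} = #R := by simp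
  have e6 := C.be_add
  have hN : 2 * Fintype.card {e // e ∈ R} ≤ #C.W := by omega
  have e7 := C.count (#X) hN hf
  have e8 : #C.F = 0 → 2 ≤ #R → _ := fun h1 h2 => C.strict (card_eq_zero.1 h1) (by omega)
  rw [e5] at e2 e6 e7 e8 hN
  clear hf hc hH hX hS hM hmax
  generalize ∑ u, #(C.cd u) = Q at *
  generalize ∑ v, colorDegree G c v = Dg at *
  generalize #C.F = φ at *
  generalize C.be = β at *
  generalize #X = a at *
  generalize #R = b at *
  generalize Fintype.card {v // v ∉ X} = nU at *
  obtain ⟨N', hN'⟩ : ∃ N', #C.W = 3 * a + 2 * b + N' := ⟨#C.W - (3 * a + 2 * b), by omega⟩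
  generalize #C.W = W at *
  have hb : b = β + φ := by omega
  obtain rfl : nU = W + 2 * b := by omega
  have hn' : Fintype.card V = W + 2 * b + a := by omega
  rw [hn'] at e1 hD hpos hn ⊢
  subst hb hN' e4
  have key : N' * (β + 1) + a ^ 2 + 5 * a + 5 * a * β + φ ≤ 0 := by nlinarith
  have k1 : N' * (β + 1) = 0 := by nlinarith [Nat.zero_le (a ^ 2), Nat.zero_le (a * β), Nat.zero_le (N' * (β + 1))]
  have k2 : a = 0 := by nlinarith [Nat.zero_le (a ^ 2), Nat.zero_le (a * β), Nat.zero_le (N' * (β + 1))]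
  have k3 : φ = 0 := by nlinarith [Nat.zero_le (a ^ 2), Nat.zero_le (a * β), Nat.zero_le (N' * (β + 1))]
  have k4 : N' = 0 := by
    rcases Nat.mul_eq_zero.1 k1 with h | h
    · exact h
    · omega
  subst k2 k3 k4
  have k5 : β < 2 := by
    by_contra hcon
    have := e8 rfl (by omega)
    nlinarith
  interval_cases β
  · simp at hpos
  · simp

end RMaux




namespace RMaux

open Finset
open scoped Classical

variable {V : Type u} [Fintype V]
variable {G : SimpleGraph V} {c : Sym2 V → ℕ}

theorem fin4_fact : ∀ i j k l : Fin 4, i ≠ j → k ≠ l →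
    (i.val ^^^ j.val = k.val ^^^ l.val ↔
      (i = k ∧ j = l) ∨ (i = l ∧ j = k) ∨ (i ≠ k ∧ i ≠ l ∧ j ≠ k ∧ j ≠ l)) := by
  decide

theorem k4_case (hV : Fintype.card V = 4) (hD : 12 ≤ ∑ v, colorDegree G c v)
    (hmax : ∀ M, IsRainbowMatching G c M → #M ≤ 1) : IsK4Tilde G c := by
  have hle : ∀ v, colorDegree G c v ≤ 3 := fun v => by
    have h1 := colorDegree_le_degree (G := G) (c := c) v
    have h2 := G.degree_lt_card_verts v
    omega
  have heq : ∀ v, colorDegree G c v = 3 := by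
    have h1 : ∑ v, colorDegree G c v = ∑ v : V, 3 := by
      apply le_antisymm (sum_le_sum fun v _ => hle v)
      simpa [hV] using hD
    intro v
    exact (sum_eq_sum_iff_of_le (fun v _ => hle v)).1 h1 v (mem_univ v)
  have hnb : ∀ v, univ.filter (fun w => G.Adj v w) = univ.erase v := by
    intro v
    apply eq_of_subset_of_card_le
    · intro w hw
      rw [mem_filter] at hw
      exact mem_erase.2 ⟨hw.2.ne', mem_univ _⟩
    · rw [card_erase_of_mem (mem_univ v), card_univ, hV]
      have h1 := heq v
      rw [colorDegree_eq] at h1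
      have h2 : _ ≤ #(univ.filter (fun w => G.Adj v w)) :=
        card_image_le (f := fun w => c s(v, w))
      omega
  have hadj : ∀ u v, G.Adj u v ↔ u ≠ v := by
    intro u v
    have := Finset.ext_iff.1 (hnb u) v
    simp only [mem_filter, mem_univ, true_and, mem_erase, and_true] at this
    rw [this, ne_comm]
  have hinj : ∀ u v w, u ≠ v → u ≠ w → c s(u, v) = c s(u, w) → v = w := by
    intro u v w h1 h2 h3
    have h4 := heq u
    rw [colorDegree_eq] at h4
    have h5 : #(univ.filter (fun w => G.Adj u w)) = 3 := by
      rw [hnb, card_erase_of_mem (mem_univ u), card_univ, hV]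
    have h6 := card_image_iff.1 (h4.trans h5.symm)
    exact h6 (by simpa using (hadj u v).2 h1) (by simpa using (hadj u w).2 h2) h3
  have hdis : ∀ u v w x, u ≠ v → w ≠ x → u ≠ w → u ≠ x → v ≠ w → v ≠ x →
      c s(u, v) = c s(w, x) := by
    intro u v w x h1 h2 h3 h4 h5 h6
    by_contra hne
    obtain ⟨M, m1, m2, -, -⟩ := list_rm (G := G) (c := c) [(u, v), (w, x)]
      (by simp [hadj, h1, h2]) (by simp [h1, h2, h3, h4, h5, h6]) (by simpa using hne)
    have := hmax M m1
    simp at m2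
    omega
  refine ⟨Fintype.equivFinOfCardEq hV, hadj, ?_⟩
  intro u v w x h1 h2
  rw [hadj] at h1 h2
  generalize Fintype.equivFinOfCardEq hV = f
  have h3 := fin4_fact (f u) (f v) (f w) (f x) (f.injective.ne h1) (f.injective.ne h2)
  simp only [f.injective.eq_iff, ne_eq] at h3
  change _ ↔ (f u).val ^^^ (f v).val = (f w).val ^^^ (f x).val
  rw [h3]
  constructor
  · intro h4
    by_cases a1 : u = w
    · subst a1
      exact Or.inl ⟨rfl, hinj u v x h1 h2 h4⟩
    by_cases a2 : u = x
    · subst a2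
      rw [Sym2.eq_swap (a := w)] at h4
      exact Or.inr (Or.inl ⟨rfl, hinj u v w h1 h2.symm h4⟩)
    by_cases a3 : v = w
    · subst a3
      rw [Sym2.eq_swap (a := u)] at h4
      exact absurd (hinj v u x h1.symm h2 h4) a2
    by_cases a4 : v = x
    · subst a4
      rw [Sym2.eq_swap (a := u), Sym2.eq_swap (a := w)] at h4
      exact absurd (hinj v u w h1.symm h2.symm h4) a1
    exact Or.inr (Or.inr ⟨a1, a2, a3, a4⟩)
  · rintro (⟨rfl, rfl⟩ | ⟨rfl, rfl⟩ | ⟨a1, a2, a3, a4⟩)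
    · rfl
    · rw [Sym2.eq_swap]
    · exact hdis u v w x h1 h2 a1 a2 a3 a4

theorem sum_le_edges : ∑ v, colorDegree G c v ≤ 2 * G.edgeSet.ncard := by
  have h1 : ∑ v, colorDegree G c v ≤ ∑ v, G.degree v :=
    sum_le_sum fun v _ => colorDegree_le_degree v
  rw [SimpleGraph.sum_degrees_eq_twice_card_edges] at h1
  rwa [← SimpleGraph.coe_edgeFinset, Set.ncard_coe_finset]

theorem main_nat {k : ℕ} (hk : 1 ≤ k) (hpos : 1 ≤ Fintype.card V)
    (hD : (2 * k - 1) * Fintype.card V ≤ ∑ v, colorDegree G c v)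
    (hK4 : ¬ IsK4Tilde G c)
    (hno : ¬ ∃ M : Finset (Sym2 V), IsRainbowMatching G c M ∧ M.card = k) :
    Fintype.card V * (Fintype.card V + 3) ≤ 4 * G.edgeSet.ncard := by
  by_contra hcon
  push Not at hcon
  have h1 := sum_le_edges (G := G) (c := c)
  obtain ⟨p, hp, hmax⟩ := exists_max_image
    (univ.filter (fun M : Finset (Sym2 V) => IsRainbowMatching G c M)) (fun M => #M)
    ⟨∅, mem_filter.2 ⟨mem_univ _, rm_empty⟩⟩
  have hp' := (mem_filter.1 hp).2
  have hmax' : ∀ M, IsRainbowMatching G c M → #M ≤ #p := fun M hM =>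
    hmax M (mem_filter.2 ⟨mem_univ _, hM⟩)
  have hlt : #p < k := by
    by_contra hge
    push Not at hge
    obtain ⟨q, hq, hqk⟩ := exists_subset_card_eq hge
    exact hno ⟨q, rm_sub hp' hq, hqk⟩
  have hn : 4 * k < Fintype.card V + 5 := by
    have h2 : Fintype.card V * (2 * (2 * k - 1)) < Fintype.card V * (Fintype.card V + 3) := by
      calc _ = 2 * ((2 * k - 1) * Fintype.card V) := by ring
        _ ≤ 4 * G.edgeSet.ncard := by omega
        _ < _ := hcon
    have h3 := Nat.lt_of_mul_lt_mul_left h2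
    omega
  have hDm : (2 * #p + 1) * Fintype.card V ≤ ∑ v, colorDegree G c v :=
    (Nat.mul_le_mul_right _ (by omega)).trans hD
  obtain ⟨hm, hV⟩ := core hmax' hp' rfl (by omega) hpos hDm
  rw [hm] at hmax' hDm
  rw [hV] at hDm
  exact hK4 (k4_case hV (by omega) hmax')

end RMaux

theorem edge_count_of_counterexample
    {V : Type*} [Fintype V] (k : ℕ) (hk : 1 ≤ k)
    (G : SimpleGraph V) (c : Sym2 V → ℕ)
    (havg : (2 * (k : ℚ) - 1) ≤ (∑ v, (colorDegree G c v : ℚ)) / (Fintype.card V : ℚ))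
    (hK4 : ¬ IsK4Tilde G c)
    (hno : ¬ ∃ M : Finset (Sym2 V), IsRainbowMatching G c M ∧ M.card = k) :
    ((Fintype.card V : ℚ) ^ 2 / 4 + 3 * (Fintype.card V : ℚ) / 4 ≤ (G.edgeSet.ncard : ℚ)) := by
  have hk' : (1 : ℚ) ≤ k := by exact_mod_cast hk
  have hpos : 1 ≤ Fintype.card V := by
    by_contra h0
    have h0' : Fintype.card V = 0 := by omega
    rw [h0', Nat.cast_zero, div_zero] at havg
    linarith
  have hposQ : (0 : ℚ) < Fintype.card V := by exact_mod_cast hpos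
  rw [le_div_iff₀ hposQ] at havg
  have hD : (2 * k - 1) * Fintype.card V ≤ ∑ v, colorDegree G c v := by
    have : (((2 * k - 1) * Fintype.card V : ℕ) : ℚ) ≤ ((∑ v, colorDegree G c v : ℕ) : ℚ) := by
      push_cast [Nat.cast_sub (show 1 ≤ 2 * k by omega)]
      exact havg
    exact_mod_cast this
  have h := RMaux.main_nat hk hpos hD hK4 hno
  have h' : (Fintype.card V : ℚ) * (Fintype.card V + 3) ≤ 4 * G.edgeSet.ncard := by
    exact_mod_cast h
  linarith
end
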